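/- arXiv:1409.5017 — 2 statements merged into one kernel-verified Lean document; each statement's English description precedes it below -/
import Mathlib

section
/- Let A ∈ BH_n(F) and π ∈ F^×. Then (d_A + d_A^∨)² = 0 on R_A(F) ⊗ ⋀(F^n); more precisely d_A² = 0, (d_A^∨)² = 0, and d_A d_A^∨ + d_A^∨ d_A = 0. Hence B_A(F) = (R_A(F) ⊗ ⋀(F^n), d_A + d_A^∨) is a chain complex. -/
open scoped BigOperators TensorProduct
open Matrix Classical

noncomputable section

/-- The invertible-type polynomial `W_A = ∑ i, ∏ j, x_j ^ A i j`. -/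
def Wpoly (F : Type) [Field F] {ι : Type} [Fintype ι] (A : Matrix ι ι ℕ) :
    MvPolynomial ι F :=
  ∑ i, ∏ j, MvPolynomial.X j ^ A i j

/-- `A` is a Berglund–Hübsch matrix over the field `F`. -/
def IsBH (F : Type) [Field F] {ι : Type} [Fintype ι] [LinearOrder ι]
    (A : Matrix ι ι ℕ) : Prop :=
  (A.map ((↑) : ℕ → ℚ)).det ≠ 0 ∧
  (ringChar F = 0 ∨ ((A.map ((↑) : ℕ → ℤ)).det < (ringChar F : ℤ))) ∧
  (∃ q : ι → ℚ, (∀ j, 0 < q j) ∧ ∀ i, (∑ j, (A i j : ℚ) * q j) = 1) ∧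
  RingTheory.Sequence.IsRegular (MvPolynomial ι F)
    ((Finset.univ.sort (· ≤ ·)).map fun i => MvPolynomial.pderiv i (Wpoly F A))

/-- The model for the exterior algebra `⋀(Fⁿ)`: the free `F`-module on the standard
basis monomials `e_S = e_{s_1} ∧ … ∧ e_{s_k}`, `s_1 < … < s_k`, indexed by finite sets. -/
abbrev ExtV (F : Type) (ι : Type) := Finset ι → F

/-- Exterior multiplication by `e_i` on `⋀(Fⁿ)`. -/
def mulE (F : Type) [Field F] {ι : Type} [LinearOrder ι] (i : ι) :
    ExtV F ι →ₗ[F] ExtV F ι where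
  toFun f S := if i ∈ S then (-1 : F) ^ (S.filter (· < i)).card * f (S.erase i) else 0
  map_add' f g := by
    funext S
    by_cases h : i ∈ S <;> simp [h, mul_add]
  map_smul' a f := by
    funext S
    by_cases h : i ∈ S <;> simp [h, mul_left_comm]

/-- Contraction `e_i^∨` on `⋀(Fⁿ)`. -/
def contrE (F : Type) [Field F] {ι : Type} [LinearOrder ι] (i : ι) :
    ExtV F ι →ₗ[F] ExtV F ι where
  toFun f S := if i ∈ S then 0 else (-1 : F) ^ (S.filter (· < i)).card * f (insert i S)
  map_add' f g := by
    funext S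
    by_cases h : i ∈ S <;> simp [h, mul_add]
  map_smul' a f := by
    funext S
    by_cases h : i ∈ S <;> simp [h, mul_left_comm]

/-- `E_{A,i} = π ∑_j A_{ij} e_j`. -/
def EA (F : Type) [Field F] {ι : Type} [Fintype ι] [LinearOrder ι]
    (π : F) (A : Matrix ι ι ℕ) (i : ι) : ExtV F ι →ₗ[F] ExtV F ι :=
  π • ∑ j, (A i j : F) • mulE F j

/-- `E^∨_{A,i} = π⁻¹ ∑_j (A⁻¹)_{ji} e_j^∨`, the inverse matrix being computed over `F`. -/
def EAdual (F : Type) [Field F] {ι : Type} [Fintype ι] [LinearOrder ι]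
    (π : F) (A : Matrix ι ι ℕ) (i : ι) : ExtV F ι →ₗ[F] ExtV F ι :=
  π⁻¹ • ∑ j, ((A.map ((↑) : ℕ → F))⁻¹ j i) • contrE F j

/-- The element `E_{Aᵀ,1} E_{Aᵀ,2} ⋯ E_{Aᵀ,n} (1) ∈ ⋀(Fⁿ)`. -/
def starTop (F : Type) [Field F] {ι : Type} [Fintype ι] [LinearOrder ι]
    (π : F) (A : Matrix ι ι ℕ) : ExtV F ι :=
  (Finset.univ.sort (· ≤ ·)).foldr (fun i v => EA F π Aᵀ i v)
    (Pi.single (∅ : Finset ι) (1 : F))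

/-- Borisov's duality operator `*^A`, defined on the standard basis by
`*^A(e_{i_1} ∧ … ∧ e_{i_k}) = E^∨_{Aᵀ,i_1} ⋯ E^∨_{Aᵀ,i_k}(E_{Aᵀ,1} ⋯ E_{Aᵀ,n}(1))`. -/
def starA (F : Type) [Field F] {ι : Type} [Fintype ι] [LinearOrder ι]
    (π : F) (A : Matrix ι ι ℕ) : ExtV F ι →ₗ[F] ExtV F ι :=
  (Pi.basisFun F (Finset ι)).constr F fun S =>
    (S.sort (· ≤ ·)).foldr (fun i v => EAdual F π Aᵀ i v) (starTop F π A)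

/-- Index of a monomial `x^γ y^λ`. -/
abbrev MonIdx (ι : Type) := (ι → ℕ) × (ι → ℕ)

/-- The matrix `A` viewed over `ℚ`. -/
def Aq {ι : Type} [Fintype ι] [LinearOrder ι] (A : Matrix ι ι ℕ) : Matrix ι ι ℚ :=
  A.map ((↑) : ℕ → ℚ)

/-- The row vector `λ A⁻ᵀ`, computed over `ℚ`. -/
def lamRow {ι : Type} [Fintype ι] [LinearOrder ι] (A : Matrix ι ι ℕ) (lam : ι → ℕ) :
    ι → ℚ :=
  Matrix.vecMul (fun i => (lam i : ℚ)) ((Aq A)ᵀ)⁻¹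

/-- The row vector `γ A⁻¹`, computed over `ℚ`. -/
def gamRow {ι : Type} [Fintype ι] [LinearOrder ι] (A : Matrix ι ι ℕ) (gam : ι → ℕ) :
    ι → ℚ :=
  Matrix.vecMul (fun i => (gam i : ℚ)) (Aq A)⁻¹

/-- The allowed monomials `x^γ y^λ` of `R_A`: `(λA⁻ᵀ)_i ≥ 0` for all `i`, and
`γ A⁻¹ λᵀ = 0`. -/
def OKA {ι : Type} [Fintype ι] [LinearOrder ι] (A : Matrix ι ι ℕ) (m : MonIdx ι) : Prop :=
  (∀ i, 0 ≤ lamRow A m.2 i) ∧ (gamRow A m.1 ⬝ᵥ fun i => ((m.2 i : ℚ))) = 0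

/-- The space `R_A(F)`: the free `F`-module on the allowed monomials `x^γ y^λ`. -/
abbrev RMod (F : Type) [Field F] {ι : Type} [Fintype ι] [LinearOrder ι]
    (A : Matrix ι ι ℕ) := {m : MonIdx ι // OKA A m} →₀ F

/-- The monomial `x^γ y^λ` as an element of `R_A(F)` (`0` if not allowed). -/
def bE (F : Type) [Field F] {ι : Type} [Fintype ι] [LinearOrder ι]
    (A : Matrix ι ι ℕ) (m : MonIdx ι) : RMod F A :=
  if h : OKA A m then Finsupp.single ⟨m, h⟩ 1 else 0

/-- `θ_{A,i}(x^γ y^λ) = γ_i x^γ y^λ`. -/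
def thetaOp (F : Type) [Field F] {ι : Type} [Fintype ι] [LinearOrder ι]
    (A : Matrix ι ι ℕ) (i : ι) : RMod F A →ₗ[F] RMod F A :=
  Finsupp.linearCombination F fun m => ((m.1.1 i : F)) • Finsupp.single m (1 : F)

/-- `T^∨_{A,i}(x^γ y^λ) = π⁻¹ (λA⁻ᵀ)_i x^γ y^λ`, the matrix inverse being computed
over `F`. -/
def TdualOp (F : Type) [Field F] {ι : Type} [Fintype ι] [LinearOrder ι]
    (π : F) (A : Matrix ι ι ℕ) (i : ι) : RMod F A →ₗ[F] RMod F A :=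
  Finsupp.linearCombination F fun m =>
    (π⁻¹ * Matrix.vecMul (fun k => ((m.1.2 k : F))) (((A.map ((↑) : ℕ → F))ᵀ)⁻¹) i) •
      Finsupp.single m (1 : F)

/-- `ψ^∨_{A,i}(x^γ y^λ) = x^γ y^{λ + e_i Aᵀ}`. -/
def psidualOp (F : Type) [Field F] {ι : Type} [Fintype ι] [LinearOrder ι]
    (A : Matrix ι ι ℕ) (i : ι) : RMod F A →ₗ[F] RMod F A :=
  Finsupp.linearCombination F fun m => bE F A (m.1.1, fun j => m.1.2 j + A j i)

/-- `φ_{A,i}(x^γ y^λ) = π ∑_j A_{ji} x^{γ + e_j A} y^λ`. -/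
def phiOp (F : Type) [Field F] {ι : Type} [Fintype ι] [LinearOrder ι]
    (π : F) (A : Matrix ι ι ℕ) (i : ι) : RMod F A →ₗ[F] RMod F A :=
  Finsupp.linearCombination F fun m =>
    π • ∑ j, (A j i : F) • bE F A ((fun k => m.1.1 k + A j k), m.1.2)

/-- The underlying module of the complex `B_A(F) = R_A(F) ⊗ ⋀(Fⁿ)`. -/
abbrev BMod (F : Type) [Field F] {ι : Type} [Fintype ι] [LinearOrder ι]
    (A : Matrix ι ι ℕ) := RMod F A ⊗[F] ExtV F ι

/-- `d_{A,i} = (θ_{A,i} + φ_{A,i}) ⊗ e_i`. -/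
def dSingle (F : Type) [Field F] {ι : Type} [Fintype ι] [LinearOrder ι]
    (π : F) (A : Matrix ι ι ℕ) (i : ι) : BMod F A →ₗ[F] BMod F A :=
  TensorProduct.map (thetaOp F A i + phiOp F π A i) (mulE F i)

/-- `d^∨_{A,i} = (T^∨_{A,i} + ψ^∨_{A,i}) ⊗ e_i^∨`. -/
def dDualSingle (F : Type) [Field F] {ι : Type} [Fintype ι] [LinearOrder ι]
    (π : F) (A : Matrix ι ι ℕ) (i : ι) : BMod F A →ₗ[F] BMod F A :=
  TensorProduct.map (TdualOp F π A i + psidualOp F A i) (contrE F i)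

/-- `d_A = ∑ i, d_{A,i}`. -/
def dOp (F : Type) [Field F] {ι : Type} [Fintype ι] [LinearOrder ι]
    (π : F) (A : Matrix ι ι ℕ) : BMod F A →ₗ[F] BMod F A :=
  ∑ i, dSingle F π A i

/-- `d^∨_A = ∑ i, d^∨_{A,i}`. -/
def dDualOp (F : Type) [Field F] {ι : Type} [Fintype ι] [LinearOrder ι]
    (π : F) (A : Matrix ι ι ℕ) : BMod F A →ₗ[F] BMod F A :=
  ∑ i, dDualSingle F π A i

/-- The total differential `d_A + d^∨_A` of the complex `B_A(F)`. -/
def DOp (F : Type) [Field F] {ι : Type} [Fintype ι] [LinearOrder ι]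
    (π : F) (A : Matrix ι ι ℕ) : BMod F A →ₗ[F] BMod F A :=
  dOp F π A + dDualOp F π A

end
noncomputable section

/-- The basis element `x^γ y^λ ⊗ e_S` of `B_A(F)`. -/
def basisTensor (F : Type) [Field F] {ι : Type} [Fintype ι] [LinearOrder ι]
    (A : Matrix ι ι ℕ) (m : {m : MonIdx ι // OKA A m}) (S : Finset ι) : BMod F A :=
  Finsupp.single m (1 : F) ⊗ₜ[F] Pi.single S (1 : F)

/-- The subcomplex `B^λ_A(F) ⊆ B_A(F)` spanned by the monomials `x^γ y^{λ + μAᵀ} ⊗ e_S`. -/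
def BlamSub (F : Type) [Field F] {ι : Type} [Fintype ι] [LinearOrder ι]
    (A : Matrix ι ι ℕ) (lam : ι → ℕ) : Submodule F (BMod F A) :=
  Submodule.span F {x | ∃ m S, (∃ μ : ι → ℕ, ∀ j, m.1.2 j = lam j + ∑ k, μ k * A j k) ∧
    x = basisTensor F A m S}

/-- The subcomplex `B^0_A(F) ⊆ B_A(F)` spanned by the monomials `x^γ y^{μAᵀ} ⊗ e_S`. -/
def B0Sub (F : Type) [Field F] {ι : Type} [Fintype ι] [LinearOrder ι]
    (A : Matrix ι ι ℕ) : Submodule F (BMod F A) :=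
  BlamSub F A 0

/-- The subcomplex `C_A(F) ⊆ B_A(F)` spanned by the monomials `x^γ y^λ ⊗ e_S` with
`(γA⁻¹)_i ≥ 0` for all `i`. -/
def CSub (F : Type) [Field F] {ι : Type} [Fintype ι] [LinearOrder ι]
    (A : Matrix ι ι ℕ) : Submodule F (BMod F A) :=
  Submodule.span F {x | ∃ m S, (∀ i, 0 ≤ gamRow A m.1.1 i) ∧ x = basisTensor F A m S}

/-- The projection `P^∨_{A,i}` onto the span of monomials with `(λA⁻ᵀ)_i ≠ 0`. -/
def PdualOp (F : Type) [Field F] {ι : Type} [Fintype ι] [LinearOrder ι]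
    (A : Matrix ι ι ℕ) (i : ι) : RMod F A →ₗ[F] RMod F A :=
  Finsupp.linearCombination F fun m =>
    if lamRow A m.1.2 i = 0 then 0 else Finsupp.single m (1 : F)

/-- `Q^∨_{A,i} = P^∨_{A,i} ⊗ e_i^∨ e_i`. -/
def QdualOp (F : Type) [Field F] {ι : Type} [Fintype ι] [LinearOrder ι]
    (A : Matrix ι ι ℕ) (i : ι) : BMod F A →ₗ[F] BMod F A :=
  TensorProduct.map (PdualOp F A i) ((contrE F i).comp (mulE F i))

/-- `Q_{A,i} = Id ⊗ e_i e_i^∨ + Q^∨_{A,i}`. -/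
def QOp (F : Type) [Field F] {ι : Type} [Fintype ι] [LinearOrder ι]
    (A : Matrix ι ι ℕ) (i : ι) : BMod F A →ₗ[F] BMod F A :=
  TensorProduct.map LinearMap.id ((mulE F i).comp (contrE F i)) + QdualOp F A i

/-- The underlying module of the de Rham complex `DR_A(F)`: `F[x] ⊗ ⋀(Fⁿ)`. -/
abbrev DRMod (F : Type) [Field F] (ι : Type) := MvPolynomial ι F ⊗[F] ExtV F ι

/-- The twisted de Rham differential `∑ i, D_i ⊗ e_i`, `D_i = ∂_i + π (∂_i W_A)`. -/
def dDR (F : Type) [Field F] {ι : Type} [Fintype ι] [LinearOrder ι]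
    (π : F) (A : Matrix ι ι ℕ) : DRMod F ι →ₗ[F] DRMod F ι :=
  ∑ i, TensorProduct.map
    ((MvPolynomial.pderiv i).toLinearMap +
      π • LinearMap.mulLeft F (MvPolynomial.pderiv i (Wpoly F A)))
    (mulE F i)

/-- The projection of `⋀(Fⁿ)` onto the line spanned by the basis vector `e_S`. -/
def projS (F : Type) [Field F] {ι : Type} [Fintype ι] [LinearOrder ι] (S : Finset ι) :
    ExtV F ι →ₗ[F] ExtV F ι :=
  (Pi.basisFun F (Finset ι)).constr F fun T => if T = S then Pi.single S (1 : F) else 0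

/-- The chain map `Θ : DR_A(F) → B^0_A(F)`, `x^γ ⊗ e_S ↦ x^{γ + S} y^0 ⊗ e_S`. -/
def ThetaMap (F : Type) [Field F] {ι : Type} [Fintype ι] [LinearOrder ι]
    (A : Matrix ι ι ℕ) : DRMod F ι →ₗ[F] BMod F A :=
  ∑ S : Finset ι, TensorProduct.map
    ((MvPolynomial.basisMonomials ι F).constr F fun d =>
      bE F A ((fun j => d j + (if j ∈ S then 1 else 0)), 0))
    (projS F S)

/-- The "cohomology" `ker D ∩ P / D(P)` of the differential `D` restricted to the
subcomplex `P`. -/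
def Hsub {F : Type} [Field F] {M : Type} [AddCommGroup M] [Module F M]
    (D : M →ₗ[F] M) (P : Submodule F M) :=
  ↥(LinearMap.ker D ⊓ P) ⧸
    Submodule.comap (LinearMap.ker D ⊓ P).subtype (Submodule.map D P)

end

section ExteriorSigns

variable {F : Type} [Field F] {ι : Type} [LinearOrder ι]

lemma neg_one_pow_card_filter_lt_insert {S : Finset ι} {i k : ι} (hk : k ∉ S) :
    (-1 : F) ^ ((insert k S).filter (· < i)).card =
      if k < i then -(-1 : F) ^ (S.filter (· < i)).card
      else (-1 : F) ^ (S.filter (· < i)).card := by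
  rw [Finset.filter_insert]
  split_ifs with h
  · rw [Finset.card_insert_of_notMem (by simp [hk]), pow_succ, mul_neg_one]
  · rfl

lemma neg_one_pow_card_filter_lt_erase {S : Finset ι} {i k : ι} (hk : k ∈ S) :
    (-1 : F) ^ ((S.erase k).filter (· < i)).card =
      if k < i then -(-1 : F) ^ (S.filter (· < i)).card
      else (-1 : F) ^ (S.filter (· < i)).card := by
  have h := neg_one_pow_card_filter_lt_insert (F := F) (i := i) (Finset.notMem_erase k S)
  rw [Finset.insert_erase hk] at h
  rw [h]
  split_ifs <;> simp

lemma mulE_comp_self (i : ι) : (mulE F i).comp (mulE F i) = 0 := by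
  refine LinearMap.ext fun f => funext fun S => ?_
  simp [mulE]

lemma contrE_comp_self (i : ι) : (contrE F i).comp (contrE F i) = 0 := by
  refine LinearMap.ext fun f => funext fun S => ?_
  simp [contrE]

lemma mulE_comp_mulE {i k : ι} (h : i ≠ k) :
    (mulE F i).comp (mulE F k) + (mulE F k).comp (mulE F i) = 0 := by
  refine LinearMap.ext fun f => funext fun S => ?_
  by_cases hi : i ∈ S <;> by_cases hk : k ∈ S <;>
    simp [mulE, hi, hk, h, h.symm, neg_one_pow_card_filter_lt_erase]
  rw [Finset.erase_right_comm (a := k) (b := i)]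
  rcases lt_or_gt_of_ne h with hlt | hlt <;> simp [hlt, hlt.not_gt] <;> ring

lemma contrE_comp_contrE {i k : ι} (h : i ≠ k) :
    (contrE F i).comp (contrE F k) + (contrE F k).comp (contrE F i) = 0 := by
  refine LinearMap.ext fun f => funext fun S => ?_
  by_cases hi : i ∈ S <;> by_cases hk : k ∈ S <;>
    simp [contrE, hi, hk, h, h.symm, neg_one_pow_card_filter_lt_insert]
  rw [Finset.insert_comm k i]
  rcases lt_or_gt_of_ne h with hlt | hlt <;> simp [hlt, hlt.not_gt] <;> ring

lemma mulE_comp_contrE {i k : ι} (h : i ≠ k) :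
    (mulE F i).comp (contrE F k) + (contrE F k).comp (mulE F i) = 0 := by
  refine LinearMap.ext fun f => funext fun S => ?_
  by_cases hi : i ∈ S <;> by_cases hk : k ∈ S <;>
    simp [mulE, contrE, hi, hk, h, h.symm, neg_one_pow_card_filter_lt_insert,
      neg_one_pow_card_filter_lt_erase]
  rw [Finset.erase_insert_of_ne h.symm]
  rcases lt_or_gt_of_ne h with hlt | hlt <;> simp [hlt, hlt.not_gt] <;> ring

end ExteriorSigns

section KoszulSums

variable {F : Type} [Field F] {ι : Type} [Fintype ι] {M N : Type}
  [AddCommGroup M] [Module F M] [AddCommGroup N] [Module F N]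

lemma sum_map_comp_self_eq_zero (D : ι → M →ₗ[F] M) (e : ι → N →ₗ[F] N)
    (hD : ∀ i k, (D i).comp (D k) = (D k).comp (D i))
    (he : ∀ i, (e i).comp (e i) = 0)
    (hanti : ∀ i k, i ≠ k → (e i).comp (e k) + (e k).comp (e i) = 0) :
    (∑ i, TensorProduct.map (D i) (e i)).comp (∑ i, TensorProduct.map (D i) (e i)) = 0 := by
  simp only [← Module.End.mul_eq_comp, Finset.sum_mul_sum]
  simp only [Module.End.mul_eq_comp, ← TensorProduct.map_comp]
  rw [← Finset.sum_product' (f := fun i k =>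
    TensorProduct.map ((D i).comp (D k)) ((e i).comp (e k)))]
  refine Finset.sum_involution (fun p _ => p.swap) ?_ ?_ (by simp) (by simp)
  · rintro ⟨i, k⟩ -
    by_cases h : i = k
    · subst h
      simp [he]
    · simp only [Prod.swap]
      rw [hD i k, ← TensorProduct.map_add_right, hanti i k h,
        TensorProduct.map_zero_right]
  · rintro ⟨i, k⟩ - hne heq
    obtain rfl : k = i := congrArg Prod.fst heq
    exact hne (by simp [he])

lemma sum_map_anticommute (D V : ι → M →ₗ[F] M) (e c : ι → N →ₗ[F] N)
    (hcomm : ∀ i k, (D i).comp (V k) = (V k).comp (D i))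
    (hzero : ∀ i, (D i).comp (V i) = 0)
    (hanti : ∀ i k, i ≠ k → (e i).comp (c k) + (c k).comp (e i) = 0) :
    (∑ i, TensorProduct.map (D i) (e i)).comp (∑ i, TensorProduct.map (V i) (c i)) +
      (∑ i, TensorProduct.map (V i) (c i)).comp (∑ i, TensorProduct.map (D i) (e i)) = 0 := by
  simp only [← Module.End.mul_eq_comp, Finset.sum_mul_sum]
  simp only [Module.End.mul_eq_comp, ← TensorProduct.map_comp]
  rw [Finset.sum_comm, ← Finset.sum_add_distrib]
  refine Finset.sum_eq_zero fun k _ => ?_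
  rw [← Finset.sum_add_distrib]
  refine Finset.sum_eq_zero fun i _ => ?_
  by_cases h : i = k
  · subst h
    rw [← hcomm, hzero]
    simp
  · rw [← hcomm i k, ← TensorProduct.map_add_right, hanti i k h, TensorProduct.map_zero_right]

end KoszulSums

section MonomialOperators

variable {F : Type} [Field F] {ι : Type} [Fintype ι] [LinearOrder ι] {A : Matrix ι ι ℕ}

lemma gamRow_dotProduct (gam lam : ι → ℕ) :
    (gamRow A gam ⬝ᵥ fun i => (lam i : ℚ)) = ∑ i, (gam i : ℚ) * lamRow A lam i := by
  rw [gamRow, lamRow, ← Matrix.dotProduct_mulVec, ← Matrix.transpose_nonsing_inv,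
    Matrix.vecMul_transpose]
  rfl

lemma OKA_iff {m : MonIdx ι} (hm : ∀ i, 0 ≤ lamRow A m.2 i) :
    OKA A m ↔ ∀ i, m.1 i = 0 ∨ lamRow A m.2 i = 0 := by
  rw [OKA, gamRow_dotProduct,
    Finset.sum_eq_zero_iff_of_nonneg fun i _ => mul_nonneg (Nat.cast_nonneg _) (hm i)]
  simp [hm]

lemma bE_eq_zero {gam lam : ι → ℕ} {i : ι} (h1 : gam i ≠ 0) (h2 : lamRow A lam i ≠ 0) :
    bE F A (gam, lam) = 0 :=
  dif_neg fun h => ((OKA_iff h.1).1 h i).elim h1 h2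

lemma bE_eq_zero_of_le {m m' : MonIdx ι} (hm : ∀ i, 0 ≤ lamRow A m.2 i) (h : ¬ OKA A m)
    (h1 : ∀ i, m.1 i ≤ m'.1 i) (h2 : ∀ i, lamRow A m.2 i ≤ lamRow A m'.2 i) :
    bE F A m' = 0 := by
  rw [OKA_iff hm] at h
  push Not at h
  obtain ⟨i, hi1, hi2⟩ := h
  exact bE_eq_zero (i := i) (by have := h1 i; lia)
    (((lt_of_le_of_ne (hm i) (Ne.symm hi2)).trans_le (h2 i)).ne')

lemma lamRow_add_col (hdet : (Aq A).det ≠ 0) (lam : ι → ℕ) (i k : ι) :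
    lamRow A (fun j => lam j + A j i) k = lamRow A lam k + (1 : Matrix ι ι ℚ) i k := by
  have hu : IsUnit ((Aq A)ᵀ).det := by rwa [Matrix.det_transpose, isUnit_iff_ne_zero]
  rw [lamRow, lamRow, ← Matrix.mul_nonsing_inv _ hu]
  simp only [Matrix.vecMul, Matrix.mul_apply, dotProduct, Nat.cast_add, add_mul,
    Finset.sum_add_distrib, Aq, Matrix.transpose_apply, Matrix.map_apply]

lemma lamRow_le_add_col (hdet : (Aq A).det ≠ 0) (lam : ι → ℕ) (i k : ι) :
    lamRow A lam k ≤ lamRow A (fun j => lam j + A j i) k := by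
  rw [lamRow_add_col hdet, Matrix.one_apply]
  split_ifs <;> simp

/-- The row vector `λ A⁻ᵀ`, computed over the field `F`. -/
noncomputable def lamRowField (F : Type) [Field F] (A : Matrix ι ι ℕ) (lam : ι → ℕ) : ι → F :=
  Matrix.vecMul (fun k => (lam k : F)) ((A.map ((↑) : ℕ → F))ᵀ)⁻¹

lemma lamRowField_eq (lam : ι → ℕ) (i : ι) :
    lamRowField F A lam i = Ring.inverse (A.map ((↑) : ℕ → F)).det *
      (((Matrix.vecMul (fun k => (lam k : ℤ)) (A.map ((↑) : ℕ → ℤ))ᵀ.adjugate) i : ℤ) : F) := by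
  have h : (A.map ((↑) : ℕ → F))ᵀ.adjugate =
      (A.map ((↑) : ℕ → ℤ))ᵀ.adjugate.map (Int.castRingHom F) := by
    rw [← RingHom.mapMatrix_apply, RingHom.map_adjugate]
    congr 1
    ext
    simp
  rw [lamRowField, Matrix.inv_def, Matrix.det_transpose, h]
  simp [Matrix.vecMul, dotProduct, Finset.mul_sum, mul_left_comm]

lemma lamRowField_eq_zero (hdet : (Aq A).det ≠ 0) {lam : ι → ℕ} {i : ι}
    (h : lamRow A lam i = 0) : lamRowField F A lam i = 0 := by
  have hq : lamRowField ℚ A lam i = 0 := h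
  rw [lamRowField_eq, mul_eq_zero] at hq
  rw [lamRowField_eq]
  rcases hq with hq | hq
  · rw [Ring.inverse_eq_inv', inv_eq_zero] at hq
    exact absurd hq hdet
  · rw [Int.cast_eq_zero.1 hq, Int.cast_zero, mul_zero]

lemma lamRowField_add_col (lam : ι → ℕ) (i k : ι) :
    lamRowField F A (fun j => lam j + A j i) k = lamRowField F A lam k +
      ((A.map ((↑) : ℕ → F))ᵀ * ((A.map ((↑) : ℕ → F))ᵀ)⁻¹) i k := by
  simp only [lamRowField, Matrix.vecMul, Matrix.mul_apply, dotProduct, Nat.cast_add, add_mul,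
    Finset.sum_add_distrib, Matrix.transpose_apply, Matrix.map_apply]

lemma mul_nonsing_inv_apply_ne (B : Matrix ι ι F) {i k : ι} (hik : i ≠ k) :
    (B * B⁻¹) i k = 0 := by
  by_cases h : IsUnit B.det
  · rw [Matrix.mul_nonsing_inv _ h, Matrix.one_apply_ne hik]
  · rw [Matrix.nonsing_inv_apply_not_isUnit _ h, mul_zero, Matrix.zero_apply]

lemma RMod_hom_ext {f g : RMod F A →ₗ[F] RMod F A}
    (h : ∀ m, (∀ i, 0 ≤ lamRow A m.2 i) → f (bE F A m) = g (bE F A m)) : f = g := by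
  refine Finsupp.lhom_ext' fun m => LinearMap.ext_ring ?_
  have := h m.1 m.2.1
  rwa [bE, dif_pos m.2] at this

lemma thetaOp_bE (i : ι) (m : MonIdx ι) :
    thetaOp F A i (bE F A m) = (m.1 i : F) • bE F A m := by
  by_cases h : OKA A m <;> simp [bE, h, thetaOp]

lemma TdualOp_bE (π : F) (i : ι) (m : MonIdx ι) :
    TdualOp F π A i (bE F A m) = (π⁻¹ * lamRowField F A m.2 i) • bE F A m := by
  by_cases h : OKA A m <;> simp [bE, h, TdualOp, lamRowField]

lemma phiOp_bE (π : F) (i : ι) {m : MonIdx ι} (hm : ∀ i, 0 ≤ lamRow A m.2 i) :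
    phiOp F π A i (bE F A m) =
      π • ∑ j, (A j i : F) • bE F A ((fun k => m.1 k + A j k), m.2) := by
  by_cases h : OKA A m
  · rw [bE, dif_pos h, phiOp, Finsupp.linearCombination_single, one_smul]
  · have h0 : ∀ j, bE F A ((fun k => m.1 k + A j k), m.2) = 0 := fun j =>
      bE_eq_zero_of_le hm h (fun _ => Nat.le_add_right _ _) fun _ => le_rfl
    rw [bE, dif_neg h]
    simp [h0]

lemma psidualOp_bE (hdet : (Aq A).det ≠ 0) (i : ι) {m : MonIdx ι}
    (hm : ∀ i, 0 ≤ lamRow A m.2 i) :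
    psidualOp F A i (bE F A m) = bE F A (m.1, fun j => m.2 j + A j i) := by
  by_cases h : OKA A m
  · rw [bE, dif_pos h, psidualOp, Finsupp.linearCombination_single, one_smul]
  · rw [bE_eq_zero_of_le (m' := (m.1, fun j => m.2 j + A j i)) hm h (fun _ => le_rfl)
      (lamRow_le_add_col hdet _ _), bE, dif_neg h, map_zero]

lemma thetaOp_add_phiOp_comm (π : F) (i k : ι) :
    (thetaOp F A i + phiOp F π A i).comp (thetaOp F A k + phiOp F π A k) =
      (thetaOp F A k + phiOp F π A k).comp (thetaOp F A i + phiOp F π A i) := by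
  refine RMod_hom_ext fun m hm => ?_
  have hphi : ∀ a b, phiOp F π A a (phiOp F π A b (bE F A m)) =
      π • ∑ j, ∑ l, (π * (A j b * A l a) : F) •
        bE F A ((fun x => m.1 x + A j x + A l x), m.2) := by
    intro a b
    rw [phiOp_bE π b hm]
    simp only [map_smul, map_sum]
    congr 1
    refine Finset.sum_congr rfl fun j _ => ?_
    rw [phiOp_bE π a (m := ((fun x => m.1 x + A j x), m.2)) hm]
    simp only [Finset.smul_sum, smul_smul]
    refine Finset.sum_congr rfl fun l _ => ?_
    congr 1
    ring
  have hcomm : phiOp F π A i (phiOp F π A k (bE F A m)) =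
      phiOp F π A k (phiOp F π A i (bE F A m)) := by
    rw [hphi, hphi, Finset.sum_comm]
    congr 1
    refine Finset.sum_congr rfl fun j _ => Finset.sum_congr rfl fun l _ => ?_
    simp only [add_right_comm _ (A l _) (A j _), mul_comm (A l k : F)]
  have htheta : ∀ a b, thetaOp F A a (phiOp F π A b (bE F A m)) =
      (m.1 a : F) • phiOp F π A b (bE F A m) +
        π • ∑ j, (A j b * A j a : F) • bE F A ((fun x => m.1 x + A j x), m.2) := by
    intro a b
    rw [phiOp_bE π b hm]
    simp only [map_smul, map_sum, thetaOp_bE, Nat.cast_add, Finset.smul_sum,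
      ← Finset.sum_add_distrib, smul_smul, ← add_smul]
    refine Finset.sum_congr rfl fun j _ => ?_
    congr 1
    ring
  simp only [LinearMap.comp_apply, LinearMap.add_apply, map_add, hcomm, htheta]
  simp only [thetaOp_bE, map_smul, mul_comm (A _ k : F)]
  rw [smul_comm (m.1 i : F) (m.1 k : F)]
  abel

lemma TdualOp_add_psidualOp_comm (hdet : (Aq A).det ≠ 0) (π : F) (i k : ι) :
    (TdualOp F π A i + psidualOp F A i).comp (TdualOp F π A k + psidualOp F A k) =
      (TdualOp F π A k + psidualOp F A k).comp (TdualOp F π A i + psidualOp F A i) := by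
  refine RMod_hom_ext fun m hm => ?_
  have hshift : ∀ a b, psidualOp F A a (psidualOp F A b (bE F A m)) =
      bE F A (m.1, fun j => m.2 j + A j b + A j a) := fun a b => by
    rw [psidualOp_bE hdet b hm, psidualOp_bE hdet a
      (m := (m.1, fun j => m.2 j + A j b)) fun x => (hm x).trans (lamRow_le_add_col hdet _ _ _)]
  have hcomm : psidualOp F A i (psidualOp F A k (bE F A m)) =
      psidualOp F A k (psidualOp F A i (bE F A m)) := by
    simp only [hshift, add_right_comm _ (A _ k)]
  have hT : ∀ a b, TdualOp F π A a (psidualOp F A b (bE F A m)) =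
      (π⁻¹ * lamRowField F A m.2 a) • psidualOp F A b (bE F A m) +
        (π⁻¹ * ((A.map ((↑) : ℕ → F))ᵀ * ((A.map ((↑) : ℕ → F))ᵀ)⁻¹) b a) •
          psidualOp F A b (bE F A m) := fun a b => by
    rw [psidualOp_bE hdet b hm, TdualOp_bE, lamRowField_add_col, mul_add, add_smul]
  by_cases hik : i = k
  · rw [hik]
  simp only [LinearMap.comp_apply, LinearMap.add_apply, map_add, hcomm, hT,
    mul_nonsing_inv_apply_ne _ hik, mul_nonsing_inv_apply_ne _ (Ne.symm hik)]
  simp only [TdualOp_bE, map_smul, mul_zero, zero_smul, add_zero]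
  rw [smul_comm (π⁻¹ * lamRowField F A m.2 i)]
  abel

lemma thetaOp_add_phiOp_comm_TdualOp_add_psidualOp (hdet : (Aq A).det ≠ 0) (π : F) (i k : ι) :
    (thetaOp F A i + phiOp F π A i).comp (TdualOp F π A k + psidualOp F A k) =
      (TdualOp F π A k + psidualOp F A k).comp (thetaOp F A i + phiOp F π A i) := by
  refine RMod_hom_ext fun m hm => ?_
  have hm' : ∀ x, 0 ≤ lamRow A (fun j => m.2 j + A j k) x := fun x =>
    (hm x).trans (lamRow_le_add_col hdet _ _ _)
  have hpsi : ∀ j, psidualOp F A k (bE F A ((fun x => m.1 x + A j x), m.2)) =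
      bE F A ((fun x => m.1 x + A j x), fun x => m.2 x + A x k) := fun j =>
    psidualOp_bE hdet k (m := ((fun x => m.1 x + A j x), m.2)) hm
  simp only [LinearMap.comp_apply, LinearMap.add_apply, map_add, thetaOp_bE, TdualOp_bE,
    psidualOp_bE hdet k hm, phiOp_bE π i hm, map_smul, map_sum, hpsi,
    phiOp_bE π i (m := (m.1, fun j => m.2 j + A j k)) hm']
  simp only [smul_add, Finset.smul_sum, smul_smul, Finset.sum_add_distrib]
  simp only [mul_comm, mul_left_comm]
  abel

lemma thetaOp_add_phiOp_comp_TdualOp_add_psidualOp (hdet : (Aq A).det ≠ 0) (π : F) (i : ι) :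
    (thetaOp F A i + phiOp F π A i).comp (TdualOp F π A i + psidualOp F A i) = 0 := by
  refine RMod_hom_ext fun m hm => ?_
  have hm' : ∀ x, 0 ≤ lamRow A (fun j => m.2 j + A j i) x := fun x =>
    (hm x).trans (lamRow_le_add_col hdet _ _ _)
  have hpos : lamRow A (fun j => m.2 j + A j i) i ≠ 0 := by
    rw [lamRow_add_col hdet, Matrix.one_apply_eq]
    have := hm i
    positivity
  have htheta_T : ((m.1 i : F) * lamRowField F A m.2 i) • bE F A m = 0 := by
    by_cases h1 : m.1 i = 0
    · simp [h1]
    by_cases h2 : lamRow A m.2 i = 0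
    · simp [lamRowField_eq_zero hdet h2]
    · rw [show bE F A m = 0 from bE_eq_zero h1 h2, smul_zero]
  have hphi : ∀ j, ((A j i : F) * lamRowField F A m.2 i) •
      bE F A ((fun x => m.1 x + A j x), m.2) = 0 := by
    intro j
    by_cases h1 : A j i = 0
    · simp [h1]
    by_cases h2 : lamRow A m.2 i = 0
    · simp [lamRowField_eq_zero hdet h2]
    · rw [bE_eq_zero (i := i) (by simp [h1]) h2, smul_zero]
  have htheta_psi : (m.1 i : F) • bE F A (m.1, fun j => m.2 j + A j i) = 0 := by
    by_cases h1 : m.1 i = 0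
    · simp [h1]
    · rw [bE_eq_zero (i := i) h1 hpos, smul_zero]
  have hphi_psi : ∀ j, (A j i : F) •
      bE F A ((fun x => m.1 x + A j x), fun x => m.2 x + A x i) = 0 := by
    intro j
    by_cases h1 : A j i = 0
    · simp [h1]
    · rw [bE_eq_zero (i := i) (by simp [h1]) hpos, smul_zero]
  have hphi_T : lamRowField F A m.2 i • phiOp F π A i (bE F A m) = 0 := by
    rw [phiOp_bE π i hm, smul_comm, Finset.smul_sum]
    simp only [smul_smul, mul_comm (lamRowField F A m.2 i), hphi, Finset.sum_const_zero,
      smul_zero]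
  simp only [LinearMap.comp_apply, LinearMap.add_apply, map_add, TdualOp_bE,
    psidualOp_bE hdet i hm, map_smul, mul_smul, smul_add, hphi_T, thetaOp_bE,
    phiOp_bE π i (m := (m.1, fun j => m.2 j + A j i)) hm', hphi_psi, htheta_psi,
    Finset.sum_const_zero, smul_zero, add_zero, LinearMap.zero_apply]
  rw [smul_smul (lamRowField F A m.2 i), mul_comm, htheta_T, smul_zero]

end MonomialOperators

/-- Lemma 4.1: `d_A² = 0`, `(d_A^∨)² = 0`, `d_A d_A^∨ + d_A^∨ d_A = 0`, hence
`(d_A + d_A^∨)² = 0` and `B_A(F) = (R_A(F) ⊗ ⋀(Fⁿ), d_A + d_A^∨)` is a chain complex. -/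
theorem BA_is_complex (F : Type) [Field F] (n : ℕ) (A : Matrix (Fin n) (Fin n) ℕ)
    (hA : IsBH F A) (π : F) (hπ : π ≠ 0) :
    (dOp F π A).comp (dOp F π A) = 0 ∧
    (dDualOp F π A).comp (dDualOp F π A) = 0 ∧
    (dOp F π A).comp (dDualOp F π A) + (dDualOp F π A).comp (dOp F π A) = 0 ∧
    (DOp F π A).comp (DOp F π A) = 0 := by
  have hdet : (Aq A).det ≠ 0 := hA.1
  have hdd : (dOp F π A).comp (dOp F π A) = 0 :=
    sum_map_comp_self_eq_zero _ _ (thetaOp_add_phiOp_comm π) mulE_comp_self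
      fun _ _ => mulE_comp_mulE
  have hvv : (dDualOp F π A).comp (dDualOp F π A) = 0 :=
    sum_map_comp_self_eq_zero _ _ (TdualOp_add_psidualOp_comm hdet π) contrE_comp_self
      fun _ _ => contrE_comp_contrE
  have hdv : (dOp F π A).comp (dDualOp F π A) + (dDualOp F π A).comp (dOp F π A) = 0 :=
    sum_map_anticommute _ _ _ _ (thetaOp_add_phiOp_comm_TdualOp_add_psidualOp hdet π)
      (thetaOp_add_phiOp_comp_TdualOp_add_psidualOp hdet π) fun _ _ => mulE_comp_contrE
  refine ⟨hdd, hvv, hdv, ?_⟩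
  rw [DOp, LinearMap.add_comp, LinearMap.comp_add, LinearMap.comp_add, hdd, hvv, zero_add,
    add_zero, hdv]
end

section
/- Let p be a prime, K = ℂ_p, π ∈ K with π^{p-1} = −p, and let A be an n×n nonnegative integer matrix with 0 < det A < p whose reduction is Berglund–Hübsch over the residue field F of K (A ∈ BH_n(F)). Then the inclusions B_A(K) ↪ B^†_A(K) and C_A(K) ↪ C^†_A(K) are quasi-isomorphisms: they induce isomorphisms on all cohomology groups. -/
open scoped BigOperators TensorProduct
open Matrix Classical

noncomputable section

/-- The allowed monomial indices of `R_A`. -/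
abbrev AMon {n : ℕ} (A : Matrix (Fin n) (Fin n) ℕ) : Type := {m : MonIdx (Fin n) // OKA A m}

/-- Index set for coefficients of elements of `R_A ⊗ ⋀(Kⁿ)`. -/
abbrev BIdx {n : ℕ} (A : Matrix (Fin n) (Fin n) ℕ) : Type := AMon A × Finset (Fin n)

/-- The full coefficient space of (possibly infinite) series supported on the allowed
monomials of `R_A`. -/
abbrev RFull (K : Type) {n : ℕ} (A : Matrix (Fin n) (Fin n) ℕ) : Type := AMon A → K

/-- The full coefficient space of (possibly infinite) series in `R_A ⊗ ⋀(Kⁿ)`. -/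
abbrev BFull (K : Type) {n : ℕ} (A : Matrix (Fin n) (Fin n) ℕ) : Type := BIdx A → K

/-- Diagonal operator with weight `w`. -/
def diagOp {K : Type} [Field K] {α : Type} (w : α → K) : (α → K) →ₗ[K] (α → K) where
  toFun c a := w a * c a
  map_add' c c' := by funext a; simp [mul_add]
  map_smul' r c := by funext a; simp [mul_left_comm]

/-- The "transpose" of a partially defined index map: `(pullOp σ c) b = c (σ b)`,
with the convention that missing values contribute `0`. -/
def pullOp {K : Type} [Field K] {α β : Type} (σ : β → Option α) :
    (α → K) →ₗ[K] (β → K) where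
  toFun c b := ((σ b).map c).getD 0
  map_add' c c' := by funext b; cases h : σ b <;> simp [h]
  map_smul' r c := by funext b; cases h : σ b <;> simp [h]

/-- The tensor product `T ⊗ L` of a coefficientwise operator `T` on series and an
operator `L` on the (finite-dimensional) exterior algebra. -/
def tmap {K : Type} [Field K] {n : ℕ} {α β : Type}
    (T : (α → K) →ₗ[K] (β → K)) (L : ExtV K (Fin n) →ₗ[K] ExtV K (Fin n)) :
    (α × Finset (Fin n) → K) →ₗ[K] (β × Finset (Fin n) → K) where
  toFun c q := ∑ S : Finset (Fin n), L (Pi.single S 1) q.2 * T (fun m => c (m, S)) q.1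
  map_add' c c' := by
    funext q
    have h : ∀ S : Finset (Fin n), T (fun m => c (m, S) + c' (m, S))
        = T (fun m => c (m, S)) + T (fun m => c' (m, S)) := fun S =>
      map_add T (fun m => c (m, S)) (fun m => c' (m, S))
    simp only [Pi.add_apply]
    simp only [h, Pi.add_apply, mul_add, Finset.sum_add_distrib]
  map_smul' r c := by
    funext q
    have h : ∀ S : Finset (Fin n), T (fun m => r * c (m, S))
        = r • T (fun m => c (m, S)) := fun S =>
      _root_.map_smul T r (fun m => c (m, S))
    simp only [Pi.smul_apply, smul_eq_mul, RingHom.id_apply]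
    simp only [h, Pi.smul_apply, smul_eq_mul, Finset.mul_sum, mul_left_comm]

/-- `φ_{A,i} = π ∑_j A_{ji} x^{e_j A}·`, acting on coefficients of series. -/
def phiF (K : Type) [Field K] {n : ℕ} (π : K) (A : Matrix (Fin n) (Fin n) ℕ) (i : Fin n) :
    RFull K A →ₗ[K] RFull K A :=
  π • ∑ j, (A j i : K) • pullOp (fun m' : AMon A =>
    if h : (∀ k, A j k ≤ m'.1.1 k) ∧ OKA A ((fun k => m'.1.1 k - A j k), m'.1.2)
    then some ⟨((fun k => m'.1.1 k - A j k), m'.1.2), h.2⟩ else none)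

/-- `ψ^∨_{A,i} = y^{e_i Aᵀ}·`, acting on coefficients of series. -/
def psidualF (K : Type) [Field K] {n : ℕ} (A : Matrix (Fin n) (Fin n) ℕ) (i : Fin n) :
    RFull K A →ₗ[K] RFull K A :=
  pullOp (fun m' : AMon A =>
    if h : (∀ j, A j i ≤ m'.1.2 j) ∧ OKA A (m'.1.1, fun j => m'.1.2 j - A j i)
    then some ⟨(m'.1.1, fun j => m'.1.2 j - A j i), h.2⟩ else none)

/-- `θ_{A,i} + φ_{A,i}`. -/
def dxF (K : Type) [Field K] {n : ℕ} (π : K) (A : Matrix (Fin n) (Fin n) ℕ) (i : Fin n) :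
    RFull K A →ₗ[K] RFull K A :=
  diagOp (fun m => (m.1.1 i : K)) + phiF K π A i

/-- `T^∨_{A,i} + ψ^∨_{A,i}`. -/
def dyF (K : Type) [Field K] {n : ℕ} (π : K) (A : Matrix (Fin n) (Fin n) ℕ) (i : Fin n) :
    RFull K A →ₗ[K] RFull K A :=
  diagOp (fun m => π⁻¹ * ((lamRow A m.1.2 i : ℚ) : K)) + psidualF K A i

/-- The differential `d_A + d^∨_A` on series. -/
def dFull (K : Type) [Field K] {n : ℕ} (π : K) (A : Matrix (Fin n) (Fin n) ℕ) :
    BFull K A →ₗ[K] BFull K A :=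
  (∑ i, tmap (dxF K π A i) (mulE K i)) + ∑ i, tmap (dyF K π A i) (contrE K i)

/-- The total degree `|γ| + |λ|` of a monomial. -/
def degMon {n : ℕ} (m : MonIdx (Fin n)) : ℕ := (∑ i, m.1 i) + ∑ i, m.2 i

/-- Overconvergence (à la Dwork–Monsky) of a series: there is `M > 0` with
`ord_p(coefficient) ≥ M(|γ|+|λ|)`, i.e. `‖coefficient‖ ≤ p^{-M(|γ|+|λ|)}`, for all but
finitely many monomials. -/
def OvercR {K : Type} [NontriviallyNormedField K] {n : ℕ} {A : Matrix (Fin n) (Fin n) ℕ}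
    (p : ℕ) (c : RFull K A) : Prop :=
  ∃ M : ℝ, 0 < M ∧
    {m : AMon A | ¬ ‖c m‖ ≤ (p : ℝ) ^ (-(M * (degMon m.1 : ℝ)))}.Finite

/-- Overconvergence of an element of `B^†_A(K)`. -/
def OvercB {K : Type} [NontriviallyNormedField K] {n : ℕ} {A : Matrix (Fin n) (Fin n) ℕ}
    (p : ℕ) (c : BFull K A) : Prop :=
  ∃ M : ℝ, 0 < M ∧
    {q : BIdx A | ¬ ‖c q‖ ≤ (p : ℝ) ^ (-(M * (degMon q.1.1 : ℝ)))}.Finite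

/-- Polynomial (finitely supported) elements of `B_A(K)`. -/
def FinSuppB {K : Type} [Field K] {n : ℕ} {A : Matrix (Fin n) (Fin n) ℕ}
    (c : BFull K A) : Prop :=
  (Function.support c).Finite

/-- The condition `(γA⁻¹)_i ≥ 0` for all `i` cutting out `S_A ⊆ R_A`. -/
def gamOK {n : ℕ} (A : Matrix (Fin n) (Fin n) ℕ) (q : BIdx A) : Prop :=
  ∀ i, 0 ≤ gamRow A q.1.1.1 i

/-- Membership in the subcomplex `C_A(K) = S_A(K) ⊗ ⋀(Kⁿ)` (polynomial version). -/
def CFin {K : Type} [Field K] {n : ℕ} {A : Matrix (Fin n) (Fin n) ℕ}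
    (c : BFull K A) : Prop :=
  FinSuppB c ∧ ∀ q, c q ≠ 0 → gamOK A q

/-- Membership in the subcomplex `C^†_A(K) = S^†_A(K) ⊗ ⋀(Kⁿ)` (overconvergent
version). -/
def COver {K : Type} [NontriviallyNormedField K] {n : ℕ} {A : Matrix (Fin n) (Fin n) ℕ}
    (p : ℕ) (c : BFull K A) : Prop :=
  OvercB p c ∧ ∀ q, c q ≠ 0 → gamOK A q
end

section Dagger

variable (K : Type) [NontriviallyNormedField K] {M : Type} (deg : M → ℕ)

/-- The series whose coefficients decay at least geometrically in the degree. -/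
def Dagger : Submodule K (M → K) where
  carrier := {c | ∃ r B : ℝ, 0 < r ∧ r < 1 ∧ 0 ≤ B ∧ ∀ m, ‖c m‖ ≤ B * r ^ deg m}
  add_mem' := by
    rintro c c' ⟨r, B, hr, hr1, hB, h⟩ ⟨r', B', hr', hr1', hB', h'⟩
    refine ⟨max r r', B + B', lt_max_of_lt_left hr, max_lt hr1 hr1', by positivity, fun m => ?_⟩
    calc ‖c m + c' m‖ ≤ ‖c m‖ + ‖c' m‖ := norm_add_le _ _
      _ ≤ B * r ^ deg m + B' * r' ^ deg m := add_le_add (h m) (h' m)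
      _ ≤ B * max r r' ^ deg m + B' * max r r' ^ deg m := by
        gcongr
        · exact le_max_left _ _
        · exact le_max_right _ _
      _ = _ := by ring
  zero_mem' := ⟨1 / 2, 0, by norm_num, by norm_num, le_rfl, fun m => by simp⟩
  smul_mem' := by
    rintro a c ⟨r, B, hr, hr1, hB, h⟩
    refine ⟨r, ‖a‖ * B, hr, hr1, by positivity, fun m => ?_⟩
    rw [Pi.smul_apply, smul_eq_mul, norm_mul, mul_assoc]
    gcongr
    exact h m

/-- An operator on polynomials that respects geometric decay of coefficients. -/
def IsTame (T : Module.End K (M →₀ K)) : Prop :=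
  ∀ r : ℝ, 0 < r → r < 1 → ∃ r' B : ℝ, 0 < r' ∧ r' < 1 ∧ 0 ≤ B ∧
    ∀ m m', ‖T (Finsupp.single m 1) m'‖ * r ^ deg m ≤ B * r' ^ deg m'

variable {K} {deg}

lemma end_apply_eq_sum (T : Module.End K (M →₀ K)) (v : M →₀ K) (m : M) :
    T v m = v.sum fun m' a => T (Finsupp.single m' 1) m * a := by
  conv_lhs => rw [← Finsupp.sum_single v, Finsupp.sum, map_sum, Finsupp.finsetSum_apply]
  refine Finset.sum_congr rfl fun m' _ => ?_
  rw [← mul_one (v m'), ← smul_eq_mul, ← Finsupp.smul_single, map_smul, Finsupp.smul_apply,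
    smul_eq_mul, smul_eq_mul, mul_one, mul_comm]

lemma IsTame.add {T T' : Module.End K (M →₀ K)} (h : IsTame K deg T) (h' : IsTame K deg T') :
    IsTame K deg (T + T') := by
  intro r hr hr1
  obtain ⟨s, B, hs, hs1, hB, H⟩ := h r hr hr1
  obtain ⟨s', B', hs', hs1', hB', H'⟩ := h' r hr hr1
  refine ⟨max s s', B + B', lt_max_of_lt_left hs, max_lt hs1 hs1', by positivity, fun m m' => ?_⟩
  calc ‖(T + T') (Finsupp.single m 1) m'‖ * r ^ deg m
      ≤ (‖T (Finsupp.single m 1) m'‖ + ‖T' (Finsupp.single m 1) m'‖) * r ^ deg m := by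
        gcongr; exact norm_add_le _ _
    _ ≤ B * s ^ deg m' + B' * s' ^ deg m' := by
        rw [add_mul]; exact add_le_add (H m m') (H' m m')
    _ ≤ B * max s s' ^ deg m' + B' * max s s' ^ deg m' := by
        gcongr
        · exact le_max_left _ _
        · exact le_max_right _ _
    _ = _ := by ring

lemma isTame_algebraMap (a : K) : IsTame K deg (algebraMap K (Module.End K (M →₀ K)) a) := by
  intro r hr hr1
  refine ⟨r, ‖a‖, hr, hr1, norm_nonneg _, fun m m' => ?_⟩
  by_cases h : m = m'
  · subst h; simp
  · simp [h]; positivity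

variable [IsUltrametricDist K]

lemma IsTame.mul {T T' : Module.End K (M →₀ K)} (h : IsTame K deg T) (h' : IsTame K deg T') :
    IsTame K deg (T * T') := by
  intro r hr hr1
  obtain ⟨s', B', hs', hs1', hB', H'⟩ := h' r hr hr1
  obtain ⟨s, B, hs, hs1, hB, H⟩ := h s' hs' hs1'
  refine ⟨s, B * B', hs, hs1, by positivity, fun m m'' => ?_⟩
  rw [Module.End.mul_apply, end_apply_eq_sum T]
  have hr' : 0 < r ^ deg m := by positivity
  rw [← le_div_iff₀ hr']
  refine IsUltrametricDist.norm_sum_le_of_forall_le_of_nonneg (by positivity) fun m' _ => ?_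
  rw [le_div_iff₀ hr', norm_mul, mul_assoc]
  calc ‖T (Finsupp.single m' 1) m''‖ * (‖T' (Finsupp.single m 1) m'‖ * r ^ deg m)
      ≤ ‖T (Finsupp.single m' 1) m''‖ * (B' * s' ^ deg m') := mul_le_mul_of_nonneg_left (H' m m') (norm_nonneg _)
    _ = B' * (‖T (Finsupp.single m' 1) m''‖ * s' ^ deg m') := by ring
    _ ≤ B' * (B * s ^ deg m'') := mul_le_mul_of_nonneg_left (H m' m'') hB'
    _ = _ := by ring

variable (K deg) in
/-- The algebra of tame operators on polynomials. -/
def TameAlg : Subalgebra K (Module.End K (M →₀ K)) where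
  carrier := {T | IsTame K deg T}
  mul_mem' := IsTame.mul
  add_mem' := IsTame.add
  algebraMap_mem' := isTame_algebraMap

lemma tendsto_pow_deg (hfin : ∀ N, {m | deg m ≤ N}.Finite) {r : ℝ} (hr : 0 < r) (hr1 : r < 1) :
    Filter.Tendsto (fun m => r ^ deg m) Filter.cofinite (nhds 0) := by
  refine (tendsto_pow_atTop_nhds_zero_of_lt_one hr.le hr1).comp ?_
  rw [Filter.tendsto_atTop]
  intro N
  rw [Filter.eventually_cofinite]
  exact (hfin N).subset fun m hm => (not_le.mp hm).le

variable [CompleteSpace K]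

omit [IsUltrametricDist K] [CompleteSpace K] in
lemma IsTame.bound {T : Module.End K (M →₀ K)} (h : IsTame K deg T) (c : Dagger K deg) :
    ∃ r s B : ℝ, 0 < r ∧ r < 1 ∧ 0 < s ∧ s < 1 ∧ 0 ≤ B ∧
      ∀ m m', ‖T (Finsupp.single m 1) m' * c.1 m‖ ≤ B * r ^ deg m * s ^ deg m' := by
  obtain ⟨r, B, hr, hr1, hB, H⟩ := c.2
  obtain ⟨t, ht, ht1⟩ := exists_between hr1
  obtain ⟨s, B', hs, hs1, hB', H'⟩ := h t (hr.trans ht) ht1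
  have ht0 : 0 < t := hr.trans ht
  refine ⟨r / t, s, B * B', by positivity, (div_lt_one ht0).2 ht, hs, hs1, by positivity,
    fun m m' => ?_⟩
  rw [norm_mul]
  calc ‖T (Finsupp.single m 1) m'‖ * ‖c.1 m‖
      ≤ ‖T (Finsupp.single m 1) m'‖ * (B * r ^ deg m) := by gcongr; exact H m
    _ = (‖T (Finsupp.single m 1) m'‖ * t ^ deg m) * (B * (r / t) ^ deg m) := by
        rw [div_pow]; field_simp
    _ ≤ (B' * s ^ deg m') * (B * (r / t) ^ deg m) :=
        mul_le_mul_of_nonneg_right (H' m m') (by positivity)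
    _ = _ := by ring

lemma IsTame.summable (hfin : ∀ N, {m | deg m ≤ N}.Finite) {T : Module.End K (M →₀ K)}
    (h : IsTame K deg T) (c : Dagger K deg) (m' : M) :
    Summable fun m => T (Finsupp.single m 1) m' * c.1 m := by
  obtain ⟨r, s, B, hr, hr1, hs, hs1, hB, H⟩ := h.bound c
  apply NonarchimedeanAddGroup.summable_of_tendsto_cofinite_zero
  rw [tendsto_zero_iff_norm_tendsto_zero]
  have := (tendsto_pow_deg hfin hr hr1).const_mul (B * s ^ deg m')
  rw [mul_zero] at this
  refine squeeze_zero (fun _ => norm_nonneg _) (fun m => ?_) this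
  exact (H m m').trans (le_of_eq (by ring))

/-- The extension of a tame operator to overconvergent series. -/
noncomputable def tameExt (hfin : ∀ N, {m | deg m ≤ N}.Finite) (T : TameAlg K deg) :
    Module.End K (Dagger K deg) where
  toFun c := ⟨fun m' => ∑' m, T.1 (Finsupp.single m 1) m' * c.1 m, by
    obtain ⟨r, s, B, hr, hr1, hs, hs1, hB, H⟩ := IsTame.bound T.2 c
    refine ⟨s, B, hs, hs1, hB, fun m' => ?_⟩
    refine IsUltrametricDist.norm_tsum_le_of_forall_le_of_nonneg (by positivity) fun m => ?_
    refine (H m m').trans ?_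
    gcongr
    exact mul_le_of_le_one_right hB (pow_le_one₀ hr.le hr1.le)⟩
  map_add' c c' := by
    ext m'
    simp only [Submodule.coe_add, Pi.add_apply, mul_add]
    exact (IsTame.summable hfin T.2 c m').tsum_add (IsTame.summable hfin T.2 c' m')
  map_smul' a c := by
    ext m'
    simp only [Submodule.coe_smul, Pi.smul_apply, smul_eq_mul, RingHom.id_apply]
    rw [← tsum_mul_left]
    exact tsum_congr fun m => by ring

lemma tameExt_apply (hfin : ∀ N, {m | deg m ≤ N}.Finite) (T : TameAlg K deg) (c : Dagger K deg)
    (m' : M) : (tameExt hfin T c).1 m' = ∑' m, T.1 (Finsupp.single m 1) m' * c.1 m := rfl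

lemma tameExt_mul (hfin : ∀ N, {m | deg m ≤ N}.Finite) (T T' : TameAlg K deg) :
    tameExt hfin (T * T') = tameExt hfin T * tameExt hfin T' := by
  ext c m''
  rw [Module.End.mul_apply, tameExt_apply, tameExt_apply]
  simp only [tameExt_apply, ← tsum_mul_left]
  have key : Summable (Function.uncurry fun m m' => T.1 (Finsupp.single m' 1) m'' *
      (T'.1 (Finsupp.single m 1) m' * c.1 m)) := by
    obtain ⟨r, s, B, hr, hr1, hs, hs1, hB, H⟩ := IsTame.bound T'.2 c
    obtain ⟨t, ht, ht1⟩ := exists_between hs1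
    have ht0 : 0 < t := hs.trans ht
    obtain ⟨u, B', hu, hu1, hB', H'⟩ := T.2 t ht0 ht1
    have hst : s / t < 1 := (div_lt_one ht0).2 ht
    apply NonarchimedeanAddGroup.summable_of_tendsto_cofinite_zero
    rw [tendsto_zero_iff_norm_tendsto_zero]
    have hfin2 : ∀ N, {x : M × M | deg x.1 + deg x.2 ≤ N}.Finite := fun N =>
      ((hfin N).prod (hfin N)).subset fun x (hx : _ ≤ _) =>
        ⟨(Nat.le_add_right _ _).trans hx, (Nat.le_add_left _ _).trans hx⟩
    have := (tendsto_pow_deg hfin2 (r := max r (s / t)) (lt_max_of_lt_left hr)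
      (max_lt hr1 hst)).const_mul (B * (B' * u ^ deg m''))
    rw [mul_zero] at this
    refine squeeze_zero (fun _ => norm_nonneg _) (fun x => ?_) this
    obtain ⟨m, m'⟩ := x
    simp only [Function.uncurry_apply_pair]
    rw [norm_mul, pow_add]
    calc ‖T.1 (Finsupp.single m' 1) m''‖ * ‖T'.1 (Finsupp.single m 1) m' * c.1 m‖
        ≤ ‖T.1 (Finsupp.single m' 1) m''‖ * (B * r ^ deg m * s ^ deg m') := by
          gcongr; exact H m m'
      _ = B * (‖T.1 (Finsupp.single m' 1) m''‖ * t ^ deg m') * (r ^ deg m * (s / t) ^ deg m') := by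
          rw [div_pow]; field_simp
      _ ≤ B * (B' * u ^ deg m'') *
          (max r (s / t) ^ deg m * max r (s / t) ^ deg m') := by
          have h1 := H' m' m''
          have h2 := le_max_left r (s / t)
          have h3 := le_max_right r (s / t)
          exact mul_le_mul (mul_le_mul_of_nonneg_left h1 hB)
            (mul_le_mul (pow_le_pow_left₀ hr.le h2 _) (pow_le_pow_left₀ (by positivity) h3 _)
              (by positivity) (by positivity)) (by positivity) (by positivity)
  rw [Summable.tsum_comm key]
  refine tsum_congr fun m => ?_
  rw [tsum_eq_sum (s := (T'.1 (Finsupp.single m 1)).support)]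
  · rw [Subalgebra.coe_mul, Module.End.mul_apply, end_apply_eq_sum T.1, Finsupp.sum,
      Finset.sum_mul]
    exact Finset.sum_congr rfl fun _ _ => by ring
  · intro m' hm'
    rw [Finsupp.notMem_support_iff.mp hm']
    ring

variable (K) in
/-- Extension to overconvergent series, as a morphism of algebras. -/
noncomputable def tameHom (hfin : ∀ N, {m | deg m ≤ N}.Finite) :
    TameAlg K deg →ₐ[K] Module.End K (Dagger K deg) :=
  AlgHom.ofLinearMap
    { toFun := tameExt hfin
      map_add' := fun T T' => by
        ext c m'
        have h1 := IsTame.summable hfin T.2 c m'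
        have h2 := IsTame.summable hfin T'.2 c m'
        simp only [LinearMap.add_apply, Submodule.coe_add, Pi.add_apply, tameExt_apply,
          ← h1.tsum_add h2]
        exact tsum_congr fun m => by simp [add_mul]
      map_smul' := fun a T => by
        ext c m'
        simp only [LinearMap.smul_apply, Submodule.coe_smul, Pi.smul_apply, tameExt_apply,
          smul_eq_mul, RingHom.id_apply, ← tsum_mul_left]
        exact tsum_congr fun m => by simp [mul_assoc] }
    (by
      ext c m'
      change ∑' m, _ = _
      rw [tsum_eq_single m']
      · simp
      · intro m hm
        simp [hm])
    (tameExt_mul hfin)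

lemma tameHom_apply (hfin : ∀ N, {m | deg m ≤ N}.Finite) (T : TameAlg K deg) (c : Dagger K deg)
    (m' : M) : (tameHom K hfin T c).1 m' = ∑' m, T.1 (Finsupp.single m 1) m' * c.1 m := rfl

/-- A tame operator mapping polynomials supported on `Z` to polynomials supported on `Z'` does the
same to overconvergent series. -/
lemma tameHom_apply_eq_zero (hfin : ∀ N, {m | deg m ≤ N}.Finite) (T : TameAlg K deg)
    {Z Z' : Set M} (hT : ∀ m ∈ Z, T.1 (Finsupp.single m 1) ∈ Finsupp.supported K K Z')
    (c : Dagger K deg) (hc : ∀ m, c.1 m ≠ 0 → m ∈ Z) (m' : M)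
    (hm' : (tameHom K hfin T c).1 m' ≠ 0) : m' ∈ Z' := by
  contrapose! hm'
  rw [tameHom_apply]
  convert tsum_zero with m
  by_cases h : c.1 m = 0
  · simp [h]
  · have := hT m (hc m h)
    rw [Finsupp.mem_supported'] at this
    rw [this m' hm', zero_mul]

lemma tameHom_apply_finite (hfin : ∀ N, {m | deg m ≤ N}.Finite) (T : TameAlg K deg)
    (c : Dagger K deg) (hc : c.1.support.Finite) : (tameHom K hfin T c).1.support.Finite := by
  refine (hc.biUnion fun m _ => (T.1 (Finsupp.single m 1)).hasFiniteSupport).subset ?_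
  intro m' hm'
  refine tameHom_apply_eq_zero hfin T (Z := c.1.support) (fun m hm => ?_) c (fun m hm => hm) m' hm'
  rw [Finsupp.mem_supported]
  intro x hx
  exact Set.mem_biUnion hm (by simpa using hx)

omit [IsUltrametricDist K] [CompleteSpace K] in
lemma isTame_of_poly_bound {T : Module.End K (M →₀ K)} (C k : ℕ)
    (h : ∀ m m', T (Finsupp.single m 1) m' ≠ 0 →
      deg m' ≤ C * (deg m + 1) ∧ ‖T (Finsupp.single m 1) m'‖ ≤ C * (deg m + 1) ^ k) :
    IsTame K deg T := by
  intro r hr hr1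
  obtain ⟨t, ht, ht1⟩ := exists_between hr1
  have ht0 : 0 < t := hr.trans ht
  have hrt : r / t < 1 := (div_lt_one ht0).2 ht
  obtain ⟨B, hB⟩ : ∃ B : ℝ, ∀ d : ℕ, ((d : ℝ) + 1) ^ k * (r / t) ^ d ≤ B := by
    have h1 := tendsto_pow_const_mul_const_pow_of_abs_lt_one k
      (r := r / t) (by rwa [abs_of_pos (by positivity)])
    have h2 := (Filter.tendsto_add_atTop_iff_nat 1).2 h1
    obtain ⟨B, hB⟩ := h2.bddAbove_range
    refine ⟨B * (r / t)⁻¹, fun d => ?_⟩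
    have := hB ⟨d, rfl⟩
    simp only [Nat.cast_add, Nat.cast_one, pow_succ (r / t)] at this
    rw [← div_eq_mul_inv, le_div_iff₀ (by positivity)]
    linarith [this]
  have hB0 : 0 ≤ B := by
    have := hB 0
    simp at this
    linarith
  set s : ℝ := t ^ ((C + 1 : ℝ)⁻¹) with hs
  have hs0 : 0 < s := Real.rpow_pos_of_pos ht0 _
  have hs1 : s < 1 := Real.rpow_lt_one ht0.le ht1 (by positivity)
  have hst : s ^ (C + 1) = t := by
    rw [hs, ← Real.rpow_natCast, ← Real.rpow_mul ht0.le]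
    push_cast
    rw [inv_mul_cancel₀ (by positivity), Real.rpow_one]
  refine ⟨s, C * B * (s ^ (C + 1))⁻¹, hs0, hs1, by positivity, fun m m' => ?_⟩
  by_cases h0 : T (Finsupp.single m 1) m' = 0
  · rw [h0]; simp; positivity
  obtain ⟨h1, h2⟩ := h m m' h0
  have h3 : t ^ deg m ≤ (s ^ (C + 1))⁻¹ * s ^ deg m' := by
    rw [inv_mul_eq_div, le_div_iff₀ (by positivity), ← hst, ← pow_mul, ← pow_add]
    apply pow_le_pow_of_le_one hs0.le hs1.le
    nlinarith
  calc ‖T (Finsupp.single m 1) m'‖ * r ^ deg m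
      ≤ (C * (deg m + 1) ^ k) * r ^ deg m := by gcongr
    _ = C * ((deg m + 1) ^ k * (r / t) ^ deg m) * t ^ deg m := by
        rw [div_pow]; field_simp
    _ ≤ C * B * ((s ^ (C + 1))⁻¹ * s ^ deg m') := by
        gcongr
        exact hB _
    _ = _ := by ring

end Dagger

/-- A set `M` of monomials with rational weights indexed by `I`, in which the weights may be
shifted by integers inside the allowed region. -/
structure ShiftSystem (I M : Type) [Fintype I] (p : ℕ) where
  /-- the weights of a monomial -/
  w : M → I → ℚ
  /-- the degree of a monomial -/
  deg : M → ℕ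
  /-- a symmetric pairing for which all weight vectors are isotropic -/
  pair : I → I → ℚ
  /-- a constant bounding weights and degrees in terms of each other -/
  bd : ℕ
  /-- a common denominator of the weights -/
  den : ℕ
  injective_w : Function.Injective w
  finite_deg : ∀ N, {m | deg m ≤ N}.Finite
  interval : ∀ m (v v' : I → ℤ), 0 ≤ v → v ≤ v' →
    (∃ m', w m' = w m + fun c => (v' c : ℚ)) → ∃ m', w m' = w m + fun c => (v c : ℚ)
  lower : ∀ m (v : I → ℤ), 0 ≤ w m → v ≤ 0 → (0 ≤ w m + fun c => (v c : ℚ)) →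
    ∃ m', w m' = w m + fun c => (v c : ℚ)
  eq_zero_of_blocked : ∀ m c, 0 ≤ w m → (¬ ∃ m', w m' = w m + Pi.single c 1) → w m c = 0
  unblocked : ∀ m m₀ c k (l : ℕ), 0 ≤ w m → w m = w m₀ + Pi.single c (l : ℚ) → 0 < w m₀ c →
    k ≠ c → (∃ m', w m' = w m₀ + Pi.single k 1) → ∃ m', w m' = w m + Pi.single k 1
  pair_symm : ∀ c k, pair c k = pair k c
  pair_self : ∀ c, pair c c = 0
  isotropic : ∀ m, ∑ c, w m c * ∑ k, pair c k * w m k = 0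
  abs_w_le : ∀ m c, |w m c| ≤ bd * deg m
  deg_le : ∀ m m' c (z : ℤ), w m' = w m + Pi.single c (z : ℚ) → deg m' ≤ deg m + bd * z.natAbs
  deg_le_of_mem_box : ∀ m, (∀ c, 0 ≤ w m c ∧ w m c ≤ 1) → deg m ≤ bd
  coprime_den : p.Coprime den
  den_mul : ∀ m c, ∃ z : ℤ, den * w m c = z

namespace ShiftSystem

variable {I M : Type} [Fintype I] {p : ℕ} (X : ShiftSystem I M p)

variable (K : Type) [Field K]

/-- The monomial obtained by shifting the weights by `v`, or zero if there is none. -/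
noncomputable def shift (v : I → ℤ) (m : M) : M →₀ K :=
  if h : ∃ m', X.w m' = X.w m + fun c => (v c : ℚ) then Finsupp.single h.choose 1 else 0

/-- Shifting by `v`, as an operator. -/
noncomputable def shiftOp (v : I → ℤ) : Module.End K (M →₀ K) :=
  Finsupp.linearCombination K (X.shift K v)

/-- Multiplication by the weight with index `c`. -/
noncomputable def weightOp (c : I) : Module.End K (M →₀ K) :=
  Finsupp.linearCombination K fun m => (X.w m c : K) • Finsupp.single m 1

variable {K} (π : K)

/-- The operator `weight + π · shift`. -/
noncomputable def diffOp (c : I) : Module.End K (M →₀ K) :=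
  X.weightOp K c + π • X.shiftOp K (Pi.single c 1)

/-- The coefficients of `lowerOp`. -/
noncomputable def lowerCoeff (x : ℚ) (i : ℕ) : K :=
  π⁻¹ * ∏ t ∈ Finset.range i, (-π⁻¹ * ((x - 1 - t : ℚ) : K))

/-- The coefficients of `raiseOp`. -/
noncomputable def raiseCoeff (x : ℚ) (i : ℕ) : K :=
  ((x + i : ℚ) : K)⁻¹ * ∏ t ∈ Finset.range i, (-π * ((x + t : ℚ) : K)⁻¹)

/-- An operator inverting `diffOp` up to monomials of weight less than one. -/
noncomputable def lowerOp (c : I) : Module.End K (M →₀ K) :=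
  Finsupp.linearCombination K fun m => ∑ i ∈ Finset.range ⌊X.w m c⌋₊,
    lowerCoeff π (X.w m c) i • X.shift K (Pi.single c (-(i + 1 : ℤ))) m

/-- An operator inverting `diffOp` up to monomials of nonnegative weight. -/
noncomputable def raiseOp (c : I) : Module.End K (M →₀ K) :=
  Finsupp.linearCombination K fun m => ∑ i ∈ Finset.range ⌈-X.w m c⌉₊,
    raiseCoeff π (X.w m c) i • X.shift K (Pi.single c (i : ℤ)) m

variable {π} {X}

lemma shift_eq {v : I → ℤ} {m m' : M} (h : X.w m' = X.w m + fun c => (v c : ℚ)) :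
    X.shift K v m = Finsupp.single m' 1 := by
  have h' : ∃ m', X.w m' = X.w m + fun c => (v c : ℚ) := ⟨m', h⟩
  rw [shift, dif_pos h', X.injective_w (h'.choose_spec.trans h.symm)]

lemma shift_eq_zero {v : I → ℤ} {m : M} (h : ¬ ∃ m', X.w m' = X.w m + fun c => (v c : ℚ)) :
    X.shift K v m = 0 := dif_neg h

omit [Fintype I] in
lemma cast_single (c : I) (z : ℤ) :
    (fun k => ((Pi.single c z : I → ℤ) k : ℚ)) = Pi.single c (z : ℚ) := by
  ext k
  by_cases h : k = c
  · subst h; simp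
  · simp [h]

@[simp] lemma shiftOp_single (v : I → ℤ) (m : M) :
    X.shiftOp K v (Finsupp.single m 1) = X.shift K v m := by simp [shiftOp]

@[simp] lemma weightOp_single (c : I) (m : M) :
    X.weightOp K c (Finsupp.single m 1) = (X.w m c : K) • Finsupp.single m 1 := by
  simp [weightOp]

lemma lowerOp_single (c : I) (m : M) :
    X.lowerOp π c (Finsupp.single m 1) = ∑ i ∈ Finset.range ⌊X.w m c⌋₊,
      lowerCoeff π (X.w m c) i • X.shift K (Pi.single c (-(i + 1 : ℤ))) m := by simp [lowerOp]

lemma raiseOp_single (c : I) (m : M) :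
    X.raiseOp π c (Finsupp.single m 1) = ∑ i ∈ Finset.range ⌈-X.w m c⌉₊,
      raiseCoeff π (X.w m c) i • X.shift K (Pi.single c (i : ℤ)) m := by simp [raiseOp]

lemma shift_of_w_eq {u v : I → ℤ} {m m₀ : M} (h : X.w m = X.w m₀ + fun c => (u c : ℚ)) :
    X.shift K v m = X.shift K (u + v) m₀ := by
  have key : ∀ m', (X.w m' = X.w m + fun c => (v c : ℚ)) ↔
      X.w m' = X.w m₀ + fun c => ((u + v) c : ℚ) := by
    intro m'
    rw [h, add_assoc]
    simp only [Pi.add_apply, Int.cast_add]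
    rfl
  by_cases h' : ∃ m', X.w m' = X.w m + fun c => (v c : ℚ)
  · obtain ⟨m', hm'⟩ := h'
    rw [shift_eq hm', shift_eq ((key m').1 hm')]
  · rw [shift_eq_zero h', shift_eq_zero fun ⟨m', hm'⟩ => h' ⟨m', (key m').2 hm'⟩]

lemma shift_eq_zero_of_le {v v' : I → ℤ} {m : M} (hv : 0 ≤ v) (hvv : v ≤ v')
    (h : ¬ ∃ m', X.w m' = X.w m + fun c => (v c : ℚ)) : X.shift K v' m = 0 :=
  shift_eq_zero fun h' => h (X.interval m v v' hv hvv h')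

lemma shiftOp_shift {v v' : I → ℤ} (hv : 0 ≤ v) (hv' : 0 ≤ v') (m : M) :
    X.shiftOp K v (X.shift K v' m) = X.shift K (v' + v) m := by
  by_cases h : ∃ m', X.w m' = X.w m + fun c => (v' c : ℚ)
  · obtain ⟨m', hm'⟩ := h
    rw [shift_eq hm', shiftOp_single, shift_of_w_eq hm']
  · rw [shift_eq_zero h, map_zero, shift_eq_zero_of_le hv' (by simpa using hv) h]

omit [Fintype I] in
lemma single_nonneg (c : I) {z : ℤ} (hz : 0 ≤ z) : (0 : I → ℤ) ≤ Pi.single c z :=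
  Pi.single_nonneg.2 hz

@[simp] lemma shift_zero (m : M) : X.shift K 0 m = Finsupp.single m 1 :=
  shift_eq (by ext; simp)

lemma diffOp_single (c : I) (m : M) : X.diffOp π c (Finsupp.single m 1) =
    (X.w m c : K) • Finsupp.single m 1 + π • X.shift K (Pi.single c 1) m := by
  simp [diffOp]

lemma end_ext {T T' : Module.End K (M →₀ K)}
    (h : ∀ m, T (Finsupp.single m 1) = T' (Finsupp.single m 1)) : T = T' := by
  refine Finsupp.lhom_ext' fun m => LinearMap.ext_ring ?_
  simpa using h m

lemma shiftOp_comm {v v' : I → ℤ} (hv : 0 ≤ v) (hv' : 0 ≤ v') :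
    X.shiftOp K v * X.shiftOp K v' = X.shiftOp K v' * X.shiftOp K v := by
  refine end_ext fun m => ?_
  simp only [Module.End.mul_apply, shiftOp_single, shiftOp_shift hv hv', shiftOp_shift hv' hv,
    add_comm]

lemma weightOp_shift (c : I) (v : I → ℤ) (m : M) [CharZero K] : X.weightOp K c (X.shift K v m) =
    ((X.w m c + v c : ℚ) : K) • X.shift K v m := by
  by_cases h : ∃ m', X.w m' = X.w m + fun c => (v c : ℚ)
  · obtain ⟨m', hm'⟩ := h
    rw [shift_eq hm', weightOp_single, hm', Pi.add_apply]
  · rw [shift_eq_zero h, map_zero, smul_zero]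

lemma weightOp_comm (c k : I) : X.weightOp K c * X.weightOp K k =
    X.weightOp K k * X.weightOp K c := by
  refine end_ext fun m => ?_
  simp only [Module.End.mul_apply, weightOp_single, map_smul, smul_comm (X.w m c : K)]

variable [CharZero K]

lemma weightOp_shiftOp_comm {c k : I} (h : c ≠ k) (z : ℤ) :
    X.weightOp K c * X.shiftOp K (Pi.single k z) =
      X.shiftOp K (Pi.single k z) * X.weightOp K c := by
  refine end_ext fun m => ?_
  rw [Module.End.mul_apply, Module.End.mul_apply, weightOp_single, map_smul, shiftOp_single,
    weightOp_shift, Pi.single_eq_of_ne h, Int.cast_zero, add_zero]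

lemma diffOp_comm (c k : I) :
    X.diffOp π c * X.diffOp π k = X.diffOp π k * X.diffOp π c := by
  by_cases h : c = k
  · rw [h]
  have h1 : Commute (X.weightOp K c) (X.shiftOp K (Pi.single k 1)) := weightOp_shiftOp_comm h 1
  have h2 : Commute (X.shiftOp K (Pi.single c 1)) (X.weightOp K k) :=
    (weightOp_shiftOp_comm (Ne.symm h) 1).symm
  have h3 : Commute (X.shiftOp K (Pi.single c 1)) (X.shiftOp K (Pi.single k 1)) :=
    shiftOp_comm (single_nonneg c zero_le_one) (single_nonneg k zero_le_one)
  have h4 : Commute (X.weightOp K c) (X.weightOp K k) := weightOp_comm c k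
  exact (h4.add_right (h1.smul_right π)).add_left
    ((h2.smul_left π).add_right ((h3.smul_left π).smul_right π))

/-- The relation that makes the total differential square to zero. -/
lemma sum_pair_diffOp : ∑ c, ∑ k, (X.pair c k : K) • (X.diffOp π c * X.diffOp π k) = 0 := by
  have hpair : ∀ m (c : I), (∃ m', X.w m' = X.w m + Pi.single c 1) →
      ∑ k, X.pair c k * X.w m k = 0 := by
    rintro m c ⟨m', hm'⟩
    have h0 := X.isotropic m
    have h1 := X.isotropic m'
    simp only [hm', Pi.add_apply, mul_add, add_mul, Finset.sum_add_distrib, Pi.single_apply,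
      mul_ite, mul_one, mul_zero, Finset.sum_ite_eq', Finset.mem_univ, if_true, ite_mul, zero_mul,
      one_mul, X.pair_self, h0, zero_add, add_zero] at h1
    have h2 : ∑ x, X.w m x * X.pair x c = ∑ k, X.pair c k * X.w m k :=
      Finset.sum_congr rfl fun k _ => by rw [X.pair_symm k c, mul_comm]
    rw [h2] at h1
    linarith
  have hpair2 : ∀ m (c k : I), X.shift K (Pi.single c 1 + Pi.single k 1) m ≠ 0 →
      X.pair c k = 0 := by
    intro m c k h
    have hck : ∃ m', X.w m' = X.w m + fun i => ((Pi.single c 1 + Pi.single k 1 : I → ℤ) i : ℚ) := by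
      by_contra h'
      exact h (shift_eq_zero h')
    have hc : ∃ m', X.w m' = X.w m + fun i => ((Pi.single c 1 : I → ℤ) i : ℚ) := by
      refine X.interval m _ _ (single_nonneg c zero_le_one) ?_ hck
      simp
    have hk : ∃ m', X.w m' = X.w m + Pi.single k 1 := by
      have := X.interval m _ _ (single_nonneg k zero_le_one) (by simp) hck
      simpa only [cast_single, Int.cast_one] using this
    obtain ⟨m₁, hm₁⟩ := hc
    obtain ⟨m₂, hm₂⟩ := hck
    rw [cast_single, Int.cast_one] at hm₁
    have h1 : ∃ m', X.w m' = X.w m₁ + Pi.single k 1 := by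
      refine ⟨m₂, ?_⟩
      rw [hm₂, hm₁, add_assoc]
      congr 1
      ext i
      by_cases h1 : i = c <;> by_cases h2 : i = k <;> simp [Pi.single_apply, h1, h2]
    have e1 := hpair m₁ k h1
    have e0 := hpair m k hk
    simp only [hm₁, Pi.add_apply, mul_add, Finset.sum_add_distrib, e0, Pi.single_apply,
      mul_ite, mul_one, mul_zero, Finset.sum_ite_eq', Finset.mem_univ, if_true, zero_add] at e1
    rw [X.pair_symm, e1]
  refine end_ext fun m => ?_
  have hterm : ∀ c k, (X.pair c k : K) • (X.diffOp π c * X.diffOp π k) (Finsupp.single m 1) =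
      ((X.w m c * (X.pair c k * X.w m k) : ℚ) : K) • Finsupp.single m 1 +
      ((X.pair c k * X.w m k : ℚ) : K) • π • X.shift K (Pi.single c 1) m +
      ((X.pair k c * X.w m c : ℚ) : K) • π • X.shift K (Pi.single k 1) m := by
    intro c k
    by_cases hck : c = k
    · subst hck
      simp [X.pair_self]
    rw [Module.End.mul_apply, diffOp_single, map_add, map_smul, map_smul, diffOp_single, diffOp,
      LinearMap.add_apply, LinearMap.smul_apply, weightOp_shift,
      shiftOp_shift (single_nonneg c zero_le_one) (single_nonneg k zero_le_one),
      Pi.single_eq_of_ne hck]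
    have h2 : (X.pair c k : K) • X.shift K (Pi.single k 1 + Pi.single c 1) m = 0 := by
      by_cases h : X.shift K (Pi.single k 1 + Pi.single c 1) m = 0
      · rw [h, smul_zero]
      · rw [X.pair_symm, hpair2 m k c h, Rat.cast_zero, zero_smul]
    rw [X.pair_symm k c]
    simp only [smul_add, smul_comm (X.pair c k : K), h2, smul_zero, add_zero]
    push_cast
    simp only [smul_smul]
    rw [show π * (((X.w m c : K) + 0) * (X.pair c k : K)) = X.pair c k * X.w m c * π by ring,
      show (X.w m k : K) * (X.w m c * X.pair c k) = X.w m c * (X.pair c k * X.w m k) by ring,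
      show (X.w m k : K) * (π * X.pair c k) = X.pair c k * X.w m k * π by ring]
  simp only [LinearMap.sum_apply, LinearMap.smul_apply, hterm, Finset.sum_add_distrib,
    LinearMap.zero_apply, ← Finset.sum_smul]
  have z1 : ∑ c, ∑ k, ((X.w m c * (X.pair c k * X.w m k) : ℚ) : K) = 0 := by
    rw [← Rat.cast_zero, ← X.isotropic m]
    push_cast
    simp only [Finset.mul_sum]
  have z2 : ∀ c, (∑ k, ((X.pair c k * X.w m k : ℚ) : K)) • π • X.shift K (Pi.single c 1) m = 0 := by
    intro c
    by_cases h : ∃ m', X.w m' = X.w m + Pi.single c 1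
    · have : ∑ k, ((X.pair c k * X.w m k : ℚ) : K) = 0 := by
        rw [← Rat.cast_zero, ← hpair m c h]
        push_cast
        rfl
      rw [this, zero_smul]
    · rw [shift_eq_zero (by simpa only [cast_single, Int.cast_one] using h), smul_zero, smul_zero]
  rw [z1, zero_smul, Finset.sum_comm (f := fun c k => ((X.pair k c * X.w m c : ℚ) : K) • π •
    X.shift K (Pi.single k 1) m)]
  simp only [← Finset.sum_smul, z2, Finset.sum_const_zero, add_zero]

end ShiftSystem

namespace ShiftSystem

variable {I M : Type} [Fintype I] {p : ℕ} {X : ShiftSystem I M p}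
variable {K : Type} [Field K] [CharZero K] {π : K}

omit [CharZero K] in
lemma raiseOp_single_of_nonneg {c : I} {m : M} (h : 0 ≤ X.w m c) :
    X.raiseOp π c (Finsupp.single m 1) = 0 := by
  rw [raiseOp_single, Nat.ceil_eq_zero.2 (by linarith), Finset.sum_range_zero]

omit [CharZero K] in
lemma lowerOp_single_of_lt {c : I} {m : M} (h : X.w m c < 1) :
    X.lowerOp π c (Finsupp.single m 1) = 0 := by
  rw [lowerOp_single, Nat.floor_eq_zero.2 h, Finset.sum_range_zero]

omit [CharZero K] in
lemma raiseCoeff_succ (x : ℚ) (i : ℕ) :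
    raiseCoeff π x (i + 1) = (x : K)⁻¹ * (-π * raiseCoeff π (x + 1) i) := by
  rw [raiseCoeff, raiseCoeff, Finset.prod_range_succ']
  simp only [Nat.cast_add, Nat.cast_one, Nat.cast_zero, add_zero, add_assoc, add_comm (1 : ℚ)]
  ring

omit [CharZero K] in
lemma lowerCoeff_succ (x : ℚ) (i : ℕ) :
    lowerCoeff π x (i + 1) = -π⁻¹ * ((x - 1 : ℚ) : K) * lowerCoeff π (x - 1) i := by
  rw [lowerCoeff, lowerCoeff, Finset.prod_range_succ']
  simp only [Nat.cast_add, Nat.cast_one, Nat.cast_zero, sub_zero, sub_sub, add_comm (1 : ℚ),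
    add_assoc]
  ring

lemma raiseOp_single_of_neg {c : I} {m : M} (h : X.w m c < 0) :
    X.raiseOp π c (Finsupp.single m 1) = (X.w m c : K)⁻¹ •
      (Finsupp.single m 1 - π • X.raiseOp π c (X.shift K (Pi.single c 1) m)) := by
  have hN : ⌈-X.w m c⌉₊ = ⌈-(X.w m c + 1)⌉₊ + 1 := by
    rw [neg_add, ← sub_eq_add_neg, Nat.ceil_sub_one, Nat.sub_add_cancel]
    exact Nat.one_le_ceil_iff.2 (by linarith)
  rw [raiseOp_single, hN, Finset.sum_range_succ', smul_sub, sub_eq_add_neg, add_comm]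
  congr 1
  · simp [raiseCoeff]
  rw [smul_smul, ← neg_smul]
  by_cases hs : ∃ m', X.w m' = X.w m + fun k => ((Pi.single c 1 : I → ℤ) k : ℚ)
  · obtain ⟨m', hm'⟩ := hs
    have hw : X.w m' c = X.w m c + 1 := by simp [hm']
    rw [shift_eq hm', raiseOp_single, Finset.smul_sum, hw]
    refine Finset.sum_congr rfl fun i _ => ?_
    rw [shift_of_w_eq hm', raiseCoeff_succ, smul_smul, ← Pi.single_add]
    push_cast
    rw [add_comm (1 : ℤ)]
    congr 1
    ring
  · rw [shift_eq_zero hs, map_zero, smul_zero]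
    refine Finset.sum_eq_zero fun i _ => ?_
    rw [shift_eq_zero_of_le (single_nonneg c zero_le_one) ?_ hs, smul_zero]
    rw [Pi.single_le_single]
    push_cast
    omega

lemma lowerOp_single_of_eq {c : I} {m m₀ : M} (hm : X.w m₀ = X.w m + Pi.single c (-1))
    (h : 1 ≤ X.w m c) :
    X.lowerOp π c (Finsupp.single m 1) = π⁻¹ • (Finsupp.single m₀ 1 -
      (X.w m₀ c : K) • X.lowerOp π c (Finsupp.single m₀ 1)) := by
  have hN : ⌊X.w m c⌋₊ = ⌊X.w m c - 1⌋₊ + 1 := by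
    rw [Nat.floor_sub_one, Nat.sub_add_cancel]
    exact Nat.one_le_floor_iff _ |>.2 h
  have hm' : X.w m₀ = X.w m + fun k => ((Pi.single c (-1) : I → ℤ) k : ℚ) := by
    rw [cast_single, hm]; simp
  have hw : X.w m₀ c = X.w m c - 1 := by rw [hm]; simp [sub_eq_add_neg]
  rw [lowerOp_single, hN, Finset.sum_range_succ', smul_sub, sub_eq_add_neg (π⁻¹ • _), add_comm]
  congr 1
  · rw [shift_eq (by simpa using hm')]
    simp [lowerCoeff]
  rw [smul_smul, ← neg_smul, lowerOp_single, Finset.smul_sum, hw]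
  refine Finset.sum_congr rfl fun i _ => ?_
  rw [shift_of_w_eq hm', lowerCoeff_succ, smul_smul, ← Pi.single_add]
  congr 1
  · ring
  · congr 2
    push_cast
    ring

lemma exists_lower {c : I} {m : M} (hm : 0 ≤ X.w m) (l : ℕ) (h : l ≤ X.w m c) :
    ∃ m', X.w m' = X.w m + Pi.single c (-(l : ℚ)) := by
  have := X.lower m (Pi.single c (-(l : ℤ))) hm (by
    rw [Pi.single_nonpos]; omega) (by
    rw [cast_single]
    intro k
    by_cases hk : k = c
    · subst hk; simpa using h
    · simpa [hk] using hm k)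
  rw [cast_single] at this
  simpa using this

lemma diffOp_raiseOp_mem (c : I) (m : M) :
    X.diffOp π c (X.raiseOp π c (Finsupp.single m 1)) - Finsupp.single m 1 ∈
      Finsupp.supported K K {m' | 0 ≤ X.w m' c ∧ ∀ k ≠ c, X.w m' k = X.w m k} := by
  obtain ⟨N, hN⟩ : ∃ N : ℕ, -X.w m c ≤ N := exists_nat_ge _
  induction N generalizing m with
  | zero =>
    have h0 : 0 ≤ X.w m c := by simpa using hN
    rw [raiseOp_single_of_nonneg h0, map_zero, zero_sub]
    exact neg_mem (Finsupp.single_mem_supported K _ ⟨h0, fun k _ => rfl⟩)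
  | succ N ih =>
    by_cases h0 : 0 ≤ X.w m c
    · rw [raiseOp_single_of_nonneg h0, map_zero, zero_sub]
      exact neg_mem (Finsupp.single_mem_supported K _ ⟨h0, fun k _ => rfl⟩)
    have hw : (X.w m c : K) ≠ 0 := by
      rw [Ne, Rat.cast_eq_zero]; exact fun h => h0 h.ge
    rw [raiseOp_single_of_neg (not_le.1 h0), map_smul, map_sub, map_smul, diffOp_single]
    by_cases hs : ∃ m', X.w m' = X.w m + fun k => ((Pi.single c 1 : I → ℤ) k : ℚ)
    · obtain ⟨m', hm'⟩ := hs
      have hwc : X.w m' c = X.w m c + 1 := by simp [hm']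
      rw [shift_eq hm']
      have key := ih m' (by rw [hwc]; push_cast at hN; linarith)
      have hwk : ∀ k ≠ c, X.w m' k = X.w m k := fun k hk => by simp [hm', hk]
      have key' := (Finsupp.supported K K _).smul_mem (-((X.w m c : K)⁻¹ * π)) key
      have hset : {m'' | 0 ≤ X.w m'' c ∧ ∀ k ≠ c, X.w m'' k = X.w m' k} =
          {m'' | 0 ≤ X.w m'' c ∧ ∀ k ≠ c, X.w m'' k = X.w m k} := by
        ext m''
        simp only [Set.mem_ofPred_eq]
        refine and_congr_right fun _ => forall₂_congr fun k hk => by rw [hwk k hk]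
      rw [hset] at key'
      convert key' using 1
      rw [smul_sub, smul_sub, smul_add, smul_smul, inv_mul_cancel₀ hw, one_smul, smul_smul,
        smul_smul, neg_smul, neg_smul]
      abel
    · rw [shift_eq_zero hs, map_zero, map_zero, smul_zero, add_zero, sub_zero, smul_smul,
        inv_mul_cancel₀ hw, one_smul, sub_self]
      exact zero_mem _

lemma raiseOp_diffOp_of_neg {c : I} {m : M} (h : X.w m c < 0) :
    X.raiseOp π c (X.diffOp π c (Finsupp.single m 1)) = Finsupp.single m 1 := by
  have hw : (X.w m c : K) ≠ 0 := by
    rw [Ne, Rat.cast_eq_zero]; exact h.ne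
  rw [diffOp_single, map_add, map_smul, map_smul, raiseOp_single_of_neg h, smul_smul,
    mul_inv_cancel₀ hw, one_smul, sub_add_cancel]

omit [CharZero K] in
lemma raiseOp_diffOp_of_nonneg {c : I} {m : M} (h : 0 ≤ X.w m c) :
    X.raiseOp π c (X.diffOp π c (Finsupp.single m 1)) = 0 := by
  rw [diffOp_single, map_add, map_smul, map_smul, raiseOp_single_of_nonneg h]
  by_cases hs : ∃ m', X.w m' = X.w m + fun k => ((Pi.single c 1 : I → ℤ) k : ℚ)
  · obtain ⟨m', hm'⟩ := hs
    rw [shift_eq hm', raiseOp_single_of_nonneg (by simp [hm']; linarith), smul_zero, smul_zero,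
      zero_add]
  · rw [shift_eq_zero hs, map_zero, smul_zero, smul_zero, zero_add]

lemma one_sub_raiseOp_mem (c : I) (m : M) :
    Finsupp.single m 1 - X.raiseOp π c (X.diffOp π c (Finsupp.single m 1)) ∈
      Finsupp.supported K K {m' | 0 ≤ X.w m' c ∧ ∀ k ≠ c, X.w m' k = X.w m k} := by
  by_cases h : 0 ≤ X.w m c
  · rw [raiseOp_diffOp_of_nonneg h, sub_zero]
    exact Finsupp.single_mem_supported K _ ⟨h, fun _ _ => rfl⟩
  · rw [raiseOp_diffOp_of_neg (not_le.1 h), sub_self]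
    exact zero_mem _

lemma weightOp_raiseOp_comm {c k : I} (h : k ≠ c) (m : M) :
    X.weightOp K k (X.raiseOp π c (Finsupp.single m 1)) =
      X.raiseOp π c (X.weightOp K k (Finsupp.single m 1)) := by
  rw [weightOp_single, map_smul, raiseOp_single, map_sum, Finset.smul_sum]
  refine Finset.sum_congr rfl fun i _ => ?_
  rw [map_smul, weightOp_shift, Pi.single_eq_of_ne h, Int.cast_zero, add_zero, smul_comm]

lemma weightOp_lowerOp_comm {c k : I} (h : k ≠ c) (m : M) :
    X.weightOp K k (X.lowerOp π c (Finsupp.single m 1)) =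
      X.lowerOp π c (X.weightOp K k (Finsupp.single m 1)) := by
  rw [weightOp_single, map_smul, lowerOp_single, map_sum, Finset.smul_sum]
  refine Finset.sum_congr rfl fun i _ => ?_
  rw [map_smul, weightOp_shift, Pi.single_eq_of_ne h, Int.cast_zero, add_zero, smul_comm]

omit [CharZero K] in
lemma shiftOp_raiseOp_comm {c k : I} (h : k ≠ c) (m : M) :
    X.shiftOp K (Pi.single k 1) (X.raiseOp π c (Finsupp.single m 1)) =
      X.raiseOp π c (X.shift K (Pi.single k 1) m) := by
  have hk := single_nonneg k (zero_le_one (α := ℤ))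
  have e : X.shiftOp K (Pi.single k 1) (X.raiseOp π c (Finsupp.single m 1)) =
      ∑ i ∈ Finset.range ⌈-X.w m c⌉₊,
        raiseCoeff π (X.w m c) i • X.shift K (Pi.single k 1 + Pi.single c (i : ℤ)) m := by
    rw [raiseOp_single, map_sum]
    refine Finset.sum_congr rfl fun i _ => ?_
    rw [map_smul, shiftOp_shift hk (single_nonneg c (by positivity)), add_comm]
  rw [e]
  by_cases hs : ∃ m', X.w m' = X.w m + fun j => ((Pi.single k 1 : I → ℤ) j : ℚ)
  · obtain ⟨m', hm'⟩ := hs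
    have hw : X.w m' c = X.w m c := by simp [hm', h.symm]
    rw [shift_eq hm', raiseOp_single, hw]
    refine Finset.sum_congr rfl fun i _ => ?_
    rw [shift_of_w_eq hm']
  · rw [shift_eq_zero hs, map_zero]
    refine Finset.sum_eq_zero fun i _ => ?_
    rw [shift_eq_zero_of_le hk ?_ hs, smul_zero]
    exact le_add_of_nonneg_right (single_nonneg c (by positivity))

/-- The commutator of `diffOp` and `raiseOp` creates only nonnegative weights. -/
lemma commutator_raiseOp_mem (c k : I) (m : M) :
    X.diffOp π k (X.raiseOp π c (Finsupp.single m 1)) -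
      X.raiseOp π c (X.diffOp π k (Finsupp.single m 1)) ∈
      Finsupp.supported K K {m' | 0 ≤ X.w m' c ∧ ∀ k ≠ c, X.w m' k = X.w m k} := by
  by_cases h : k = c
  · subst h
    have := add_mem (diffOp_raiseOp_mem (X := X) (π := π) k m)
      (one_sub_raiseOp_mem (X := X) (π := π) k m)
    rwa [sub_add_sub_cancel] at this
  · have : X.diffOp π k (X.raiseOp π c (Finsupp.single m 1)) =
      X.raiseOp π c (X.diffOp π k (Finsupp.single m 1)) := by
      rw [diffOp, LinearMap.add_apply, LinearMap.add_apply, map_add, weightOp_raiseOp_comm h,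
        LinearMap.smul_apply, LinearMap.smul_apply, map_smul, shiftOp_raiseOp_comm h,
        shiftOp_single]
    rw [this, sub_self]
    exact zero_mem _

lemma lowerOp_diffOp_of_exists (hπ : π ≠ 0) {c : I} {m m' : M} (hm : 0 ≤ X.w m)
    (h : X.w m' = X.w m + Pi.single c 1) :
    X.lowerOp π c (X.diffOp π c (Finsupp.single m 1)) = Finsupp.single m 1 := by
  have h' : X.w m' = X.w m + fun k => ((Pi.single c 1 : I → ℤ) k : ℚ) := by
    rw [cast_single, h, Int.cast_one]
  have h0 : X.w m = X.w m' + Pi.single c (-1) := by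
    rw [h, add_assoc, ← Pi.single_add]; simp
  have h1 : 1 ≤ X.w m' c := by
    have : 0 ≤ X.w m c := hm c
    rw [h, Pi.add_apply, Pi.single_eq_same]
    linarith
  rw [diffOp_single, map_add, map_smul, map_smul, shift_eq h', lowerOp_single_of_eq h0 h1,
    smul_smul, mul_inv_cancel₀ hπ, one_smul, add_sub_cancel]

lemma one_sub_lowerOp_mem (hπ : π ≠ 0) (c : I) {m : M} (hm : 0 ≤ X.w m) :
    Finsupp.single m 1 - X.lowerOp π c (X.diffOp π c (Finsupp.single m 1)) ∈
      Finsupp.supported K K {m' | 0 ≤ X.w m' ∧ X.w m' c ≤ 1 ∧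
        ∀ k ≠ c, X.w m' k ≤ max (X.w m k) 1} := by
  by_cases h : ∃ m', X.w m' = X.w m + Pi.single c 1
  · obtain ⟨m', hm'⟩ := h
    rw [lowerOp_diffOp_of_exists hπ hm hm', sub_self]
    exact zero_mem _
  · have h0 := X.eq_zero_of_blocked m c hm h
    rw [diffOp_single, h0, Rat.cast_zero, zero_smul, zero_add, shift_eq_zero (by
      simpa only [cast_single, Int.cast_one] using h), smul_zero, map_zero, sub_zero]
    exact Finsupp.single_mem_supported K _ ⟨hm, by rw [h0]; norm_num, fun k _ => le_max_left _ _⟩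

lemma diffOp_lowerOp_mem (hπ : π ≠ 0) (c : I) {m : M} (hm : 0 ≤ X.w m) :
    X.diffOp π c (X.lowerOp π c (Finsupp.single m 1)) - Finsupp.single m 1 ∈
      Finsupp.supported K K {m' | 0 ≤ X.w m' ∧ X.w m' c ≤ 1 ∧
        ∀ k ≠ c, X.w m' k ≤ max (X.w m k) 1} := by
  obtain ⟨N, hN⟩ : ∃ N : ℕ, X.w m c < N := exists_nat_gt _
  induction N generalizing m with
  | zero => exact absurd (hm c) (by simpa using hN)
  | succ N ih =>
    by_cases h1 : X.w m c < 1
    · rw [lowerOp_single_of_lt h1, map_zero, zero_sub]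
      exact neg_mem (Finsupp.single_mem_supported K _ ⟨hm, h1.le, fun k _ => le_max_left _ _⟩)
    rw [not_lt] at h1
    obtain ⟨m₀, hm₀⟩ := exists_lower hm 1 (by simpa using h1)
    rw [Nat.cast_one] at hm₀
    have hwc : X.w m₀ c = X.w m c - 1 := by rw [hm₀]; simp [sub_eq_add_neg]
    have hwk : ∀ k ≠ c, X.w m₀ k = X.w m k := fun k hk => by rw [hm₀]; simp [hk]
    have hpos : 0 ≤ X.w m₀ := by
      intro k
      by_cases hk : k = c
      · subst hk
        rw [Pi.zero_apply, hwc]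
        linarith
      · rw [hwk k hk]; exact hm k
    have key := ih hpos (by rw [hwc]; push_cast at hN; linarith)
    have hset : {m' | 0 ≤ X.w m' ∧ X.w m' c ≤ 1 ∧ ∀ k ≠ c, X.w m' k ≤ max (X.w m₀ k) 1} =
        {m' | 0 ≤ X.w m' ∧ X.w m' c ≤ 1 ∧ ∀ k ≠ c, X.w m' k ≤ max (X.w m k) 1} := by
      ext m''
      simp only [Set.mem_ofPred_eq]
      refine and_congr_right fun _ => and_congr_right fun _ =>
        forall₂_congr fun k hk => by rw [hwk k hk]
    rw [hset] at key
    have hshift : X.shift K (Pi.single c 1) m₀ = Finsupp.single m 1 := by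
      refine shift_eq ?_
      rw [cast_single, hm₀, Int.cast_one, add_assoc, ← Pi.single_add]
      simp
    rw [lowerOp_single_of_eq hm₀ h1, map_smul, map_sub, map_smul, diffOp_single, hshift]
    convert (Finsupp.supported K K _).smul_mem (-(π⁻¹ * (X.w m₀ c : K))) key using 1
    rw [smul_sub, smul_sub, smul_add, smul_smul, smul_smul, smul_smul, inv_mul_cancel₀ hπ,
      one_smul, neg_smul, neg_smul]
    abel

omit [CharZero K] in
lemma shiftOp_lowerOp_sub_mem {c k : I} (h : k ≠ c) {m : M} (hm : 0 ≤ X.w m) :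
    X.shiftOp K (Pi.single k 1) (X.lowerOp π c (Finsupp.single m 1)) -
      X.lowerOp π c (X.shift K (Pi.single k 1) m) ∈
      Finsupp.supported K K {m' | 0 ≤ X.w m' ∧ X.w m' c ≤ 1 ∧
        ∀ k ≠ c, X.w m' k ≤ max (X.w m k) 1} := by
  have hlow : ∀ i ∈ Finset.range ⌊X.w m c⌋₊, ∃ m',
      X.w m' = X.w m + Pi.single c (-((i + 1 : ℕ) : ℚ)) := by
    intro i hi
    refine exists_lower hm _ ?_
    have := Nat.floor_le (hm c)
    rw [Finset.mem_range] at hi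
    refine le_trans ?_ this
    exact_mod_cast hi
  have hcast : ∀ (i : ℕ) m', X.w m' = X.w m + Pi.single c (-((i + 1 : ℕ) : ℚ)) →
      X.w m' = X.w m + fun j => ((Pi.single c (-(i + 1 : ℤ)) : I → ℤ) j : ℚ) := by
    intro i m' h'
    rw [cast_single, h']
    push_cast
    rfl
  rw [lowerOp_single, map_sum]
  by_cases hs : ∃ m', X.w m' = X.w m + fun j => ((Pi.single k 1 : I → ℤ) j : ℚ)
  · obtain ⟨m₁, hm₁⟩ := hs
    have hw : X.w m₁ c = X.w m c := by simp [hm₁, h.symm]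
    rw [shift_eq hm₁, lowerOp_single, hw, ← Finset.sum_sub_distrib]
    refine sum_mem fun i hi => ?_
    obtain ⟨m', hm'⟩ := hlow i hi
    rw [map_smul, shift_eq (hcast i m' hm'), shiftOp_single, shift_of_w_eq (hcast i m' hm'),
      shift_of_w_eq hm₁, add_comm, sub_self]
    exact zero_mem _
  · rw [shift_eq_zero hs, map_zero, sub_zero]
    refine sum_mem fun i hi => ?_
    obtain ⟨m', hm'⟩ := hlow i hi
    rw [map_smul, shift_eq (hcast i m' hm'), shiftOp_single]
    refine Submodule.smul_mem _ _ ?_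
    by_cases hs' : ∃ m'', X.w m'' = X.w m' + fun j => ((Pi.single k 1 : I → ℤ) j : ℚ)
    · obtain ⟨m'', hm''⟩ := hs'
      rw [shift_eq hm'']
      have hmm' : X.w m = X.w m' + Pi.single c ((i + 1 : ℕ) : ℚ) := by
        rw [hm', add_assoc, ← Pi.single_add]
        simp
      have hle : X.w m' c ≤ 0 := by
        by_contra hpos
        refine hs ?_
        have := X.unblocked m m' c k (i + 1) hm hmm' (not_le.1 hpos) h
          ⟨m'', by rw [hm'', cast_single, Int.cast_one]⟩
        simpa only [cast_single, Int.cast_one] using this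
      have hge : 0 ≤ X.w m' c := by
        have h1 : X.w m' c = X.w m c - (i + 1 : ℕ) := by rw [hm']; simp [sub_eq_add_neg]
        have h2 := Nat.floor_le (hm c)
        have h3 : ((i + 1 : ℕ) : ℚ) ≤ ⌊X.w m c⌋₊ := by
          exact_mod_cast Finset.mem_range.1 hi
        rw [h1]
        change (⌊X.w m c⌋₊ : ℚ) ≤ X.w m c at h2
        linarith
      have hk0 : X.w m k = 0 := X.eq_zero_of_blocked m k hm
        (by simpa only [cast_single, Int.cast_one] using hs)
      have e1 : X.w m'' c = X.w m' c := by simp [hm'', h.symm]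
      have e2 : X.w m'' k = 1 := by simp [hm'', hm', h, hk0]
      have e3 : ∀ j ≠ c, j ≠ k → X.w m'' j = X.w m j := fun j hj hj' => by
        simp [hm'', hm', hj, hj']
      refine Finsupp.single_mem_supported K _ ⟨fun j => ?_, by linarith, fun j hj => ?_⟩
      · by_cases hj : j = c
        · subst hj; rw [e1]; exact hge
        by_cases hj' : j = k
        · subst hj'; rw [e2]; exact zero_le_one
        · rw [e3 j hj hj']; exact hm j
      · by_cases hj' : j = k
        · subst hj'; rw [e2]; exact le_max_right _ _
        · rw [e3 j hj hj']; exact le_max_left _ _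
    · rw [shift_eq_zero hs']
      exact zero_mem _

/-- The commutator of `diffOp` and `lowerOp` creates only bounded weights. -/
lemma commutator_lowerOp_mem (hπ : π ≠ 0) (c k : I) {m : M} (hm : 0 ≤ X.w m) :
    X.diffOp π k (X.lowerOp π c (Finsupp.single m 1)) -
      X.lowerOp π c (X.diffOp π k (Finsupp.single m 1)) ∈
      Finsupp.supported K K {m' | 0 ≤ X.w m' ∧ X.w m' c ≤ 1 ∧
        ∀ k ≠ c, X.w m' k ≤ max (X.w m k) 1} := by
  by_cases h : k = c
  · subst h
    have := add_mem (diffOp_lowerOp_mem (X := X) hπ k hm) (one_sub_lowerOp_mem (X := X) hπ k hm)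
    rwa [sub_add_sub_cancel] at this
  · rw [diffOp, LinearMap.add_apply, LinearMap.add_apply, map_add, weightOp_lowerOp_comm h,
      LinearMap.smul_apply, LinearMap.smul_apply, map_smul, add_sub_add_left_eq_sub, ← smul_sub,
      shiftOp_single]
    exact Submodule.smul_mem _ _ (shiftOp_lowerOp_sub_mem h hm)

omit [CharZero K] in
lemma lowerOp_mem (c : I) {m : M} (hm : 0 ≤ X.w m) :
    X.lowerOp π c (Finsupp.single m 1) ∈ Finsupp.supported K K {m' | 0 ≤ X.w m'} := by
  rw [lowerOp_single]
  refine sum_mem fun i hi => Submodule.smul_mem _ _ ?_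
  have hi' : ((i + 1 : ℕ) : ℚ) ≤ X.w m c :=
    le_trans (by exact_mod_cast Finset.mem_range.1 hi) (Nat.floor_le (hm c))
  obtain ⟨m', hm'⟩ := exists_lower hm _ hi'
  rw [shift_eq (m' := m') (by rw [cast_single, hm']; push_cast; rfl)]
  refine Finsupp.single_mem_supported K _ fun k => ?_
  by_cases hk : k = c
  · subst hk
    rw [hm', Pi.add_apply, Pi.single_eq_same]
    rw [Pi.zero_apply]
    linarith
  · simpa [hm', hk] using hm k

omit [CharZero K] in
lemma diffOp_mem (c : I) {m : M} (hm : 0 ≤ X.w m) :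
    X.diffOp π c (Finsupp.single m 1) ∈ Finsupp.supported K K {m' | 0 ≤ X.w m'} := by
  rw [diffOp_single]
  refine add_mem (Submodule.smul_mem _ _ (Finsupp.single_mem_supported K _ hm))
    (Submodule.smul_mem _ _ ?_)
  by_cases hs : ∃ m', X.w m' = X.w m + fun j => ((Pi.single c 1 : I → ℤ) j : ℚ)
  · obtain ⟨m', hm'⟩ := hs
    rw [shift_eq hm']
    refine Finsupp.single_mem_supported K _ ?_
    rw [Set.mem_ofPred_eq, hm', cast_single]
    exact add_nonneg hm (Pi.single_nonneg.2 (by simp))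
  · rw [shift_eq_zero hs]
    exact zero_mem _

end ShiftSystem

section PadicNorm

lemma pow_dvd_prod_sub_mul {p N i d : ℕ} (hN : p ^ N ∣ i.factorial) (hd : p.Coprime d) (z : ℤ) :
    (p : ℤ) ^ N ∣ ∏ t ∈ Finset.range i, (z - d * t) := by
  obtain ⟨a, b, hab⟩ : IsCoprime (d : ℤ) ((p : ℤ) ^ N) :=
    (Nat.isCoprime_iff_coprime.2 hd.symm).pow_right
  have h1 : ∏ t ∈ Finset.range i, (z - d * t) ≡ ∏ t ∈ Finset.range i, (d * (a * z - t) : ℤ)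
      [ZMOD (p : ℤ) ^ N] := by
    refine Int.ModEq.prod fun t _ => ?_
    refine (Int.modEq_iff_dvd.2 ⟨-(b * z), ?_⟩)
    linear_combination z * hab
  rw [Finset.prod_mul_distrib, ← descPochhammer_eval_eq_prod_range, Polynomial.eval_eq_smeval,
    Ring.descPochhammer_eq_factorial_smul_choose] at h1
  refine (Int.ModEq.dvd_iff h1).2 (Dvd.dvd.mul_left ?_ _)
  rw [nsmul_eq_mul]
  exact Dvd.dvd.mul_right (by exact_mod_cast hN) _

variable {p : ℕ} [hp : Fact p.Prime] {K : Type} [NontriviallyNormedField K]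
  [IsUltrametricDist K] (hpn : ‖(p : K)‖ = (p : ℝ)⁻¹)

include hpn

lemma norm_natCast_eq_one {d : ℕ} (hd : p.Coprime d) : ‖(d : K)‖ = 1 := by
  refine le_antisymm (IsUltrametricDist.norm_natCast_le_one K d) ?_
  obtain ⟨a, b, hab⟩ := Nat.isCoprime_iff_coprime.2 hd.symm
  have h1 : (a : K) * d + b * p = 1 := by exact_mod_cast congrArg (Int.cast : ℤ → K) hab
  by_contra hlt
  have hp1 : (p : ℝ)⁻¹ < 1 := inv_lt_one_of_one_lt₀ (by exact_mod_cast hp.out.one_lt)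
  have ha := IsUltrametricDist.norm_intCast_le_one K a
  have hb := IsUltrametricDist.norm_intCast_le_one K b
  have h2 : ‖(a : K) * d + b * p‖ < 1 := by
    refine (IsUltrametricDist.norm_add_le_max _ _).trans_lt (max_lt ?_ ?_)
    · rw [norm_mul]
      exact (mul_le_of_le_one_left (norm_nonneg _) ha).trans_lt (not_le.1 hlt)
    · rw [norm_mul, hpn]
      exact (mul_le_of_le_one_left (by positivity) hb).trans_lt hp1
  rw [h1, norm_one] at h2
  exact lt_irrefl _ h2

lemma norm_natCast_eq {m : ℕ} (hm : m ≠ 0) : ‖(m : K)‖ = ((p : ℝ)⁻¹) ^ padicValNat p m := by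
  obtain ⟨v, n', hn', hv⟩ := Nat.exists_eq_pow_mul_and_not_dvd hm p hp.out.ne_one
  have hc : p.Coprime n' := (Nat.Prime.coprime_iff_not_dvd hp.out).2 hn'
  have h0 : n' ≠ 0 := by rintro rfl; simp at hn'
  rw [hv, padicValNat.mul (pow_ne_zero _ hp.out.ne_zero) h0, padicValNat.prime_pow,
    padicValNat.eq_zero_of_not_dvd hn', Nat.cast_mul, norm_mul, norm_natCast_eq_one hpn hc,
    Nat.cast_pow, norm_pow, hpn, mul_one, add_zero]

lemma inv_natAbs_le_norm {z : ℤ} (hz : z ≠ 0) : ((z.natAbs : ℝ))⁻¹ ≤ ‖(z : K)‖ := by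
  have h0 : z.natAbs ≠ 0 := by omega
  have h1 : ‖(z : K)‖ = ‖(z.natAbs : K)‖ := by
    rcases Int.natAbs_eq z with h | h
    · conv_lhs => rw [h, Int.cast_natCast]
    · conv_lhs => rw [h, Int.cast_neg, norm_neg, Int.cast_natCast]
  rw [h1, norm_natCast_eq hpn h0, inv_pow]
  gcongr
  · exact_mod_cast pow_pos hp.out.pos _
  · exact_mod_cast Nat.le_of_dvd (Nat.pos_of_ne_zero h0) pow_padicValNat_dvd

variable {π : K} (hπ : π ^ (p - 1) = -(p : K))

include hπ

omit hp [IsUltrametricDist K] in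
lemma norm_pi_pow : ‖π‖ ^ (p - 1) = (p : ℝ)⁻¹ := by
  rw [← norm_pow, hπ, norm_neg, hpn]

omit [IsUltrametricDist K] in
lemma pi_ne_zero : π ≠ 0 := by
  rintro rfl
  have h := norm_pi_pow hpn hπ
  rw [norm_zero, zero_pow (Nat.sub_ne_zero_of_lt hp.out.one_lt)] at h
  exact (inv_ne_zero (by exact_mod_cast hp.out.ne_zero : (p : ℝ) ≠ 0)) h.symm

omit [IsUltrametricDist K] in
lemma norm_pi_le_one : ‖π‖ ≤ 1 := by
  by_contra h
  have h1 := one_lt_pow₀ (not_le.1 h) (Nat.sub_ne_zero_of_lt hp.out.one_lt)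
  rw [norm_pi_pow hpn hπ] at h1
  have : (p : ℝ)⁻¹ < 1 := inv_lt_one_of_one_lt₀ (by exact_mod_cast hp.out.one_lt)
  linarith

omit [IsUltrametricDist K] in
lemma norm_pi_inv_le : ‖π‖⁻¹ ≤ p := by
  rw [← inv_inv (p : ℝ), ← norm_pi_pow hpn hπ]
  refine inv_anti₀ (pow_pos (norm_pos_iff.2 (pi_ne_zero hpn hπ)) _) ?_
  exact pow_le_of_le_one (norm_nonneg _) (norm_pi_le_one hpn hπ)
    (Nat.sub_ne_zero_of_lt hp.out.one_lt)

lemma norm_factorial_pow (i : ℕ) : ‖(i.factorial : K)‖ ^ (p - 1) =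
    (p : ℝ) ^ (p.digits i).sum * (‖π‖ ^ i) ^ (p - 1) := by
  have hp0 : (p : ℝ) ≠ 0 := by exact_mod_cast hp.out.ne_zero
  rw [norm_natCast_eq hpn i.factorial_ne_zero, ← pow_mul, mul_comm (padicValNat _ _),
    sub_one_mul_padicValNat_factorial, ← pow_mul, mul_comm i, pow_mul, norm_pi_pow hpn hπ]
  obtain ⟨j, hj⟩ := Nat.exists_eq_add_of_le (Nat.digit_sum_le p i)
  generalize (p.digits i).sum = s at hj ⊢
  rw [hj, Nat.add_sub_cancel_left, pow_add, ← mul_assoc, ← mul_pow, mul_inv_cancel₀ hp0, one_pow,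
    one_mul]

lemma norm_pi_pow_le (i : ℕ) : ‖π‖ ^ i ≤ ‖(i.factorial : K)‖ := by
  refine le_of_pow_le_pow_left₀ (Nat.sub_ne_zero_of_lt hp.out.one_lt) (norm_nonneg _) ?_
  rw [norm_factorial_pow hpn hπ]
  exact le_mul_of_one_le_left (by positivity)
    (one_le_pow₀ (by exact_mod_cast hp.out.one_lt.le))

lemma norm_factorial_le (i : ℕ) : ‖(i.factorial : K)‖ ≤ p * (i + 1) * ‖π‖ ^ i := by
  refine le_of_pow_le_pow_left₀ (Nat.sub_ne_zero_of_lt hp.out.one_lt) (by positivity) ?_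
  rw [norm_factorial_pow hpn hπ, mul_pow _ (‖π‖ ^ i)]
  gcongr
  have h1 : (p.digits i).sum ≤ (p.digits i).length * (p - 1) :=
    List.sum_le_card_nsmul _ _ fun d hd => Nat.le_sub_one_of_lt
      (Nat.digits_lt_base hp.out.one_lt hd)
  have h2 : p ^ (p.digits i).length ≤ p * (i + 1) := by
    rcases eq_or_ne i 0 with rfl | hi
    · simp [hp.out.one_lt.le]
    · exact (Nat.base_pow_length_digits_le p i hp.out.one_lt hi).trans (by gcongr; omega)
  calc (p : ℝ) ^ (p.digits i).sum ≤ (p : ℝ) ^ ((p.digits i).length * (p - 1)) :=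
        pow_le_pow_right₀ (by exact_mod_cast hp.out.one_lt.le) h1
    _ = ((p : ℝ) ^ (p.digits i).length) ^ (p - 1) := pow_mul _ _ _
    _ ≤ (p * (i + 1)) ^ (p - 1) := by
        gcongr
        exact_mod_cast h2

omit hπ in
lemma norm_prod_sub_le [CharZero K] {d i : ℕ} (hd : p.Coprime d) {x : ℚ} {z : ℤ}
    (hx : d * x = z) : ‖∏ t ∈ Finset.range i, ((x - t : ℚ) : K)‖ ≤ ‖(i.factorial : K)‖ := by
  have h1 : (d : K) ^ i * ∏ t ∈ Finset.range i, ((x - t : ℚ) : K) =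
      ((∏ t ∈ Finset.range i, (z - d * t) : ℤ) : K) := by
    have hx' : (d : K) * (x : K) = z := by exact_mod_cast congrArg (Rat.cast : ℚ → K) hx
    rw [Int.cast_prod, ← Finset.card_range i, ← Finset.prod_const, Finset.card_range,
      ← Finset.prod_mul_distrib]
    refine Finset.prod_congr rfl fun t _ => ?_
    push_cast
    rw [mul_sub, hx']
  have h2 := congrArg norm h1
  rw [norm_mul, norm_pow, norm_natCast_eq_one hpn hd, one_pow, one_mul] at h2
  obtain ⟨q, hq⟩ := pow_dvd_prod_sub_mul (pow_padicValNat_dvd (p := p) (n := i.factorial)) hd z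
  rw [h2, hq, norm_natCast_eq hpn i.factorial_ne_zero]
  push_cast
  rw [norm_mul, norm_pow, hpn]
  exact mul_le_of_le_one_right (by positivity) (IsUltrametricDist.norm_intCast_le_one K q)

omit hpn hπ hp in
lemma norm_factorial_mul_prod_inv_le {l : ℕ} {x : K} {B : ℝ}
    (h : ∀ i ≤ l, x + i ≠ 0 ∧ ‖(x + i)⁻¹‖ ≤ B) :
    ‖(l.factorial : K) * ∏ i ∈ Finset.range (l + 1), (x + i)⁻¹‖ ≤ B := by
  induction l generalizing x with
  | zero => simpa using (h 0 le_rfl).2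
  | succ l ih =>
    have e1 := ih (x := x) fun i hi => h i (by omega)
    have e2 := ih (x := x + 1) fun i hi => by
      have := h (i + 1) (by omega)
      push_cast at this
      rwa [add_assoc, add_comm 1]
    have hx := (h 0 (by omega)).1
    have hl := (h (l + 1) le_rfl).1
    rw [Nat.cast_zero, add_zero] at hx
    push_cast at hl
    have key : ((l + 1).factorial : K) * ∏ i ∈ Finset.range (l + 1 + 1), (x + i)⁻¹ =
        (l.factorial : K) * ∏ i ∈ Finset.range (l + 1), (x + i)⁻¹ -
        (l.factorial : K) * ∏ i ∈ Finset.range (l + 1), (x + 1 + i)⁻¹ := by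
      have f1 : ∏ i ∈ Finset.range (l + 1), (x + 1 + i)⁻¹ =
          (∏ i ∈ Finset.range l, (x + 1 + i)⁻¹) * (x + (l + 1))⁻¹ := by
        rw [Finset.prod_range_succ]; congr 2; ring
      have f2 : ∏ i ∈ Finset.range (l + 1), (x + i)⁻¹ =
          (∏ i ∈ Finset.range l, (x + 1 + i)⁻¹) * x⁻¹ := by
        rw [Finset.prod_range_succ']
        push_cast
        simp only [add_zero, add_assoc, add_comm (1 : K)]
      rw [Finset.prod_range_succ, f1, f2, Nat.factorial_succ]
      push_cast
      field_simp
      ring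
    rw [key]
    rw [sub_eq_add_neg]
    exact (IsUltrametricDist.norm_add_le_max _ _).trans (max_le e1 (by rwa [norm_neg]))

end PadicNorm

namespace ShiftSystem

variable {I M : Type} [Fintype I] {p : ℕ} [hp : Fact p.Prime] {X : ShiftSystem I M p}
variable {K : Type} [NontriviallyNormedField K] [IsUltrametricDist K] [CharZero K] {π : K}
  (hpn : ‖(p : K)‖ = (p : ℝ)⁻¹) (hπ : π ^ (p - 1) = -(p : K))

omit [CharZero K] [IsUltrametricDist K] hp in
lemma norm_shift_le (v : I → ℤ) (m m' : M) : ‖X.shift K v m m'‖ ≤ 1 := by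
  rw [shift]
  split_ifs with h
  · rw [Finsupp.single_apply]
    split_ifs <;> simp
  · simp

omit [CharZero K] hp in
lemma isTame_of_shifts {T : Module.End K (M →₀ K)} (c : I) (N : M → ℕ) (a : M → ℕ → K)
    (z : ℕ → ℤ) (C k : ℕ) (hz : ∀ i, (z i).natAbs ≤ i + 1)
    (hN : ∀ m, N m ≤ X.bd * X.deg m + 1)
    (ha : ∀ m, ∀ i < N m, ‖a m i‖ ≤ C * (X.deg m + 1) ^ k)
    (hT : ∀ m, T (Finsupp.single m 1) =
      ∑ i ∈ Finset.range (N m), a m i • X.shift K (Pi.single c (z i)) m) :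
    IsTame K X.deg T := by
  refine isTame_of_poly_bound (C + X.bd + X.bd * X.bd + 1) k fun m m' h => ⟨?_, ?_⟩
  · rw [hT, Finsupp.finsetSum_apply] at h
    obtain ⟨i, hi, hne⟩ := Finset.exists_ne_zero_of_sum_ne_zero h
    rw [Finsupp.smul_apply, smul_eq_mul] at hne
    have hne' := right_ne_zero_of_mul hne
    have hw : X.w m' = X.w m + Pi.single c ((z i : ℤ) : ℚ) := by
      by_cases hs : ∃ m', X.w m' = X.w m + fun k => ((Pi.single c (z i) : I → ℤ) k : ℚ)
      · obtain ⟨m₁, hm₁⟩ := hs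
        rw [shift_eq hm₁, Finsupp.single_apply] at hne'
        have : m₁ = m' := by
          by_contra h'
          simp [h'] at hne'
        rw [← this, hm₁, cast_single]
      · rw [shift_eq_zero hs] at hne'
        exact absurd rfl hne'
    have h1 := X.deg_le m m' c (z i) hw
    have h2 : (z i).natAbs ≤ X.bd * X.deg m + 1 :=
      (hz i).trans ((Finset.mem_range.1 hi).trans_le (hN m))
    have h3 : X.bd * (z i).natAbs ≤ X.bd * (X.bd * X.deg m + 1) := Nat.mul_le_mul_left _ h2
    nlinarith [Nat.zero_le (C * (X.deg m + 1)), Nat.zero_le (X.bd * X.deg m),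
      Nat.zero_le (X.bd * X.bd)]
  · rw [hT, Finsupp.finsetSum_apply]
    refine IsUltrametricDist.norm_sum_le_of_forall_le_of_nonneg (by positivity) fun i hi => ?_
    rw [Finsupp.smul_apply, smul_eq_mul, norm_mul]
    refine (mul_le_of_le_one_right (norm_nonneg _) (norm_shift_le _ _ _)).trans
      ((ha m i (Finset.mem_range.1 hi)).trans ?_)
    gcongr
    linarith [Nat.zero_le X.bd, Nat.zero_le (X.bd * X.bd)]

include hpn in
lemma norm_weight_le (m : M) (c : I) : ‖(X.w m c : K)‖ ≤ 1 := by
  obtain ⟨z, hz⟩ := X.den_mul m c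
  have h : (X.den : K) * (X.w m c : K) = z := by exact_mod_cast congrArg (Rat.cast : ℚ → K) hz
  have h' := congrArg norm h
  rw [norm_mul, norm_natCast_eq_one hpn X.coprime_den, one_mul] at h'
  rw [h']
  exact IsUltrametricDist.norm_intCast_le_one K z

include hpn hπ in
lemma isTame_diffOp (c : I) : IsTame K X.deg (X.diffOp π c) := by
  refine IsTame.add ?_ ?_
  · refine isTame_of_shifts (X := X) c (fun _ => 1) (fun m _ => (X.w m c : K)) (fun _ => 0) 1 0
      (by simp) (by simp) (fun m i _ => by simpa using norm_weight_le hpn m c) fun m => by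
        simp only [Finset.range_one, Finset.sum_singleton, weightOp_single, Pi.single_zero,
          shift_zero]
  · refine isTame_of_shifts (X := X) c (fun _ => 1) (fun m _ => π) (fun _ => 1) 1 0
      (by simp) (by simp) (fun m i _ => by simpa using norm_pi_le_one hpn hπ) fun m => by
        simp

include hpn hπ in
lemma isTame_lowerOp (c : I) : IsTame K X.deg (X.lowerOp π c) := by
  have hfl : ∀ m, ⌊X.w m c⌋₊ ≤ X.bd * X.deg m := fun m => by
    have := Nat.floor_le_floor ((le_abs_self _).trans (X.abs_w_le m c))
    rwa [← Nat.cast_mul, Nat.floor_natCast] at this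
  refine isTame_of_shifts (X := X) c (fun m => ⌊X.w m c⌋₊) (fun m => lowerCoeff π (X.w m c))
    (fun i => -(i + 1 : ℤ)) (p * p * (X.bd + 1)) 1 (fun i => by omega)
    (fun m => (hfl m).trans (Nat.le_succ _)) (fun m i hi => ?_) (fun m => lowerOp_single c m)
  obtain ⟨z, hz⟩ := X.den_mul m c
  have h1 : ‖∏ t ∈ Finset.range i, ((X.w m c - 1 - t : ℚ) : K)‖ ≤ ‖(i.factorial : K)‖ :=
    norm_prod_sub_le hpn X.coprime_den (z := z - X.den) (by
      rw [mul_sub, hz, mul_one]; push_cast; rfl)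
  have h2 := h1.trans (norm_factorial_le hpn hπ i)
  have hπ0 : 0 < ‖π‖ := norm_pos_iff.2 (pi_ne_zero hpn hπ)
  have h3 : (i : ℝ) + 1 ≤ X.bd * X.deg m := by exact_mod_cast Nat.lt_of_lt_of_le hi (hfl m)
  have h4 := norm_pi_inv_le hpn hπ
  rw [lowerCoeff, Finset.prod_mul_distrib, Finset.prod_const, Finset.card_range, norm_mul,
    norm_mul, norm_pow, norm_neg, norm_inv]
  calc ‖π‖⁻¹ * (‖π‖⁻¹ ^ i * ‖∏ t ∈ Finset.range i, ((X.w m c - 1 - t : ℚ) : K)‖)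
      ≤ p * (‖π‖⁻¹ ^ i * (p * (i + 1) * ‖π‖ ^ i)) := by gcongr
    _ = p * p * (i + 1) := by
      rw [inv_pow]
      field_simp
    _ ≤ p * p * (X.bd * X.deg m) := by gcongr
    _ ≤ ((p * p * (X.bd + 1) : ℕ) : ℝ) * (X.deg m + 1) ^ 1 := by
      push_cast
      rw [pow_one, mul_assoc _ (_ + 1 : ℝ)]
      gcongr <;> linarith

include hpn hπ in
lemma isTame_raiseOp (c : I) : IsTame K X.deg (X.raiseOp π c) := by
  have hfl : ∀ m, ⌈-X.w m c⌉₊ ≤ X.bd * X.deg m := fun m => by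
    rw [Nat.ceil_le]
    exact_mod_cast (neg_le_abs _).trans (X.abs_w_le m c)
  refine isTame_of_shifts (X := X) c (fun m => ⌈-X.w m c⌉₊) (fun m => raiseCoeff π (X.w m c))
    (fun i => (i : ℤ)) (X.den * X.bd) 1 (fun i => by simp)
    (fun m => (hfl m).trans (Nat.le_succ _)) (fun m l hl => ?_) (fun m => raiseOp_single c m)
  have hneg : ∀ i ≤ l, X.w m c + i < 0 := fun i hi => by
    have := Nat.lt_ceil.1 (hi.trans_lt hl)
    linarith
  have hden : ‖(X.den : K)‖ = 1 := norm_natCast_eq_one hpn X.coprime_den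
  have hbound : ∀ i ≤ l, (X.w m c : K) + i ≠ 0 ∧
      ‖((X.w m c : K) + i)⁻¹‖ ≤ X.den * (X.bd * X.deg m) := by
    intro i hi
    have hlt := hneg i hi
    obtain ⟨z, hz⟩ := X.den_mul m c
    have h1 : (X.den : K) * ((X.w m c : K) + i) = (z + X.den * i : ℤ) := by
      have : (X.den : K) * (X.w m c : K) = z := by exact_mod_cast congrArg (Rat.cast : ℚ → K) hz
      push_cast
      rw [mul_add, this]
    have h2 : ((z + X.den * i : ℤ) : ℚ) = X.den * (X.w m c + i) := by
      push_cast
      rw [mul_add, hz]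
    have hd0 : (0 : ℚ) < X.den := by
      have : X.den ≠ 0 := fun h0 => by
        have := X.coprime_den
        rw [h0, Nat.coprime_zero_right] at this
        exact hp.out.ne_one this
      exact_mod_cast Nat.pos_of_ne_zero this
    have h3 : z + X.den * i ≠ 0 := by
      intro h0
      rw [h0, Int.cast_zero] at h2
      exact (mul_neg_of_pos_of_neg hd0 hlt).ne h2.symm
    have h4 := inv_natAbs_le_norm hpn h3
    have h5 := congrArg norm h1
    rw [norm_mul, hden, one_mul] at h5
    have h6 : ((z + X.den * i : ℤ).natAbs : ℚ) ≤ X.den * (X.bd * X.deg m) := by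
      rw [Nat.cast_natAbs, Int.cast_abs, h2, abs_mul, abs_of_pos hd0, abs_of_neg hlt]
      gcongr
      have := (neg_le_abs _).trans (X.abs_w_le m c)
      have : (0 : ℚ) ≤ i := by positivity
      linarith
    have h7 : ((z + X.den * i : ℤ).natAbs : ℝ) ≤ X.den * (X.bd * X.deg m) := by
      exact_mod_cast h6
    have h8 : (0 : ℝ) < ((z + X.den * i : ℤ).natAbs : ℝ) := by
      exact_mod_cast Int.natAbs_pos.2 h3
    refine ⟨fun h0 => ?_, ?_⟩
    · rw [h0, norm_zero] at h5
      rw [← h5] at h4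
      exact absurd h4 (not_le.2 (inv_pos.2 h8))
    · rw [norm_inv, h5]
      exact (inv_le_of_inv_le₀ h8 h4).trans h7
  have key := norm_factorial_mul_prod_inv_le hbound
  have e : raiseCoeff π (X.w m c) l = (-π) ^ l *
      ∏ i ∈ Finset.range (l + 1), ((X.w m c : K) + i)⁻¹ := by
    rw [raiseCoeff, Finset.prod_mul_distrib, Finset.prod_const, Finset.card_range,
      Finset.prod_range_succ]
    push_cast
    ring
  rw [e, norm_mul, norm_pow, norm_neg]
  rw [norm_mul] at key
  calc _ ≤ ‖(l.factorial : K)‖ * ‖∏ i ∈ Finset.range (l + 1), ((X.w m c : K) + i)⁻¹‖ := by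
        gcongr
        exact norm_pi_pow_le hpn hπ l
    _ ≤ X.den * (X.bd * X.deg m) := key
    _ ≤ _ := by
      push_cast
      rw [pow_one, mul_assoc]
      gcongr
      linarith

end ShiftSystem

section Exterior

variable {F : Type} [Field F] {ι : Type} [LinearOrder ι]

lemma neg_one_pow_card_insert {i j : ι} {S : Finset ι} (hj : j ∉ S) :
    (-1 : F) ^ ((insert j S).filter (· < i)).card =
      (if j < i then -1 else 1) * (-1) ^ (S.filter (· < i)).card := by
  rw [Finset.filter_insert]
  split_ifs with h
  · rw [Finset.card_insert_of_notMem (by simp [hj]), pow_succ, mul_comm]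
  · rw [one_mul]

lemma neg_one_pow_card_erase {i j : ι} {S : Finset ι} (hj : j ∈ S) :
    (-1 : F) ^ ((S.erase j).filter (· < i)).card =
      (if j < i then -1 else 1) * (-1) ^ (S.filter (· < i)).card := by
  conv_rhs => rw [← Finset.insert_erase hj, neg_one_pow_card_insert (Finset.notMem_erase j S)]
  split_ifs <;> simp

lemma mulE_apply (i : ι) (f : ExtV F ι) (S : Finset ι) : mulE F i f S =
    if i ∈ S then (-1 : F) ^ (S.filter (· < i)).card * f (S.erase i) else 0 := rfl

lemma contrE_apply (i : ι) (f : ExtV F ι) (S : Finset ι) : contrE F i f S =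
    if i ∈ S then 0 else (-1 : F) ^ (S.filter (· < i)).card * f (insert i S) := rfl

lemma neg_one_pow_mul_self (n : ℕ) (x : F) : (-1) ^ n * ((-1) ^ n * x) = x := by
  rw [← mul_assoc, ← mul_pow, neg_one_mul, neg_neg, one_pow, one_mul]

lemma mulE_anticomm (i j : ι) :
    (mulE F i * mulE F j + mulE F j * mulE F i : Module.End F (ExtV F ι)) = 0 := by
  refine LinearMap.ext fun f => funext fun S => ?_
  simp only [LinearMap.add_apply, Module.End.mul_apply, Pi.add_apply, mulE_apply,
    LinearMap.zero_apply, Pi.zero_apply]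
  rcases lt_trichotomy i j with h | rfl | h
  · by_cases hi : i ∈ S <;> by_cases hj : j ∈ S <;>
      simp [hi, hj, h.ne, h.ne', neg_one_pow_card_erase, h, h.not_gt, Finset.erase_right_comm]
    ring
  · simp
  · by_cases hi : i ∈ S <;> by_cases hj : j ∈ S <;>
      simp [hi, hj, h.ne, h.ne', neg_one_pow_card_erase, h, h.not_gt, Finset.erase_right_comm]
    ring

lemma contrE_anticomm (i j : ι) :
    (contrE F i * contrE F j + contrE F j * contrE F i : Module.End F (ExtV F ι)) = 0 := by
  refine LinearMap.ext fun f => funext fun S => ?_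
  simp only [LinearMap.add_apply, Module.End.mul_apply, Pi.add_apply, contrE_apply,
    LinearMap.zero_apply, Pi.zero_apply]
  rcases lt_trichotomy i j with h | rfl | h
  · by_cases hi : i ∈ S <;> by_cases hj : j ∈ S <;>
      simp [hi, hj, h.ne, h.ne', neg_one_pow_card_insert, h, h.not_gt, Finset.insert_comm j i]
    ring
  · simp
  · by_cases hi : i ∈ S <;> by_cases hj : j ∈ S <;>
      simp [hi, hj, h.ne, h.ne', neg_one_pow_card_insert, h, h.not_gt, Finset.insert_comm j i]
    ring

lemma mulE_contrE_anticomm (i j : ι) :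
    (mulE F i * contrE F j + contrE F j * mulE F i : Module.End F (ExtV F ι)) =
      if i = j then 1 else 0 := by
  refine LinearMap.ext fun f => funext fun S => ?_
  simp only [LinearMap.add_apply, Module.End.mul_apply, Pi.add_apply, contrE_apply, mulE_apply]
  rcases lt_trichotomy i j with h | rfl | h
  · by_cases hi : i ∈ S <;> by_cases hj : j ∈ S <;>
      simp [hi, hj, h.ne, h.ne', neg_one_pow_card_insert, neg_one_pow_card_erase, h, h.not_gt,
        Finset.erase_insert_of_ne h.ne']
    ring
  · by_cases hi : i ∈ S <;>
      simp [hi, neg_one_pow_card_insert, neg_one_pow_card_erase, neg_one_pow_mul_self]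
  · by_cases hi : i ∈ S <;> by_cases hj : j ∈ S <;>
      simp [hi, hj, h.ne, h.ne', neg_one_pow_card_insert, neg_one_pow_card_erase, h, h.not_gt,
        Finset.erase_insert_of_ne h.ne]
    ring

end Exterior

section Tensor

variable {K : Type} [Field K] {V : Type} [AddCommGroup V] [Module K V] {σ : Type} [Fintype σ]

/-- The tensor product of an operator with constant coefficients and a matrix, acting on
vectors with entries in `V`. -/
noncomputable def opTensor : Module.End K V →ₗ[K] Module.End K (σ → K) →ₗ[K]
    Module.End K (σ → V) :=
  LinearMap.mk₂ K
    (fun T L =>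
      { toFun := fun f s' => ∑ s, L (Pi.single s 1) s' • T (f s)
        map_add' := fun f g => by
          ext s'
          simp only [Pi.add_apply, map_add, smul_add, Finset.sum_add_distrib]
        map_smul' := fun a f => by
          ext s'
          simp only [Pi.smul_apply, map_smul, Finset.smul_sum, smul_comm a, RingHom.id_apply] })
    (fun T T' L => by
      ext1
      refine LinearMap.ext fun f => ?_
      ext s'
      simp [Finset.sum_add_distrib])
    (fun a T L => by
      refine LinearMap.ext fun f => funext fun s' => ?_
      simp [Finset.smul_sum, smul_comm a])
    (fun T L L' => by
      refine LinearMap.ext fun f => funext fun s' => ?_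
      simp [add_smul, Finset.sum_add_distrib])
    (fun a T L => by
      refine LinearMap.ext fun f => funext fun s' => ?_
      simp [Finset.smul_sum, mul_smul])

lemma opTensor_apply (T : Module.End K V) (L : Module.End K (σ → K)) (f : σ → V) (s' : σ) :
    opTensor T L f s' = ∑ s, L (Pi.single s 1) s' • T (f s) := rfl

lemma opTensor_mul (T T' : Module.End K V) (L L' : Module.End K (σ → K)) :
    opTensor (T * T') (L * L') = opTensor T L * opTensor T' L' := by
  refine LinearMap.ext fun f => funext fun s'' => ?_
  rw [Module.End.mul_apply]
  simp only [opTensor_apply, map_sum, map_smul, Finset.smul_sum, smul_smul]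
  rw [Finset.sum_comm]
  refine Finset.sum_congr rfl fun s _ => ?_
  rw [← Finset.sum_smul]
  congr 1
  have h : L' (Pi.single s 1) = ∑ s', L' (Pi.single s 1) s' • Pi.single s' (1 : K) := by
    ext t
    simp [Pi.single_apply]
  rw [Module.End.mul_apply, h]
  conv_lhs => rw [map_sum, Finset.sum_apply]
  refine Finset.sum_congr rfl fun t _ => ?_
  rw [map_smul, Pi.smul_apply, smul_eq_mul, ← h, mul_comm]

lemma opTensor_one : opTensor (1 : Module.End K V) (1 : Module.End K (σ → K)) = 1 := by
  refine LinearMap.ext fun f => funext fun s => ?_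
  simp [opTensor_apply, Pi.single_apply]

variable {I : Type} [Fintype I] {T : I → Module.End K V} {E F : I → Module.End K (σ → K)}

lemma koszul_sq_eq_zero [CharZero K] (hT : ∀ c k, T c * T k = T k * T c) (g : I → I → K)
    (hE : ∀ c k, E c * E k + E k * E c = g c k • 1) (hg : ∑ c, ∑ k, g c k • (T c * T k) = 0) :
    (∑ c, opTensor (T c) (E c)) * (∑ c, opTensor (T c) (E c)) = 0 := by
  have h1 : (∑ c, opTensor (T c) (E c)) * (∑ c, opTensor (T c) (E c)) =
      ∑ c, ∑ k, opTensor (T c * T k) (E c * E k) := by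
    rw [Finset.sum_mul_sum]
    simp only [opTensor_mul]
  have h2 : ∑ c, ∑ k, opTensor (T c * T k) (E c * E k) =
      ∑ c, ∑ k, opTensor (T c * T k) (E k * E c) := by
    rw [Finset.sum_comm]
    refine Finset.sum_congr rfl fun c _ => Finset.sum_congr rfl fun k _ => ?_
    rw [hT]
  have h3 : ∑ c, ∑ k, opTensor (T c * T k) (E c * E k) +
      ∑ c, ∑ k, opTensor (T c * T k) (E c * E k) = 0 := by
    conv_lhs => rw [h2]
    conv_lhs => enter [1]; rw [← h2]
    simp only [← Finset.sum_add_distrib, ← map_add, hE, map_smul]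
    rw [← LinearMap.zero_apply (σ₁₂ := RingHom.id K) (1 : Module.End K (σ → K)),
      ← map_zero (opTensor (K := K) (V := V) (σ := σ)), ← hg]
    simp only [map_sum, map_smul, LinearMap.sum_apply, LinearMap.smul_apply]
  rw [h1]
  have h4 : (2 : K) • ∑ c, ∑ k, opTensor (T c * T k) (E c * E k) = 0 := by rw [two_smul, h3]
  exact (smul_eq_zero.1 h4).resolve_left two_ne_zero

lemma koszul_homotopy (hEF : ∀ c k, E k * F c + F c * E k = if k = c then 1 else 0)
    (H : Module.End K V) (c : I) :
    (∑ k, opTensor (T k) (E k)) * opTensor H (F c) + opTensor H (F c) * ∑ k, opTensor (T k) (E k) =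
      opTensor (H * T c) 1 + ∑ k, opTensor (T k * H - H * T k) (E k * F c) := by
  rw [Finset.sum_mul, Finset.mul_sum]
  simp only [← opTensor_mul, map_sub, LinearMap.sub_apply, Finset.sum_sub_distrib]
  have h : ∀ k, F c * E k = (if k = c then 1 else 0) - E k * F c := fun k => by rw [← hEF]; abel
  simp only [h, map_sub, Finset.sum_sub_distrib]
  have h2 : ∑ k, opTensor (H * T k) (if k = c then (1 : Module.End K (σ → K)) else 0) =
      opTensor (H * T c) 1 := by
    rw [Finset.sum_eq_single c (fun k _ hk => by rw [if_neg hk, map_zero])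
      (fun hc => absurd (Finset.mem_univ c) hc), if_pos rfl]
  rw [h2]
  abel

lemma one_sub_koszul_homotopy (hEF : ∀ c k, E k * F c + F c * E k = if k = c then 1 else 0)
    (H : Module.End K V) (c : I) :
    1 - ((∑ k, opTensor (T k) (E k)) * opTensor H (F c) +
      opTensor H (F c) * ∑ k, opTensor (T k) (E k)) =
      opTensor (1 + (-1 : K) • (H * T c)) 1 -
        ∑ k, opTensor (T k * H + (-1 : K) • (H * T k)) (E k * F c) := by
  rw [koszul_homotopy hEF, sub_add_eq_sub_sub]
  simp only [neg_smul, one_smul, ← sub_eq_add_neg, map_sub, LinearMap.sub_apply, opTensor_one]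

end Tensor

section Homotopy

variable {K : Type} [Field K] {W : Type} [AddCommGroup W] [Module K W]

/-- The operator `P` is homotopic to the identity, through a homotopy preserving the given
family of submodules. -/
def HomotopicToId {ι : Type} (d : Module.End K W) (U : ι → Submodule K W) (P : Module.End K W) :
    Prop :=
  ∃ h : Module.End K W, (∀ i, ∀ f ∈ U i, h f ∈ U i) ∧ P = 1 - (d * h + h * d)

lemma HomotopicToId.one {ι : Type} (d : Module.End K W) (U : ι → Submodule K W) :
    HomotopicToId d U 1 := ⟨0, fun i _ _ => zero_mem _, by simp⟩

lemma HomotopicToId.mem {ι : Type} {d : Module.End K W} {U : ι → Submodule K W}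
    {P : Module.End K W} (hd : ∀ i, ∀ f ∈ U i, d f ∈ U i) (hP : HomotopicToId d U P) (i : ι)
    {f : W} (hf : f ∈ U i) : P f ∈ U i := by
  obtain ⟨h, hU, rfl⟩ := hP
  exact sub_mem hf (add_mem (hd i _ (hU i f hf)) (hU i _ (hd i f hf)))

lemma HomotopicToId.comm {ι : Type} {d : Module.End K W} {U : ι → Submodule K W}
    {P : Module.End K W} (hdd : d * d = 0) (hP : HomotopicToId d U P) : P * d = d * P := by
  obtain ⟨h, -, rfl⟩ := hP
  rw [sub_mul, mul_sub, add_mul, mul_add, one_mul, mul_one, ← mul_assoc d d, hdd, mul_assoc h d d,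
    hdd, zero_mul, mul_zero, mul_assoc, add_zero, zero_add]

lemma HomotopicToId.mul {ι : Type} {d : Module.End K W} {U : ι → Submodule K W}
    (hd : ∀ i, ∀ f ∈ U i, d f ∈ U i) (hdd : d * d = 0) {P P' : Module.End K W}
    (hP : HomotopicToId d U P) (hP' : HomotopicToId d U P') : HomotopicToId d U (P * P') := by
  have hcomm := hP.comm hdd
  have hmem := fun i f hf => hP.mem hd i (f := f) hf
  obtain ⟨h, hU, e⟩ := hP
  obtain ⟨h', hU', e'⟩ := hP'
  refine ⟨h + P * h', fun i f hf => add_mem (hU i f hf) (hmem i _ (hU' i f hf)), ?_⟩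
  have : d * (h + P * h') + (h + P * h') * d = (d * h + h * d) + P * (d * h' + h' * d) := by
    rw [mul_add, add_mul, mul_add P, ← mul_assoc d P, ← hcomm, mul_assoc P d, mul_assoc P h']
    abel
  rw [this, show d * h + h * d = 1 - P by rw [e]; abel,
    show d * h' + h' * d = 1 - P' by rw [e']; abel, mul_sub, mul_one]
  abel

end Homotopy

section Submodules

variable {K : Type} [NontriviallyNormedField K] {M : Type} {deg : M → ℕ} {σ : Type}

variable (K deg σ) in
/-- Vectors of overconvergent series all of whose monomials lie in `Z`. -/
def daggerSupported (Z : Set M) : Submodule K (σ → Dagger K deg) where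
  carrier := {f | ∀ s m, (f s).1 m ≠ 0 → m ∈ Z}
  add_mem' := by
    intro f g hf hg s m h
    by_contra hm
    have h1 : (f s).1 m = 0 := by_contra fun h' => hm (hf s m h')
    have h2 : (g s).1 m = 0 := by_contra fun h' => hm (hg s m h')
    exact h (show (f s).1 m + (g s).1 m = 0 by rw [h1, h2, add_zero])
  zero_mem' := fun s m h => absurd rfl h
  smul_mem' := by
    intro a f hf s m h
    exact hf s m fun h' => h (show a * (f s).1 m = 0 by rw [h', mul_zero])

variable (K deg σ) in
/-- Vectors of polynomials. -/
def daggerFinite : Submodule K (σ → Dagger K deg) where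
  carrier := {f | ∀ s, (f s).1.support.Finite}
  add_mem' := by
    intro f g hf hg s
    exact ((hf s).union (hg s)).subset (Function.support_add _ _)
  zero_mem' := fun s => by simp
  smul_mem' := by
    intro a f hf s
    refine (hf s).subset fun m hm h' => hm ?_
    change a * (f s).1 m = 0
    rw [h', mul_zero]

lemma daggerSupported_le_daggerFinite {Z : Set M} (hZ : Z.Finite) :
    daggerSupported K deg σ Z ≤ daggerFinite K deg σ :=
  fun _ hf s => hZ.subset fun m hm => hf s m hm

variable [IsUltrametricDist K] [CompleteSpace K] [Fintype σ]
  (hfin : ∀ N, {m | deg m ≤ N}.Finite)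

lemma opTensor_mem_daggerSupported {Z Z' : Set M} {T : TameAlg K deg}
    (hT : ∀ m ∈ Z, T.1 (Finsupp.single m 1) ∈ Finsupp.supported K K Z')
    (L : Module.End K (σ → K)) {f : σ → Dagger K deg} (hf : f ∈ daggerSupported K deg σ Z) :
    opTensor (tameHom K hfin T) L f ∈ daggerSupported K deg σ Z' := by
  have h : ∀ s m, (tameHom K hfin T (f s)).1 m ≠ 0 → m ∈ Z' := fun s m hm =>
    tameHom_apply_eq_zero hfin T hT (f s) (hf s) m hm
  intro s' m hm
  rw [opTensor_apply] at hm
  by_contra hZ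
  refine hm ?_
  have : ∀ s, (tameHom K hfin T (f s)).1 m = 0 := fun s => by_contra fun h' => hZ (h s m h')
  simp [this]

lemma opTensor_mem_daggerFinite (T : TameAlg K deg) (L : Module.End K (σ → K))
    {f : σ → Dagger K deg} (hf : f ∈ daggerFinite K deg σ) :
    opTensor (tameHom K hfin T) L f ∈ daggerFinite K deg σ := by
  have h : ∀ s, (tameHom K hfin T (f s)).1.support.Finite := fun s =>
    tameHom_apply_finite hfin T (f s) (hf s)
  intro s'
  refine (Set.finite_iUnion h).subset fun m hm => ?_
  rw [opTensor_apply] at hm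
  rw [Set.mem_iUnion]
  by_contra! hZ
  refine hm ?_
  have : ∀ s, (tameHom K hfin T (f s)).1 m = 0 := fun s => by simpa using hZ s
  simp [this]

end Submodules

namespace ShiftSystem

variable {I M : Type} [Fintype I] {p : ℕ} [hp : Fact p.Prime] (X : ShiftSystem I M p)
variable {K : Type} [NontriviallyNormedField K] [IsUltrametricDist K] [CompleteSpace K]
  [CharZero K] {π : K} (hpn : ‖(p : K)‖ = (p : ℝ)⁻¹) (hπ : π ^ (p - 1) = -(p : K))
variable {σ : Type} [Fintype σ] {E F : I → Module.End K (σ → K)}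

/-- The operator `diffOp` as a tame operator. -/
noncomputable def tameDiffOp (c : I) : TameAlg K X.deg :=
  ⟨X.diffOp π c, isTame_diffOp hpn hπ c⟩

/-- The Koszul differential of the operators `diffOp` on overconvergent series. -/
noncomputable def koszul (E : I → Module.End K (σ → K)) :
    Module.End K (σ → Dagger K X.deg) :=
  ∑ c, opTensor (tameHom K X.finite_deg (X.tameDiffOp hpn hπ c)) (E c)

variable (K σ) in
/-- The submodule of polynomials and that of series with nonnegative weights. -/
def stable (b : Bool) : Submodule K (σ → Dagger K X.deg) :=
  if b then daggerFinite K X.deg σ else daggerSupported K X.deg σ {m | 0 ≤ X.w m}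

variable {X}

lemma koszul_mem (b : Bool) {f : σ → Dagger K X.deg} (hf : f ∈ X.stable K σ b) :
    X.koszul hpn hπ E f ∈ X.stable K σ b := by
  rw [koszul, LinearMap.sum_apply]
  refine sum_mem fun c _ => ?_
  cases b
  · exact opTensor_mem_daggerSupported X.finite_deg (fun m hm => diffOp_mem c hm) _ hf
  · exact opTensor_mem_daggerFinite X.finite_deg _ _ hf

lemma koszul_mul_self {a : K} (hE : ∀ c k, E c * E k + E k * E c = (a * X.pair c k) • 1) :
    X.koszul hpn hπ E * X.koszul hpn hπ E = 0 := by
  have hcomm : ∀ c k, X.tameDiffOp hpn hπ c * X.tameDiffOp hpn hπ k =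
      X.tameDiffOp hpn hπ k * X.tameDiffOp hpn hπ c := fun c k => Subtype.ext (diffOp_comm c k)
  have hpair : ∑ c, ∑ k, (a * X.pair c k : K) •
      (X.tameDiffOp hpn hπ c * X.tameDiffOp hpn hπ k) = 0 := by
    refine Subtype.ext ?_
    have := congrArg (a • ·) (sum_pair_diffOp (X := X) (π := π))
    simp only [smul_zero, Finset.smul_sum, smul_smul] at this
    rw [AddSubmonoidClass.coe_finsetSum]
    simp only [AddSubmonoidClass.coe_finsetSum]
    exact this
  generalize hT : X.tameDiffOp hpn hπ = T at hcomm hpair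
  have hφ := congrArg (tameHom K X.finite_deg) hpair
  rw [koszul, hT]
  refine koszul_sq_eq_zero (T := fun c => tameHom K X.finite_deg (T c)) (fun c k => ?_)
    (fun c k => a * (X.pair c k : K)) hE ?_
  · exact (map_mul (tameHom K X.finite_deg) _ _).symm.trans
      ((congrArg _ (hcomm c k)).trans (map_mul _ _ _))
  · rw [map_zero] at hφ
    rw [← hφ]
    simp only [map_sum, map_smul, map_mul]

/-- A tame operator that nearly inverts one of the operators `diffOp` and nearly commutes with the
others gives an operator homotopic to the identity that shrinks supports. -/
lemma exists_homotopicToId_of_inverse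
    (hEF : ∀ c k, E k * F c + F c * E k = if k = c then 1 else 0) (c : I) (H : TameAlg K X.deg)
    (hH : ∀ m, 0 ≤ X.w m → H.1 (Finsupp.single m 1) ∈ Finsupp.supported K K {m | 0 ≤ X.w m})
    {Z Z' : Set M}
    (h1 : ∀ m ∈ Z, Finsupp.single m 1 - H.1 (X.diffOp π c (Finsupp.single m 1)) ∈
      Finsupp.supported K K Z')
    (h2 : ∀ m ∈ Z, ∀ k, X.diffOp π k (H.1 (Finsupp.single m 1)) -
      H.1 (X.diffOp π k (Finsupp.single m 1)) ∈ Finsupp.supported K K Z') :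
    ∃ P, HomotopicToId (X.koszul hpn hπ E) (X.stable K σ) P ∧
      ∀ f ∈ daggerSupported K X.deg σ Z, P f ∈ daggerSupported K X.deg σ Z' := by
  refine ⟨_, ⟨opTensor (tameHom K X.finite_deg H) (F c), fun b f hf => ?_, rfl⟩, fun f hf => ?_⟩
  · cases b
    · exact opTensor_mem_daggerSupported X.finite_deg hH _ hf
    · exact opTensor_mem_daggerFinite X.finite_deg _ _ hf
  · have e : 1 - (X.koszul hpn hπ E * opTensor (tameHom K X.finite_deg H) (F c) +
        opTensor (tameHom K X.finite_deg H) (F c) * X.koszul hpn hπ E) =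
        opTensor (tameHom K X.finite_deg (1 + (-1 : K) • (H * X.tameDiffOp hpn hπ c))) 1 -
        ∑ k, opTensor (tameHom K X.finite_deg (X.tameDiffOp hpn hπ k * H +
          (-1 : K) • (H * X.tameDiffOp hpn hπ k))) (E k * F c) := by
      rw [koszul, one_sub_koszul_homotopy hEF]
      simp only [map_add, map_smul, map_mul, map_one]
    rw [e, LinearMap.sub_apply, LinearMap.sum_apply]
    refine sub_mem ?_ (sum_mem fun k _ => ?_)
    · refine opTensor_mem_daggerSupported X.finite_deg (fun m hm => ?_) _ hf
      convert h1 m hm using 1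
      rw [sub_eq_add_neg, ← neg_one_smul K (H.1 _)]
      rfl
    · refine opTensor_mem_daggerSupported X.finite_deg (fun m hm => ?_) _ hf
      convert h2 m hm k using 1
      rw [sub_eq_add_neg, ← neg_one_smul K (H.1 _)]
      rfl

lemma exists_homotopicToId_nonneg {a : K}
    (hE : ∀ c k, E c * E k + E k * E c = (a * X.pair c k) • 1)
    (hEF : ∀ c k, E k * F c + F c * E k = if k = c then 1 else 0) (J : Finset I) :
    ∃ P, HomotopicToId (X.koszul hpn hπ E) (X.stable K σ) P ∧
      ∀ f, P f ∈ daggerSupported K X.deg σ {m | ∀ k ∈ J, 0 ≤ X.w m k} := by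
  induction J using Finset.induction_on with
  | empty => exact ⟨1, .one _ _, fun f s m _ => by simp⟩
  | insert c J _ ih =>
    obtain ⟨P, hP, hPJ⟩ := ih
    have hsub : ∀ m ∈ {m | ∀ k ∈ J, 0 ≤ X.w m k},
        {m' | 0 ≤ X.w m' c ∧ ∀ k ≠ c, X.w m' k = X.w m k} ⊆
          {m | ∀ k ∈ insert c J, 0 ≤ X.w m k} := by
      rintro m hm m' ⟨h1, h2⟩ k hk
      by_cases hkc : k = c
      · rw [hkc]; exact h1
      · rw [h2 k hkc]; exact hm k ((Finset.mem_insert.1 hk).resolve_left hkc)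
    obtain ⟨P', hP', hPZ⟩ := exists_homotopicToId_of_inverse (X := X) hpn hπ hEF c
      ⟨X.raiseOp π c, isTame_raiseOp hpn hπ c⟩
      (fun m hm => by
        rw [raiseOp_single_of_nonneg (hm c)]
        exact zero_mem _)
      (fun m hm => Finsupp.supported_mono (hsub m hm) (one_sub_raiseOp_mem c m))
      (fun m hm k => Finsupp.supported_mono (hsub m hm) (commutator_raiseOp_mem c k m))
    exact ⟨P' * P, hP'.mul (fun b f => koszul_mem hpn hπ b) (koszul_mul_self hpn hπ hE) hP,
      fun f => hPZ _ (hPJ f)⟩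

lemma exists_homotopicToId_le_one {a : K}
    (hE : ∀ c k, E c * E k + E k * E c = (a * X.pair c k) • 1)
    (hEF : ∀ c k, E k * F c + F c * E k = if k = c then 1 else 0) (J : Finset I) :
    ∃ P, HomotopicToId (X.koszul hpn hπ E) (X.stable K σ) P ∧
      ∀ f ∈ daggerSupported K X.deg σ {m | 0 ≤ X.w m},
        P f ∈ daggerSupported K X.deg σ {m | 0 ≤ X.w m ∧ ∀ k ∈ J, X.w m k ≤ 1} := by
  induction J using Finset.induction_on with
  | empty => exact ⟨1, .one _ _, fun f hf s m h => ⟨hf s m h, by simp⟩⟩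
  | insert c J _ ih =>
    obtain ⟨P, hP, hPJ⟩ := ih
    have hπ0 := pi_ne_zero hpn hπ
    have hsub : ∀ m ∈ {m | 0 ≤ X.w m ∧ ∀ k ∈ J, X.w m k ≤ 1},
        {m' | 0 ≤ X.w m' ∧ X.w m' c ≤ 1 ∧ ∀ k ≠ c, X.w m' k ≤ max (X.w m k) 1} ⊆
          {m | 0 ≤ X.w m ∧ ∀ k ∈ insert c J, X.w m k ≤ 1} := by
      rintro m hm m' ⟨h1, h2, h3⟩
      refine ⟨h1, fun k hk => ?_⟩
      by_cases hkc : k = c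
      · rw [hkc]; exact h2
      · exact (h3 k hkc).trans
          (max_le (hm.2 k ((Finset.mem_insert.1 hk).resolve_left hkc)) le_rfl)
    obtain ⟨P', hP', hPZ⟩ := exists_homotopicToId_of_inverse (X := X) hpn hπ hEF c
      ⟨X.lowerOp π c, isTame_lowerOp hpn hπ c⟩ (fun m hm => lowerOp_mem c hm)
      (fun m hm => Finsupp.supported_mono (hsub m hm) (one_sub_lowerOp_mem hπ0 c hm.1))
      (fun m hm k => Finsupp.supported_mono (hsub m hm) (commutator_lowerOp_mem hπ0 c k hm.1))
    exact ⟨P' * P, hP'.mul (fun b f => koszul_mem hpn hπ b) (koszul_mul_self hpn hπ hE) hP,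
      fun f hf => hPZ _ (hPJ f hf)⟩

/-- The Koszul complex on overconvergent series contracts onto polynomials. -/
lemma exists_homotopicToId_finite {a : K}
    (hE : ∀ c k, E c * E k + E k * E c = (a * X.pair c k) • 1)
    (hEF : ∀ c k, E k * F c + F c * E k = if k = c then 1 else 0) :
    ∃ P, HomotopicToId (X.koszul hpn hπ E) (X.stable K σ) P ∧
      ∀ f, P f ∈ X.stable K σ true := by
  obtain ⟨P, hP, hPZ⟩ := exists_homotopicToId_nonneg (X := X) hpn hπ hE hEF Finset.univ
  obtain ⟨P', hP', hPZ'⟩ := exists_homotopicToId_le_one (X := X) hpn hπ hE hEF Finset.univ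
  refine ⟨P' * P, hP'.mul (fun b f => koszul_mem hpn hπ b) (koszul_mul_self hpn hπ hE) hP,
    fun f => ?_⟩
  have hbox : {m | 0 ≤ X.w m ∧ ∀ k ∈ Finset.univ, X.w m k ≤ 1}.Finite :=
    (X.finite_deg X.bd).subset fun m hm =>
      X.deg_le_of_mem_box m fun c => ⟨hm.1 c, hm.2 c (Finset.mem_univ c)⟩
  refine daggerSupported_le_daggerFinite hbox (hPZ' _ fun s m hm => ?_)
  exact fun k => hPZ f s m hm k (Finset.mem_univ k)

end ShiftSystem

section Weights

variable {n : ℕ} {A : Matrix (Fin n) (Fin n) ℕ}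

variable (A) in
/-- The symmetric matrix with off-diagonal blocks `A` and `Aᵀ`, over the natural numbers. -/
def blockGramNat : Matrix (Fin n ⊕ Fin n) (Fin n ⊕ Fin n) ℕ := fromBlocks 0 A Aᵀ 0

variable (A) in
/-- The symmetric matrix with off-diagonal blocks `A` and `Aᵀ`. -/
def blockGram : Matrix (Fin n ⊕ Fin n) (Fin n ⊕ Fin n) ℚ := (blockGramNat A).map (↑)

variable (A) in
/-- The inverse of `blockGram A`. -/
noncomputable def gramInv : Matrix (Fin n ⊕ Fin n) (Fin n ⊕ Fin n) ℚ :=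
  fromBlocks 0 ((Aq A)ᵀ)⁻¹ (Aq A)⁻¹ 0

variable (A) in
/-- The weights of a monomial. -/
noncomputable def monWeight (m : MonIdx (Fin n)) : Fin n ⊕ Fin n → ℚ :=
  Sum.elim (gamRow A m.1) (lamRow A m.2)

/-- The exponents of a monomial, ordered as `blockGram A` applied to its weights. -/
def monExp (m : MonIdx (Fin n)) : Fin n ⊕ Fin n → ℕ := Sum.elim m.2 m.1

lemma blockGram_eq : blockGram A = fromBlocks 0 (Aq A) (Aq A)ᵀ 0 := by
  ext (c | c) (k | k) <;> simp [blockGram, blockGramNat, Aq]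

lemma blockGram_nonneg (c k : Fin n ⊕ Fin n) : 0 ≤ blockGram A c k := Nat.cast_nonneg _

lemma blockGram_mulVec_nonneg {x : Fin n ⊕ Fin n → ℚ} (hx : 0 ≤ x) (c : Fin n ⊕ Fin n) :
    0 ≤ (blockGram A *ᵥ x) c :=
  Finset.sum_nonneg fun k _ => mul_nonneg (blockGram_nonneg c k) (hx k)

lemma blockGram_symm (c k : Fin n ⊕ Fin n) : blockGram A c k = blockGram A k c := by
  rcases c with c | c <;> rcases k with k | k <;> simp [blockGram_eq]

lemma blockGram_self (c : Fin n ⊕ Fin n) : blockGram A c c = 0 := by rcases c with c | c <;> simp [blockGram_eq]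

lemma blockGram_mul_gramInv (hA : (Aq A).det ≠ 0) : blockGram A * gramInv A = 1 := by
  have h : IsUnit (Aq A).det := isUnit_iff_ne_zero.2 hA
  have h' : IsUnit (Aq A)ᵀ.det := by rwa [det_transpose]
  rw [blockGram_eq, gramInv, fromBlocks_multiply]
  simp [mul_nonsing_inv _ h, mul_nonsing_inv _ h', ← fromBlocks_one]

lemma monWeight_eq (m : MonIdx (Fin n)) :
    monWeight A m = gramInv A *ᵥ fun c => (monExp m c : ℚ) := by
  rw [gramInv, fromBlocks_mulVec]
  ext (c | c)
  · simp only [monWeight, gamRow, Sum.elim_inl, zero_mulVec, zero_add, ← transpose_nonsing_inv,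
      mulVec_transpose]
    rfl
  · simp only [monWeight, lamRow, Sum.elim_inr, zero_mulVec, add_zero, ← transpose_nonsing_inv,
      vecMul_transpose]
    rfl

lemma blockGram_mulVec_monWeight (hA : (Aq A).det ≠ 0) (m : MonIdx (Fin n)) :
    blockGram A *ᵥ monWeight A m = fun c => (monExp m c : ℚ) := by
  rw [monWeight_eq, mulVec_mulVec, blockGram_mul_gramInv hA, one_mulVec]

lemma eq_monWeight (hA : (Aq A).det ≠ 0) {x : Fin n ⊕ Fin n → ℚ} {m : MonIdx (Fin n)}
    (h : blockGram A *ᵥ x = fun c => (monExp m c : ℚ)) : monWeight A m = x := by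
  rw [monWeight_eq, ← h, mulVec_mulVec, mul_eq_one_comm.1 (blockGram_mul_gramInv hA), one_mulVec]

lemma degMon_eq (m : MonIdx (Fin n)) : degMon m = ∑ c, monExp m c := by
  rw [Fintype.sum_sum_type, add_comm]
  rfl

lemma gamRow_dotProduct_s15 (hA : (Aq A).det ≠ 0) (m : MonIdx (Fin n)) :
    (gamRow A m.1 ⬝ᵥ fun i => (m.2 i : ℚ)) =
      ∑ i, monWeight A m (Sum.inr i) * monExp m (Sum.inr i) := by
  have h := blockGram_mulVec_monWeight hA m
  rw [blockGram_eq, fromBlocks_mulVec] at h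
  have h1 : (fun i => (m.2 i : ℚ)) = Aq A *ᵥ lamRow A m.2 := by
    ext j
    have := congrFun h (Sum.inl j)
    simp only [Sum.elim_inl, zero_mulVec, zero_add] at this
    exact this.symm
  have h2 : gamRow A m.1 ᵥ* Aq A = fun i => (m.1 i : ℚ) := by
    ext j
    have := congrFun h (Sum.inr j)
    simp only [Sum.elim_inr, zero_mulVec, add_zero, mulVec_transpose] at this
    exact this
  rw [h1, dotProduct_mulVec, h2]
  exact Finset.sum_congr rfl fun i _ => mul_comm _ _

lemma monWeight_inr_nonneg (m : AMon A) (i : Fin n) : 0 ≤ monWeight A m.1 (Sum.inr i) := m.2.1 i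

lemma monWeight_mul_monExp (hA : (Aq A).det ≠ 0) (m : AMon A) (i : Fin n) :
    monWeight A m.1 (Sum.inr i) * monExp m.1 (Sum.inr i) = 0 := by
  have h := m.2.2
  rw [gamRow_dotProduct_s15 hA, Finset.sum_eq_zero_iff_of_nonneg fun i _ =>
    mul_nonneg (monWeight_inr_nonneg m i) (Nat.cast_nonneg _)] at h
  exact h i (Finset.mem_univ i)

lemma sum_mul_blockGram_mulVec (x : Fin n ⊕ Fin n → ℚ) : ∑ c, x c * (blockGram A *ᵥ x) c =
    2 * ∑ i, x (Sum.inr i) * (blockGram A *ᵥ x) (Sum.inr i) := by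
  have h : x ∘ Sum.inl ⬝ᵥ Aq A *ᵥ (x ∘ Sum.inr) = x ∘ Sum.inr ⬝ᵥ (Aq A)ᵀ *ᵥ (x ∘ Sum.inl) := by
    rw [dotProduct_mulVec, mulVec_transpose, dotProduct_comm]
  rw [Fintype.sum_sum_type, two_mul, blockGram_eq, fromBlocks_mulVec]
  simpa [dotProduct] using h

lemma isotropic_monWeight (hA : (Aq A).det ≠ 0) (m : AMon A) :
    ∑ c, monWeight A m.1 c * (blockGram A *ᵥ monWeight A m.1) c = 0 := by
  rw [sum_mul_blockGram_mulVec, blockGram_mulVec_monWeight hA]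
  simp [monWeight_mul_monExp hA]

lemma exists_monWeight_eq (hA : (Aq A).det ≠ 0) {x : Fin n ⊕ Fin n → ℚ}
    (hx : ∀ i, 0 ≤ x (Sum.inr i)) (hint : ∀ c, ∃ z : ℤ, (blockGram A *ᵥ x) c = z)
    (hpos : ∀ c, 0 ≤ (blockGram A *ᵥ x) c)
    (hmul : ∀ i, x (Sum.inr i) * (blockGram A *ᵥ x) (Sum.inr i) = 0) :
    ∃ m : AMon A, monWeight A m.1 = x := by
  choose z hz using hint
  have hz' : ∀ c, ((z c).toNat : ℚ) = (blockGram A *ᵥ x) c := fun c => by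
    have h := hpos c
    rw [hz] at h ⊢
    have h' : 0 ≤ z c := by exact_mod_cast h
    exact_mod_cast Int.toNat_of_nonneg h'
  let m : MonIdx (Fin n) := (fun i => (z (Sum.inr i)).toNat, fun j => (z (Sum.inl j)).toNat)
  have hm : ∀ c, (monExp m c : ℚ) = (blockGram A *ᵥ x) c := by
    rintro (c | c) <;> exact hz' _
  have hw : monWeight A m = x := eq_monWeight hA (funext fun c => (hm c).symm)
  refine ⟨⟨m, fun i => ?_, ?_⟩, hw⟩
  · exact (congrFun hw (Sum.inr i)).ge.trans' (hx i)
  · rw [gamRow_dotProduct_s15 hA, hw]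
    exact Finset.sum_eq_zero fun i _ => by rw [hm, hmul]

lemma exists_monWeight_eq_of_nonneg (hA : (Aq A).det ≠ 0) {x : Fin n ⊕ Fin n → ℚ}
    (hx : 0 ≤ x) (hint : ∀ c, ∃ z : ℤ, (blockGram A *ᵥ x) c = z)
    (hiso : ∑ c, x c * (blockGram A *ᵥ x) c = 0) : ∃ m : AMon A, monWeight A m.1 = x := by
  have hpos : ∀ c, 0 ≤ (blockGram A *ᵥ x) c := blockGram_mulVec_nonneg hx
  rw [Finset.sum_eq_zero_iff_of_nonneg fun c _ => mul_nonneg (hx c) (hpos c)] at hiso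
  exact exists_monWeight_eq hA (fun i => hx _) hint hpos fun i => hiso _ (Finset.mem_univ _)

lemma blockGram_mulVec_add (x : Fin n ⊕ Fin n → ℚ) (v : Fin n ⊕ Fin n → ℤ) (c : Fin n ⊕ Fin n) :
    (blockGram A *ᵥ (x + fun k => (v k : ℚ))) c =
      (blockGram A *ᵥ x) c + ((∑ k, blockGramNat A c k * v k : ℤ) : ℚ) := by
  rw [mulVec_add, Pi.add_apply]
  push_cast
  rfl

lemma exists_int_gram_mulVec_add (hA : (Aq A).det ≠ 0) (m : MonIdx (Fin n))
    (v : Fin n ⊕ Fin n → ℤ) (c : Fin n ⊕ Fin n) :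
    ∃ z : ℤ, (blockGram A *ᵥ (monWeight A m + fun k => (v k : ℚ))) c = z :=
  ⟨monExp m c + ∑ k, blockGramNat A c k * v k, by
    rw [blockGram_mulVec_add, blockGram_mulVec_monWeight hA]
    push_cast
    rfl⟩

lemma monWeight_interval (hA : (Aq A).det ≠ 0) (m : AMon A) (v v' : Fin n ⊕ Fin n → ℤ)
    (hv : 0 ≤ v) (hvv : v ≤ v')
    (h : ∃ m' : AMon A, monWeight A m'.1 = monWeight A m.1 + fun c => (v' c : ℚ)) :
    ∃ m' : AMon A, monWeight A m'.1 = monWeight A m.1 + fun c => (v c : ℚ) := by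
  obtain ⟨m', hm'⟩ := h
  have hw : ∀ i, 0 ≤ (monWeight A m.1 + fun c => (v c : ℚ)) (Sum.inr i) := fun i =>
    add_nonneg (monWeight_inr_nonneg m i) (Int.cast_nonneg (hv _))
  have hpos : ∀ c, 0 ≤ (blockGram A *ᵥ (monWeight A m.1 + fun k => (v k : ℚ))) c := fun c => by
    rw [blockGram_mulVec_add, blockGram_mulVec_monWeight hA]
    exact add_nonneg (Nat.cast_nonneg _) (Int.cast_nonneg
      (Finset.sum_nonneg fun k _ => mul_nonneg (Int.natCast_nonneg _) (hv k)))
  refine exists_monWeight_eq hA hw (exists_int_gram_mulVec_add hA m.1 v) hpos fun i => ?_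
  refine le_antisymm ?_ (mul_nonneg (hw i) (hpos _))
  rw [← monWeight_mul_monExp hA m' i]
  have h1 : (monExp m'.1 (Sum.inr i) : ℚ) = (blockGram A *ᵥ monWeight A m'.1) (Sum.inr i) := by
    rw [blockGram_mulVec_monWeight hA]
  refine mul_le_mul ?_ ?_ (hpos _) (monWeight_inr_nonneg m' i)
  · rw [hm']
    exact add_le_add le_rfl (Int.cast_le.2 (hvv _))
  · rw [h1, hm', blockGram_mulVec_add, blockGram_mulVec_add]
    refine add_le_add le_rfl (Int.cast_le.2 (Finset.sum_le_sum fun k _ => ?_))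
    exact mul_le_mul_of_nonneg_left (hvv k) (Int.natCast_nonneg _)

lemma monWeight_lower (hA : (Aq A).det ≠ 0) (m : AMon A) (v : Fin n ⊕ Fin n → ℤ)
    (hm : 0 ≤ monWeight A m.1) (hv : v ≤ 0) (h : 0 ≤ monWeight A m.1 + fun c => (v c : ℚ)) :
    ∃ m' : AMon A, monWeight A m'.1 = monWeight A m.1 + fun c => (v c : ℚ) := by
  have hpos : ∀ c, 0 ≤ (blockGram A *ᵥ (monWeight A m.1 + fun k => (v k : ℚ))) c :=
    blockGram_mulVec_nonneg h
  refine exists_monWeight_eq_of_nonneg hA h (exists_int_gram_mulVec_add hA m.1 v)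
    (le_antisymm ?_ (Finset.sum_nonneg fun c _ => mul_nonneg (h c) (hpos c)))
  rw [← isotropic_monWeight hA m]
  refine Finset.sum_le_sum fun c _ => mul_le_mul ?_ ?_ (hpos c) (hm c)
  · exact add_le_of_nonpos_right (Int.cast_nonpos.2 (hv c))
  · rw [blockGram_mulVec_add]
    refine add_le_of_nonpos_right (Int.cast_nonpos.2 (Finset.sum_nonpos fun k _ => ?_))
    exact mul_nonpos_of_nonneg_of_nonpos (Int.natCast_nonneg _) (hv k)

lemma sum_add_single_mul_blockGram_mulVec (x : Fin n ⊕ Fin n → ℚ) (c : Fin n ⊕ Fin n) :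
    ∑ k, (x + Pi.single c 1 : _ → ℚ) k * (blockGram A *ᵥ (x + Pi.single c 1)) k =
      ∑ k, x k * (blockGram A *ᵥ x) k + 2 * (blockGram A *ᵥ x) c := by
  have h1 : blockGram A *ᵥ Pi.single c 1 = fun k => blockGram A k c := by
    ext k; simp
  have h2 : ∑ k, x k * blockGram A k c = (blockGram A *ᵥ x) c :=
    Finset.sum_congr rfl fun k _ => by rw [blockGram_symm, mul_comm]
  simp only [mulVec_add, h1, Pi.add_apply, mul_add, add_mul, Finset.sum_add_distrib, h2,
    Pi.single_apply, ite_mul, one_mul, zero_mul, Finset.sum_ite_eq', Finset.mem_univ, if_true,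
    blockGram_self]
  ring

lemma exists_monWeight_add_single (hA : (Aq A).det ≠ 0) (m : AMon A) (c : Fin n ⊕ Fin n)
    (hm : 0 ≤ monWeight A m.1) (h : (blockGram A *ᵥ monWeight A m.1) c = 0) :
    ∃ m' : AMon A, monWeight A m'.1 = monWeight A m.1 + Pi.single c 1 := by
  refine exists_monWeight_eq_of_nonneg hA (add_nonneg hm (Pi.single_nonneg.2 zero_le_one))
    (fun k => ?_) ?_
  · have := exists_int_gram_mulVec_add hA m.1 (Pi.single c 1) k
    convert this using 5
    ext i
    simp [Pi.single_apply, apply_ite]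
  · rw [sum_add_single_mul_blockGram_mulVec, isotropic_monWeight hA, h, mul_zero, add_zero]

lemma blockGram_mulVec_eq_zero (hA : (Aq A).det ≠ 0) (m : AMon A) (c : Fin n ⊕ Fin n)
    (h : ∃ m' : AMon A, monWeight A m'.1 = monWeight A m.1 + Pi.single c 1) :
    (blockGram A *ᵥ monWeight A m.1) c = 0 := by
  obtain ⟨m', hm'⟩ := h
  have h1 := sum_add_single_mul_blockGram_mulVec (A := A) (monWeight A m.1) c
  rw [← hm', isotropic_monWeight hA, isotropic_monWeight hA] at h1
  linarith

lemma monWeight_blocked (hA : (Aq A).det ≠ 0) (m : AMon A) (c : Fin n ⊕ Fin n)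
    (hm : 0 ≤ monWeight A m.1)
    (h : ¬ ∃ m' : AMon A, monWeight A m'.1 = monWeight A m.1 + Pi.single c 1) :
    monWeight A m.1 c = 0 := by
  have hiso := isotropic_monWeight hA m
  rw [Finset.sum_eq_zero_iff_of_nonneg fun c _ => mul_nonneg (hm c)
    (blockGram_mulVec_nonneg hm c)] at hiso
  exact (mul_eq_zero.1 (hiso c (Finset.mem_univ c))).resolve_right fun h' =>
    h (exists_monWeight_add_single hA m c hm h')

lemma monWeight_unblocked (hA : (Aq A).det ≠ 0) (m m₀ : AMon A) (c k : Fin n ⊕ Fin n) (l : ℕ)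
    (hm : 0 ≤ monWeight A m.1) (hmm : monWeight A m.1 = monWeight A m₀.1 + Pi.single c (l : ℚ))
    (hc : 0 < monWeight A m₀.1 c)
    (h : ∃ m' : AMon A, monWeight A m'.1 = monWeight A m₀.1 + Pi.single k 1) :
    ∃ m' : AMon A, monWeight A m'.1 = monWeight A m.1 + Pi.single k 1 := by
  have h0 : 0 ≤ monWeight A m₀.1 := fun i => by
    by_cases hi : i = c
    · rw [hi]; exact hc.le
    · have := hm i
      rwa [hmm, Pi.add_apply, Pi.single_eq_of_ne hi, add_zero] at this
  have hk := blockGram_mulVec_eq_zero hA m₀ k h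
  have hk' : blockGram A k c = 0 := by
    have hk' : ∑ i, blockGram A k i * monWeight A m₀.1 i = 0 := hk
    have := (Finset.sum_eq_zero_iff_of_nonneg fun i _ => mul_nonneg (blockGram_nonneg k i) (h0 i)).1 hk'
    exact (mul_eq_zero.1 (this c (Finset.mem_univ c))).resolve_right hc.ne'
  refine exists_monWeight_add_single hA m k hm ?_
  rw [hmm, mulVec_add, Pi.add_apply, hk, zero_add]
  simp [hk']

lemma monExp_injective : Function.Injective (monExp (n := n)) := fun _ _ h =>
  Prod.ext (funext fun i => congrFun h (Sum.inr i)) (funext fun i => congrFun h (Sum.inl i))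

variable (A) in
/-- A bound for the entries of `blockGram A` and of its inverse. -/
noncomputable def gramBound : ℕ := ⌈∑ c, ∑ k, (|gramInv A c k| + blockGram A c k)⌉₊

lemma sum_gram_le : ∑ c, ∑ k, blockGram A c k ≤ gramBound A :=
  (Finset.sum_le_sum fun _ _ => Finset.sum_le_sum fun _ _ =>
    le_add_of_nonneg_left (abs_nonneg _)).trans (Nat.le_ceil _)

lemma abs_gramInv_le (c k : Fin n ⊕ Fin n) : |gramInv A c k| ≤ gramBound A := by
  have hnn : ∀ c k, 0 ≤ |gramInv A c k| + blockGram A c k := fun c k =>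
    add_nonneg (abs_nonneg _) (blockGram_nonneg c k)
  refine le_trans ?_ (Nat.le_ceil _)
  refine (le_add_of_nonneg_right (blockGram_nonneg (A := A) c k)).trans ?_
  refine (Finset.single_le_sum (f := fun k => |gramInv A c k| + blockGram A c k)
    (fun k _ => hnn c k) (Finset.mem_univ k)).trans ?_
  exact Finset.single_le_sum (f := fun c => ∑ k, (|gramInv A c k| + blockGram A c k))
    (fun c _ => Finset.sum_nonneg fun k _ => hnn c k) (Finset.mem_univ c)

lemma abs_monWeight_le (m : MonIdx (Fin n)) (c : Fin n ⊕ Fin n) :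
    |monWeight A m c| ≤ gramBound A * degMon m := by
  rw [monWeight_eq, degMon_eq]
  push_cast
  rw [Finset.mul_sum]
  refine (Finset.abs_sum_le_sum_abs _ _).trans (Finset.sum_le_sum fun k _ => ?_)
  rw [abs_mul, Nat.abs_cast]
  exact mul_le_mul_of_nonneg_right (abs_gramInv_le c k) (Nat.cast_nonneg _)

lemma degMon_le_of_monWeight_eq (hA : (Aq A).det ≠ 0) {m m' : MonIdx (Fin n)}
    {c : Fin n ⊕ Fin n} {z : ℤ} (h : monWeight A m' = monWeight A m + Pi.single c (z : ℚ)) :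
    degMon m' ≤ degMon m + gramBound A * z.natAbs := by
  have h1 : ∀ k, (monExp m' k : ℚ) = monExp m k + blockGram A k c * z := fun k => by
    have := congrFun (blockGram_mulVec_monWeight hA m') k
    rw [h, mulVec_add, blockGram_mulVec_monWeight hA, Pi.add_apply] at this
    rw [← this]
    simp
  have h2 : ∑ k, blockGram A k c ≤ gramBound A := by
    refine le_trans (Finset.sum_le_sum fun k _ => ?_) sum_gram_le
    exact Finset.single_le_sum (f := fun c => blockGram A k c) (fun c _ => blockGram_nonneg k c)
      (Finset.mem_univ c)
  have h3 : (z : ℚ) ≤ z.natAbs := by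
    rw [Nat.cast_natAbs]
    exact_mod_cast le_abs_self z
  have h4 : 0 ≤ ∑ k, blockGram A k c := Finset.sum_nonneg fun k _ => blockGram_nonneg k c
  have : (degMon m' : ℚ) ≤ degMon m + gramBound A * z.natAbs := by
    rw [degMon_eq, degMon_eq]
    push_cast
    simp only [h1, Finset.sum_add_distrib, ← Finset.sum_mul]
    refine add_le_add le_rfl ?_
    exact (mul_le_mul_of_nonneg_left h3 h4).trans
      (mul_le_mul_of_nonneg_right h2 (Nat.cast_nonneg _))
  exact_mod_cast this

lemma degMon_le_of_mem_box (hA : (Aq A).det ≠ 0) (m : MonIdx (Fin n))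
    (h : ∀ c, 0 ≤ monWeight A m c ∧ monWeight A m c ≤ 1) : degMon m ≤ gramBound A := by
  have : (degMon m : ℚ) ≤ gramBound A := by
    refine le_trans ?_ sum_gram_le
    rw [degMon_eq]
    push_cast
    refine Finset.sum_le_sum fun c _ => ?_
    rw [← congrFun (blockGram_mulVec_monWeight hA m) c]
    exact Finset.sum_le_sum fun k _ => mul_le_of_le_one_right (blockGram_nonneg c k) (h k).2
  exact_mod_cast this

lemma finite_degMon_le (N : ℕ) : {m : AMon A | degMon m.1 ≤ N}.Finite := by
  have : {m : MonIdx (Fin n) | degMon m ≤ N}.Finite := by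
    refine (Set.finite_Iic ((fun _ => N, fun _ => N) : MonIdx (Fin n))).subset fun m hm => ?_
    refine ⟨fun i => ?_, fun i => ?_⟩
    · exact (Finset.single_le_sum (f := m.1) (fun _ _ => Nat.zero_le _) (Finset.mem_univ i)).trans
        ((Nat.le_add_right _ _).trans hm)
    · exact (Finset.single_le_sum (f := m.2) (fun _ _ => Nat.zero_le _) (Finset.mem_univ i)).trans
        ((Nat.le_add_left _ _).trans hm)
  exact this.preimage Subtype.val_injective.injOn

lemma det_Aq : (Aq A).det = ((A.map ((↑) : ℕ → ℤ)).det : ℚ) := by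
  rw [Int.cast_det]
  congr 1

lemma exists_int_det_mul_inv (i j : Fin n) : ∃ z : ℤ, (Aq A).det * (Aq A)⁻¹ i j = z := by
  by_cases h : (Aq A).det = 0
  · exact ⟨0, by simp [h]⟩
  refine ⟨(A.map ((↑) : ℕ → ℤ)).adjugate i j, ?_⟩
  rw [inv_def, Matrix.smul_apply, Ring.inverse_eq_inv', smul_eq_mul, mul_inv_cancel_left₀ h]
  have := congrFun (congrFun (RingHom.map_adjugate (Int.castRingHom ℚ) (A.map ((↑) : ℕ → ℤ))) i) j
  exact this.symm

lemma exists_int_det_mul_gramInv (c k : Fin n ⊕ Fin n) :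
    ∃ z : ℤ, (Aq A).det * gramInv A c k = z := by
  rcases c with c | c <;> rcases k with k | k
  · exact ⟨0, by simp [gramInv]⟩
  · rw [gramInv, ← transpose_nonsing_inv]
    exact exists_int_det_mul_inv k c
  · exact exists_int_det_mul_inv c k
  · exact ⟨0, by simp [gramInv]⟩

lemma exists_int_det_mul_monWeight (m : MonIdx (Fin n)) (c : Fin n ⊕ Fin n) :
    ∃ z : ℤ, (Aq A).det * monWeight A m c = z := by
  choose z hz using exists_int_det_mul_gramInv (A := A) c
  refine ⟨∑ k, z k * monExp m k, ?_⟩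
  rw [monWeight_eq, mulVec, dotProduct, Finset.mul_sum]
  push_cast
  exact Finset.sum_congr rfl fun k _ => by rw [← mul_assoc, hz]

variable (A) in
/-- The shift system of the allowed monomials. -/
noncomputable def monShiftSystem (p : ℕ) [hp : Fact p.Prime]
    (hdet : 0 < (A.map ((↑) : ℕ → ℤ)).det ∧ (A.map ((↑) : ℕ → ℤ)).det < (p : ℤ)) :
    ShiftSystem (Fin n ⊕ Fin n) (AMon A) p :=
  have hA : (Aq A).det ≠ 0 := by
    rw [det_Aq]
    exact_mod_cast hdet.1.ne'
  { w := fun m => monWeight A m.1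
    deg := fun m => degMon m.1
    pair := blockGram A
    bd := gramBound A
    den := (A.map ((↑) : ℕ → ℤ)).det.toNat
    injective_w := fun m m' h => by
      have h1 := blockGram_mulVec_monWeight hA m.1
      rw [show monWeight A m.1 = monWeight A m'.1 from h, blockGram_mulVec_monWeight hA] at h1
      refine Subtype.ext (monExp_injective (funext fun c => ?_))
      exact_mod_cast (congrFun h1 c).symm
    finite_deg := finite_degMon_le
    interval := monWeight_interval hA
    lower := monWeight_lower hA
    eq_zero_of_blocked := fun m c hm h => monWeight_blocked hA m c hm (by convert h)
    unblocked := fun m m₀ c k l hm hmm hc _ h => by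
      have := monWeight_unblocked hA m m₀ c k l hm (by convert hmm) hc (by convert h)
      convert this
    pair_symm := blockGram_symm
    pair_self := blockGram_self
    isotropic := isotropic_monWeight hA
    abs_w_le := fun m c => abs_monWeight_le m.1 c
    deg_le := fun m m' c z h => degMon_le_of_monWeight_eq hA (c := c) (by convert h)
    deg_le_of_mem_box := fun m h => degMon_le_of_mem_box hA m.1 h
    coprime_den := by
      refine Nat.coprime_of_lt_prime ?_ ?_ hp.out
      · omega
      · omega
    den_mul := fun m c => by
      obtain ⟨z, hz⟩ := exists_int_det_mul_monWeight (A := A) m.1 c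
      refine ⟨z, ?_⟩
      rw [← hz, det_Aq]
      congr 1
      exact_mod_cast Int.toNat_of_nonneg hdet.1.le }

end Weights

namespace ShiftSystem

variable {I M : Type} [Fintype I] {p : ℕ} [hp : Fact p.Prime] (X : ShiftSystem I M p)

/-- The weights of `m'` are those of `m` shifted by one in the direction `c`. -/
def IsSucc (c : I) (m m' : M) : Prop := X.w m' = X.w m + Pi.single c 1

variable {X} {K : Type} [NontriviallyNormedField K] [IsUltrametricDist K] [CompleteSpace K]
  [CharZero K] {π : K} (hpn : ‖(p : K)‖ = (p : ℝ)⁻¹) (hπ : π ^ (p - 1) = -(p : K))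

omit hp [IsUltrametricDist K] [CompleteSpace K] [CharZero K] in
lemma shift_single_one_apply (c : I) (m m' : M) :
    X.shift K (Pi.single c 1) m m' = if X.IsSucc c m m' then 1 else 0 := by
  have e : ∀ m', X.IsSucc c m m' ↔ X.w m' = X.w m + fun k => ((Pi.single c 1 : I → ℤ) k : ℚ) := by
    intro m'
    rw [cast_single, Int.cast_one, IsSucc]
  by_cases h : ∃ m'', X.IsSucc c m m''
  · obtain ⟨m'', hm''⟩ := h
    rw [shift_eq ((e m'').1 hm''), Finsupp.single_apply]
    have : m'' = m' ↔ X.IsSucc c m m' :=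
      ⟨fun h => h ▸ hm'', fun h => X.injective_w (Eq.trans hm'' (Eq.symm h))⟩
    simp only [this]
  · rw [shift_eq_zero fun ⟨m'', hm''⟩ => h ⟨m'', (e m'').2 hm''⟩, if_neg fun h' => h ⟨m', h'⟩,
      Finsupp.zero_apply]

lemma tameHom_tameDiffOp_apply {c : I} {m' : M} {o : Option M}
    (ho : ∀ m, o = some m ↔ X.IsSucc c m m') (f : Dagger K X.deg) :
    (tameHom K X.finite_deg (X.tameDiffOp hpn hπ c) f).1 m' =
      X.w m' c * f.1 m' + π * (o.map f.1).getD 0 := by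
  have hterm : ∀ m, (X.tameDiffOp hpn hπ c).1 (Finsupp.single m 1) m' * f.1 m =
      (if m = m' then X.w m' c * f.1 m' else 0) + if o = some m then π * f.1 m else 0 := by
    intro m
    change X.diffOp π c (Finsupp.single m 1) m' * f.1 m = _
    rw [diffOp_single, Finsupp.add_apply, Finsupp.smul_apply, Finsupp.smul_apply,
      shift_single_one_apply, Finsupp.single_apply, add_mul]
    simp only [ho]
    congr 1
    · split_ifs with h
      · rw [h, smul_eq_mul, mul_one]
      · rw [smul_zero, zero_mul]
    · split_ifs
      · rw [smul_eq_mul, mul_one]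
      · rw [smul_zero, zero_mul]
  rw [tameHom_apply]
  simp only [hterm]
  have h1 : Summable fun m => if m = m' then X.w m' c * f.1 m' else 0 :=
    (hasSum_ite_eq m' _).summable
  cases o with
  | none => simp
  | some m₀ =>
    have e : (fun m => if some m₀ = some m then π * f.1 m else 0) =
        fun m => if m = m₀ then π * f.1 m₀ else 0 := by
      funext m
      by_cases h : m = m₀
      · simp [h]
      · rw [if_neg h, if_neg fun h' => h (Option.some.inj h').symm]
    have h2 : Summable fun m => if m = m₀ then π * f.1 m₀ else 0 :=
      (hasSum_ite_eq m₀ _).summable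
    have h3 := h1.tsum_add h2
    simp only [funext_iff] at e
    simp only [e]
    rw [h3, tsum_ite_eq, tsum_ite_eq]
    rfl

end ShiftSystem

section Anticommutator

variable {K : Type} [Field K] {V : Type} [AddCommGroup V] [Module K V] {ι : Type} [Fintype ι]

lemma anticomm_sum_smul_left (a : ι → K) (x : ι → Module.End K V) (y : Module.End K V) :
    (∑ i, a i • x i) * y + y * ∑ i, a i • x i = ∑ i, a i • (x i * y + y * x i) := by
  simp only [Finset.sum_mul, Finset.mul_sum, smul_mul_assoc, mul_smul_comm, smul_add,
    Finset.sum_add_distrib]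

lemma anticomm_smul_right (a : K) (x y : Module.End K V) :
    x * (a • y) + (a • y) * x = a • (x * y + y * x) := by
  rw [smul_mul_assoc, mul_smul_comm, smul_add]

end Anticommutator

section Coefficients

variable {n : ℕ} (A : Matrix (Fin n) (Fin n) ℕ) {K : Type} [Field K] (π : K)

/-- The exterior operators occurring in the total differential. -/
noncomputable def extOp : Fin n ⊕ Fin n → Module.End K (ExtV K (Fin n)) :=
  Sum.elim (fun j => ∑ i, (A j i : K) • mulE K i) fun i => π⁻¹ • contrE K i

/-- The exterior operators dual to `extOp`. -/
noncomputable def extOpDual : Fin n ⊕ Fin n → Module.End K (ExtV K (Fin n)) :=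
  Sum.elim (fun j => ∑ i, (A.map ((↑) : ℕ → K))⁻¹ i j • contrE K i) fun i => π • mulE K i

lemma extOp_inl_inr [CharZero K] (j i : Fin n) :
    extOp A π (Sum.inl j) * extOp A π (Sum.inr i) + extOp A π (Sum.inr i) * extOp A π (Sum.inl j) =
      (π⁻¹ * A j i) • 1 := by
  rw [extOp, Sum.elim_inl, Sum.elim_inr, anticomm_smul_right, anticomm_sum_smul_left, mul_smul]
  simp [mulE_contrE_anticomm]

lemma extOp_anticomm [CharZero K] (c k : Fin n ⊕ Fin n) :
    extOp A π c * extOp A π k + extOp A π k * extOp A π c = (π⁻¹ * (blockGram A c k : K)) • 1 := by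
  rcases c with c | c <;> rcases k with k | k
  · have h : ∀ i, mulE K i * (∑ j, (A k j : K) • mulE K j) +
        (∑ j, (A k j : K) • mulE K j) * mulE K i = 0 := fun i => by
      rw [add_comm, anticomm_sum_smul_left]
      simp [mulE_anticomm]
    simp only [extOp, Sum.elim_inl, anticomm_sum_smul_left, h]
    simp [blockGram_eq]
  · rw [extOp_inl_inr]
    simp [blockGram_eq, Aq]
  · rw [add_comm, extOp_inl_inr]
    simp [blockGram_eq, Aq]
  · simp only [extOp, Sum.elim_inr, anticomm_smul_right]
    rw [add_comm, anticomm_smul_right, contrE_anticomm]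
    simp [blockGram_eq]

variable {A π}

lemma extOp_extOpDual_anticomm (hA : (A.map ((↑) : ℕ → K)).det ≠ 0) (hπ : π ≠ 0)
    (c k : Fin n ⊕ Fin n) :
    extOp A π k * extOpDual A π c + extOpDual A π c * extOp A π k = if k = c then 1 else 0 := by
  rcases c with c | c <;> rcases k with k | k
  · simp only [extOp, extOpDual, Sum.elim_inl, anticomm_sum_smul_left]
    simp only [add_comm (mulE K _ * _), anticomm_sum_smul_left]
    simp only [add_comm (contrE K _ * _), mulE_contrE_anticomm, smul_ite, smul_zero,
      Finset.sum_ite_eq, Finset.mem_univ, if_true, smul_smul, ← Finset.sum_smul, Sum.inl.injEq]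
    have h := congrFun (congrFun (mul_nonsing_inv _ (isUnit_iff_ne_zero.2 hA)) k) c
    rw [mul_apply, one_apply] at h
    simp only [map_apply] at h
    rw [h, ite_smul, one_smul, zero_smul]
  · simp only [extOp, extOpDual, Sum.elim_inl, Sum.elim_inr]
    rw [add_comm, anticomm_smul_right]
    simp only [anticomm_sum_smul_left, contrE_anticomm]
    simp
  · simp only [extOp, extOpDual, Sum.elim_inl, Sum.elim_inr]
    rw [anticomm_smul_right, anticomm_sum_smul_left]
    simp [mulE_anticomm]
  · simp only [extOp, extOpDual, Sum.elim_inr, anticomm_smul_right]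
    rw [add_comm, anticomm_smul_right, mulE_contrE_anticomm, smul_smul, mul_inv_cancel₀ hπ,
      one_smul]
    simp [eq_comm]

end Coefficients

section Identification

variable {n p : ℕ} [hp : Fact p.Prime] {A : Matrix (Fin n) (Fin n) ℕ}
  (hdet : 0 < (A.map ((↑) : ℕ → ℤ)).det ∧ (A.map ((↑) : ℕ → ℤ)).det < (p : ℤ))

omit hp in
include hdet in
lemma det_Aq_ne_zero : (Aq A).det ≠ 0 := by
  rw [det_Aq]
  exact_mod_cast hdet.1.ne'

lemma isSucc_iff (c : Fin n ⊕ Fin n) (m m' : AMon A) :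
    (monShiftSystem A p hdet).IsSucc c m m' ↔
      ∀ k, monExp m'.1 k = monExp m.1 k + blockGramNat A k c := by
  have hA := det_Aq_ne_zero hdet
  have h : blockGram A *ᵥ (monWeight A m.1 + Pi.single c 1) =
      fun k => ((monExp m.1 k + blockGramNat A k c : ℕ) : ℚ) := by
    rw [mulVec_add, blockGram_mulVec_monWeight hA, mulVec_single_one]
    ext k
    simp [blockGram]
  have hs : (monShiftSystem A p hdet).IsSucc c m m' ↔
      monWeight A m'.1 = monWeight A m.1 + Pi.single c 1 := by
    rw [ShiftSystem.IsSucc]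
    convert Iff.rfl <;> rfl
  rw [hs]
  refine ⟨fun e k => ?_, fun e => eq_monWeight hA ?_⟩
  · rw [← e, blockGram_mulVec_monWeight hA] at h
    exact_mod_cast congrFun h k
  · rw [h]
    exact funext fun k => by rw [e k]

lemma isSucc_inl_iff (j : Fin n) (m m' : AMon A) :
    (monShiftSystem A p hdet).IsSucc (Sum.inl j) m m' ↔
      m'.1.1 = (fun k => m.1.1 k + A j k) ∧ m'.1.2 = m.1.2 := by
  rw [isSucc_iff, Sum.forall, funext_iff, funext_iff, and_comm]
  rfl

lemma isSucc_inr_iff (i : Fin n) (m m' : AMon A) :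
    (monShiftSystem A p hdet).IsSucc (Sum.inr i) m m' ↔
      m'.1.1 = m.1.1 ∧ m'.1.2 = fun k => m.1.2 k + A k i := by
  rw [isSucc_iff, Sum.forall, funext_iff, funext_iff, and_comm]
  rfl

lemma pred_inl_eq_some_iff (j : Fin n) (m m' : AMon A) :
    (if h : (∀ k, A j k ≤ m'.1.1 k) ∧ OKA A ((fun k => m'.1.1 k - A j k), m'.1.2)
      then some (⟨((fun k => m'.1.1 k - A j k), m'.1.2), h.2⟩ : AMon A) else none) = some m ↔
      (monShiftSystem A p hdet).IsSucc (Sum.inl j) m m' := by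
  rw [isSucc_inl_iff]
  constructor
  · intro e
    split_ifs at e with h
    obtain rfl := Option.some.inj e
    exact ⟨funext fun k => (Nat.sub_add_cancel (h.1 k)).symm, rfl⟩
  · obtain ⟨⟨γ, l⟩, hm⟩ := m
    obtain ⟨⟨γ', l'⟩, hm'⟩ := m'
    rintro ⟨h1, h2⟩
    dsimp only at h1 h2
    subst h1 h2
    have e : (fun k => γ k + A j k - A j k) = γ := funext fun k => Nat.add_sub_cancel _ _
    simp only [e, Nat.le_add_left, implies_true, true_and]
    rw [dif_pos hm]

lemma pred_inr_eq_some_iff (i : Fin n) (m m' : AMon A) :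
    (if h : (∀ j, A j i ≤ m'.1.2 j) ∧ OKA A (m'.1.1, fun j => m'.1.2 j - A j i)
      then some (⟨(m'.1.1, fun j => m'.1.2 j - A j i), h.2⟩ : AMon A) else none) = some m ↔
      (monShiftSystem A p hdet).IsSucc (Sum.inr i) m m' := by
  rw [isSucc_inr_iff]
  constructor
  · intro e
    split_ifs at e with h
    obtain rfl := Option.some.inj e
    exact ⟨rfl, funext fun k => (Nat.sub_add_cancel (h.1 k)).symm⟩
  · obtain ⟨⟨γ, l⟩, hm⟩ := m
    obtain ⟨⟨γ', l'⟩, hm'⟩ := m'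
    rintro ⟨h1, h2⟩
    dsimp only at h1 h2
    subst h1 h2
    have e : (fun k => l k + A k i - A k i) = l := funext fun k => Nat.add_sub_cancel _ _
    simp only [e, Nat.le_add_left, implies_true, true_and]
    rw [dif_pos hm]

variable {K : Type} [NontriviallyNormedField K] [IsUltrametricDist K] [CompleteSpace K]
  [CharZero K] {π : K} (hpn : ‖(p : K)‖ = (p : ℝ)⁻¹) (hπ : π ^ (p - 1) = -(p : K))

lemma dxF_apply (i : Fin n) (f : Dagger K (monShiftSystem A p hdet).deg) (m : AMon A) :
    dxF K π A i f.1 m = ∑ j, (A j i : K) * (tameHom K (monShiftSystem A p hdet).finite_deg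
      ((monShiftSystem A p hdet).tameDiffOp hpn hπ (Sum.inl j)) f).1 m := by
  have hγ : (m.1.1 i : ℚ) = ∑ j, (A j i : ℚ) * monWeight A m.1 (Sum.inl j) := by
    have h := congrFun (blockGram_mulVec_monWeight (det_Aq_ne_zero hdet) m.1) (Sum.inr i)
    rw [mulVec, dotProduct, Fintype.sum_sum_type] at h
    simp only [blockGram_eq, fromBlocks_apply₂₁, fromBlocks_apply₂₂, transpose_apply,
      Matrix.zero_apply, zero_mul, Finset.sum_const_zero, add_zero] at h
    exact h.symm
  have hγK : (m.1.1 i : K) = ∑ j, (A j i : K) * (monWeight A m.1 (Sum.inl j) : K) := by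
    have := congrArg ((↑) : ℚ → K) hγ
    push_cast at this
    exact this
  have e : dxF K π A i f.1 m = (m.1.1 i : K) * f.1 m + phiF K π A i f.1 m := rfl
  rw [e, hγK, phiF, LinearMap.smul_apply, Pi.smul_apply, LinearMap.sum_apply, Finset.sum_apply,
    Finset.sum_mul, smul_eq_mul, Finset.mul_sum, ← Finset.sum_add_distrib]
  refine Finset.sum_congr rfl fun j _ => ?_
  rw [ShiftSystem.tameHom_tameDiffOp_apply hpn hπ fun m₀ => pred_inl_eq_some_iff hdet j m₀ m,
    LinearMap.smul_apply, Pi.smul_apply, smul_eq_mul, mul_add, mul_assoc, mul_left_comm π]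
  rfl

lemma dyF_apply (i : Fin n) (f : Dagger K (monShiftSystem A p hdet).deg) (m : AMon A) :
    dyF K π A i f.1 m = π⁻¹ * (tameHom K (monShiftSystem A p hdet).finite_deg
      ((monShiftSystem A p hdet).tameDiffOp hpn hπ (Sum.inr i)) f).1 m := by
  rw [ShiftSystem.tameHom_tameDiffOp_apply hpn hπ fun m₀ => pred_inr_eq_some_iff hdet i m₀ m,
    mul_add, inv_mul_cancel_left₀ (pi_ne_zero hpn hπ), ← mul_assoc]
  rfl

variable (K) in
/-- The series in monomials and exterior basis vectors given by a vector of series. -/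
noncomputable def toBFull : (Finset (Fin n) → Dagger K (monShiftSystem A p hdet).deg) →ₗ[K] BFull K A where
  toFun f q := (f q.2).1 q.1
  map_add' _ _ := rfl
  map_smul' _ _ := rfl

omit [IsUltrametricDist K] [CompleteSpace K] [CharZero K] in
lemma toBFull_injective : Function.Injective (toBFull hdet K) := fun _ _ h =>
  funext fun S => Subtype.ext (funext fun m => congrFun h (m, S))

lemma dFull_toBFull (f : Finset (Fin n) → Dagger K (monShiftSystem A p hdet).deg) :
    dFull K π A (toBFull hdet K f) =
      toBFull hdet K ((monShiftSystem A p hdet).koszul hpn hπ (extOp A π) f) := by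
  funext ⟨m, S'⟩
  have hR : toBFull hdet K ((monShiftSystem A p hdet).koszul hpn hπ (extOp A π) f) (m, S') =
      ∑ c, ∑ S, extOp A π c (Pi.single S 1) S' *
        (tameHom K (monShiftSystem A p hdet).finite_deg
          ((monShiftSystem A p hdet).tameDiffOp hpn hπ c) (f S)).1 m := by
    change ((monShiftSystem A p hdet).koszul hpn hπ (extOp A π) f S').1 m = _
    rw [ShiftSystem.koszul, LinearMap.sum_apply, Finset.sum_apply, AddSubmonoidClass.coe_finsetSum,
      Finset.sum_apply]
    refine Finset.sum_congr rfl fun c _ => ?_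
    rw [opTensor_apply, AddSubmonoidClass.coe_finsetSum, Finset.sum_apply]
    refine Finset.sum_congr rfl fun S _ => ?_
    rw [Submodule.coe_smul, Pi.smul_apply, smul_eq_mul]
    congr!
  have hL : dFull K π A (toBFull hdet K f) (m, S') =
      (∑ i, ∑ S, mulE K i (Pi.single S 1) S' * dxF K π A i (f S).1 m) +
        ∑ i, ∑ S, contrE K i (Pi.single S 1) S' * dyF K π A i (f S).1 m := by
    rw [dFull, LinearMap.add_apply, Pi.add_apply, LinearMap.sum_apply, LinearMap.sum_apply,
      Finset.sum_apply, Finset.sum_apply]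
    rfl
  rw [hL, hR, Fintype.sum_sum_type]
  congr 1
  · simp only [dxF_apply hdet hpn hπ, extOp, Sum.elim_inl, LinearMap.sum_apply, Finset.sum_apply,
      LinearMap.smul_apply, Pi.smul_apply, smul_eq_mul, Finset.mul_sum, Finset.sum_mul]
    rw [Finset.sum_comm, Finset.sum_comm (s := Finset.univ (α := Fin n))]
    refine Finset.sum_congr rfl fun S _ => ?_
    rw [Finset.sum_comm]
    refine Finset.sum_congr rfl fun j _ => Finset.sum_congr rfl fun i _ => ?_
    rw [← mul_assoc, mul_comm (A j i : K)]
  · simp only [dyF_apply hdet hpn hπ, extOp, Sum.elim_inr, LinearMap.smul_apply, Pi.smul_apply,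
      smul_eq_mul]
    refine Finset.sum_congr rfl fun i _ => Finset.sum_congr rfl fun S _ => ?_
    rw [← mul_assoc, mul_comm π⁻¹]

end Identification

section Transfer

variable {K : Type} [Field K] {W B : Type} [AddCommGroup W] [Module K W] [AddCommGroup B]
  [Module K B]

/-- An operator homotopic to the identity with values in a subcomplex `U i` shows that the inclusion
of the part of `V` lying in `U i` is a quasi-isomorphism. -/
lemma HomotopicToId.quasiIso {ι : Type} {d : Module.End K W} {U : ι → Submodule K W}
    {P : Module.End K W} (hP : HomotopicToId d U P) (hdd : d * d = 0)
    (hd : ∀ i, ∀ f ∈ U i, d f ∈ U i) (i : ι) (hPi : ∀ f, P f ∈ U i) (J : Set ι)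
    {t : W →ₗ[K] B} (ht : Function.Injective t) {D : Module.End K B} (hD : ∀ f, D (t f) = t (d f))
    {QF Q : B → Prop} (hQF : ∀ b, QF b ↔ ∃ f, (f ∈ U i ∧ ∀ j ∈ J, f ∈ U j) ∧ t f = b)
    (hQ : ∀ b, Q b ↔ ∃ f, (∀ j ∈ J, f ∈ U j) ∧ t f = b) :
    (∀ c, QF c → QF (D c)) ∧ (∀ c, Q c → Q (D c)) ∧
    (∀ b, Q b → D b = 0 → ∃ c, QF c ∧ D c = 0 ∧ ∃ b', Q b' ∧ b = c + D b') ∧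
    (∀ c, QF c → D c = 0 → (∃ b', Q b' ∧ c = D b') → ∃ c', QF c' ∧ c = D c') := by
  have hmem := fun i f hf => hP.mem hd i (f := f) hf
  have hcomm : ∀ f, P (d f) = d (P f) := LinearMap.congr_fun (hP.comm hdd)
  obtain ⟨h, hU, e⟩ := hP
  have he : ∀ f, f = P f + (d (h f) + h (d f)) := fun f => by
    rw [e]
    simp
  simp only [hQF, hQ]
  refine ⟨?_, ?_, ?_, ?_⟩
  · rintro _ ⟨f, ⟨hf, hfJ⟩, rfl⟩
    exact ⟨d f, ⟨hd i f hf, fun j hj => hd j f (hfJ j hj)⟩, (hD f).symm⟩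
  · rintro _ ⟨f, hfJ, rfl⟩
    exact ⟨d f, fun j hj => hd j f (hfJ j hj), (hD f).symm⟩
  · rintro _ ⟨f, hfJ, rfl⟩ h0
    rw [hD, map_eq_zero_iff t ht] at h0
    refine ⟨t (P f), ⟨P f, ⟨hPi f, fun j hj => hmem j f (hfJ j hj)⟩, rfl⟩, ?_, t (h f),
      ⟨h f, fun j hj => hU j f (hfJ j hj), rfl⟩, ?_⟩
    · rw [hD, ← hcomm, h0, map_zero, map_zero]
    · rw [hD, ← map_add]
      congr 1
      have := he f
      rwa [h0, map_zero, add_zero] at this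
  · rintro _ ⟨f, ⟨hf, hfJ⟩, rfl⟩ h0 ⟨_, ⟨g, hgJ, rfl⟩, hfg⟩
    rw [hD, map_eq_zero_iff t ht] at h0
    rw [hD] at hfg
    have hfg := ht hfg
    refine ⟨t (P g + h f), ⟨P g + h f, ⟨add_mem (hPi g) (hU i f hf), fun j hj =>
      add_mem (hmem j g (hgJ j hj)) (hU j f (hfJ j hj))⟩, rfl⟩, ?_⟩
    rw [hD, map_add, ← hcomm, ← hfg]
    congr 1
    have := he f
    rwa [h0, map_zero, add_zero] at this

end Transfer

section Overconvergence

variable {K : Type} [NontriviallyNormedField K] {n p : ℕ} [hp : Fact p.Prime]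
  {A : Matrix (Fin n) (Fin n) ℕ}

omit hp in
lemma rpow_neg_mul_natCast (M : ℝ) (d : ℕ) :
    (p : ℝ) ^ (-(M * (d : ℝ))) = ((p : ℝ) ^ (-M)) ^ d := by
  rw [← neg_mul, Real.rpow_mul_natCast (Nat.cast_nonneg p)]

lemma eventually_finite_of_mem_dagger {c : AMon A → K}
    (hc : c ∈ Dagger K fun m : AMon A => degMon m.1) :
    ∀ᶠ M : ℝ in nhdsWithin 0 (Set.Ioi 0),
      {m : AMon A | ¬ ‖c m‖ ≤ (p : ℝ) ^ (-(M * (degMon m.1 : ℝ)))}.Finite := by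
  obtain ⟨r, B, hr, hr1, -, h⟩ := hc
  have hp0 : (0 : ℝ) < p := Nat.cast_pos.2 hp.out.pos
  have hcont : Filter.Tendsto (fun M : ℝ => (p : ℝ) ^ (-M)) (nhdsWithin 0 (Set.Ioi 0))
      (nhds 1) := by
    have : Continuous fun M : ℝ => (p : ℝ) ^ (-M) :=
      (Real.continuous_const_rpow hp0.ne').comp continuous_neg
    exact (this.tendsto' 0 1 (by simp)).mono_left nhdsWithin_le_nhds
  filter_upwards [hcont.eventually (lt_mem_nhds hr1)] with M hM
  have hs := hr.trans hM
  have hlim : Filter.Tendsto (fun d : ℕ => B * (r / (p : ℝ) ^ (-M)) ^ d) Filter.atTop (nhds 0) := by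
    simpa using (tendsto_pow_atTop_nhds_zero_of_lt_one (div_nonneg hr.le hs.le)
      ((div_lt_one hs).2 hM)).const_mul B
  obtain ⟨N, hN⟩ := Filter.eventually_atTop.1 (hlim.eventually (ge_mem_nhds one_pos))
  refine (finite_degMon_le N).subset fun m hm => ?_
  by_contra hmN
  refine hm ((h m).trans ?_)
  have := hN (degMon m.1) (le_of_not_ge hmN)
  rw [div_pow, ← mul_div_assoc, div_le_one (pow_pos hs _)] at this
  rwa [rpow_neg_mul_natCast]

lemma overcB_iff {b : BFull K A} :
    OvercB p b ↔ ∀ S, (fun m => b (m, S)) ∈ Dagger K fun m : AMon A => degMon m.1 := by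
  constructor
  · rintro ⟨M, hM, hfin⟩ S
    have hr : (0 : ℝ) < (p : ℝ) ^ (-M) := Real.rpow_pos_of_pos (Nat.cast_pos.2 hp.out.pos) _
    have hterm : ∀ q : BIdx A, 0 ≤ ‖b q‖ / ((p : ℝ) ^ (-M)) ^ degMon q.1.1 := fun q => by
      positivity
    have hsum := Finset.sum_nonneg fun q (_ : q ∈ hfin.toFinset) => hterm q
    refine ⟨(p : ℝ) ^ (-M), 1 + ∑ q ∈ hfin.toFinset, ‖b q‖ / ((p : ℝ) ^ (-M)) ^ degMon q.1.1, hr,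
      Real.rpow_lt_one_of_one_lt_of_neg (Nat.one_lt_cast.2 hp.out.one_lt) (neg_lt_zero.2 hM),
      by positivity, fun m => ?_⟩
    by_cases h : ‖b (m, S)‖ ≤ (p : ℝ) ^ (-(M * (degMon m.1 : ℝ)))
    · rw [rpow_neg_mul_natCast] at h
      exact h.trans (le_mul_of_one_le_left (by positivity) (le_add_of_nonneg_right hsum))
    · rw [← div_le_iff₀ (by positivity)]
      exact (Finset.single_le_sum (fun q _ => hterm q) (hfin.mem_toFinset.2 h)).trans
        (le_add_of_nonneg_left zero_le_one)
  · intro h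
    have hall := Filter.eventually_all.2 fun S => eventually_finite_of_mem_dagger (p := p) (h S)
    obtain ⟨M, hfin, hM⟩ := (hall.and self_mem_nhdsWithin).exists
    refine ⟨M, hM, (Set.finite_iUnion fun S => (hfin S).image fun m => (m, S)).subset
      fun q hq => Set.mem_iUnion.2 ⟨q.2, q.1, hq, rfl⟩⟩

omit hp in
lemma finSuppB_iff {b : BFull K A} :
    FinSuppB b ↔ ∀ S, (Function.support fun m => b (m, S)).Finite :=
  ⟨fun h S => h.preimage (f := fun m => (m, S)) fun _ _ _ _ e => congrArg Prod.fst e,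
    fun h => (Set.finite_iUnion fun S => (h S).image fun m => (m, S)).subset
      fun q hq => Set.mem_iUnion.2 ⟨q.2, q.1, hq, rfl⟩⟩

omit hp in
lemma FinSuppB.overcB {b : BFull K A} (h : FinSuppB b) : OvercB p b := by
  refine ⟨1, one_pos, h.subset fun q hq hq0 => hq ?_⟩
  rw [hq0, norm_zero]
  positivity

variable (hdet : 0 < (A.map ((↑) : ℕ → ℤ)).det ∧ (A.map ((↑) : ℕ → ℤ)).det < (p : ℤ))

lemma overcB_iff_exists_toBFull {b : BFull K A} :
    OvercB p b ↔ ∃ f, toBFull hdet K f = b :=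
  ⟨fun h => ⟨fun S => ⟨fun m => b (m, S), overcB_iff.1 h S⟩, rfl⟩, by
    rintro ⟨f, rfl⟩
    exact overcB_iff.2 fun S => (f S).2⟩

lemma finSuppB_toBFull_iff (f : Finset (Fin n) → Dagger K (monShiftSystem A p hdet).deg) :
    FinSuppB (toBFull hdet K f) ↔ f ∈ (monShiftSystem A p hdet).stable K _ true :=
  finSuppB_iff

lemma gamOK_toBFull_iff (f : Finset (Fin n) → Dagger K (monShiftSystem A p hdet).deg) :
    (∀ q, toBFull hdet K f q ≠ 0 → gamOK A q) ↔
      f ∈ (monShiftSystem A p hdet).stable K _ false := by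
  have hw : ∀ m, 0 ≤ (monShiftSystem A p hdet).w m ↔ ∀ i, 0 ≤ gamRow A m.1.1 i := fun m =>
    ⟨fun h i => h (Sum.inl i), fun h => Sum.rec h fun i => monWeight_inr_nonneg m i⟩
  exact ⟨fun h S m hm => (hw m).2 (h (m, S) hm), fun h q hq => (hw q.1).1 (h q.2 q.1 hq)⟩

end Overconvergence

lemma det_map_natCast_ne_zero {n : ℕ} {A : Matrix (Fin n) (Fin n) ℕ} {K : Type} [Field K]
    [CharZero K] (h : 0 < (A.map ((↑) : ℕ → ℤ)).det) : (A.map ((↑) : ℕ → K)).det ≠ 0 := by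
  have : (A.map ((↑) : ℕ → K)).det = ((A.map ((↑) : ℕ → ℤ)).det : K) := by
    rw [Int.cast_det]
    congr 1
    ext i j
    simp
  rw [this]
  exact_mod_cast h.ne'

/-- Lemma 8.1(1): over a `ℂ_p`-like field `K` (a complete algebraically closed
nontrivially normed field with nonarchimedean norm, `‖p‖ = 1/p`, and `π ∈ K` with
`π^(p-1) = -p`), the inclusions `B_A(K) ↪ B^†_A(K)` and `C_A(K) ↪ C^†_A(K)` of the
polynomial complexes into their overconvergent completions are quasi-isomorphisms
(they induce isomorphisms on all cohomology groups, expressed here elementwise). -/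
theorem polynomial_to_overconvergent_quasiIso
    (p : ℕ) [hp : Fact p.Prime] (K : Type) [NontriviallyNormedField K] [CompleteSpace K]
    [CharZero K] (halg : IsAlgClosed K)
    (hna : ∀ a b : K, ‖a + b‖ ≤ max ‖a‖ ‖b‖) (hpnorm : ‖(p : K)‖ = (p : ℝ)⁻¹)
    (π : K) (hπ : π ^ (p - 1) = -(p : K))
    (n : ℕ) (A : Matrix (Fin n) (Fin n) ℕ)
    (hdet : 0 < (A.map ((↑) : ℕ → ℤ)).det ∧ (A.map ((↑) : ℕ → ℤ)).det < (p : ℤ))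
    (hABH : IsBH (AlgebraicClosure (ZMod p)) A) :
    (∀ c : BFull K A, FinSuppB c → FinSuppB (dFull K π A c)) ∧
    (∀ c : BFull K A, OvercB p c → OvercB p (dFull K π A c)) ∧
    (∀ b : BFull K A, OvercB p b → dFull K π A b = 0 →
      ∃ c : BFull K A, FinSuppB c ∧ dFull K π A c = 0 ∧
        ∃ b' : BFull K A, OvercB p b' ∧ b = c + dFull K π A b') ∧
    (∀ c : BFull K A, FinSuppB c → dFull K π A c = 0 →
      (∃ b' : BFull K A, OvercB p b' ∧ c = dFull K π A b') →
      ∃ c' : BFull K A, FinSuppB c' ∧ c = dFull K π A c') ∧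
    (∀ c : BFull K A, CFin c → CFin (dFull K π A c)) ∧
    (∀ c : BFull K A, COver p c → COver p (dFull K π A c)) ∧
    (∀ b : BFull K A, COver p b → dFull K π A b = 0 →
      ∃ c : BFull K A, CFin c ∧ dFull K π A c = 0 ∧
        ∃ b' : BFull K A, COver p b' ∧ b = c + dFull K π A b') ∧
    (∀ c : BFull K A, CFin c → dFull K π A c = 0 →
      (∃ b' : BFull K A, COver p b' ∧ c = dFull K π A b') →
      ∃ c' : BFull K A, CFin c' ∧ c = dFull K π A c') := by
  have : IsUltrametricDist K :=
    IsUltrametricDist.isUltrametricDist_of_forall_norm_add_le_max_norm hna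
  have hE : ∀ c k, extOp A π c * extOp A π k + extOp A π k * extOp A π c =
      (π⁻¹ * ((monShiftSystem A p hdet).pair c k : K)) • 1 := extOp_anticomm A π
  have hEF : ∀ c k, extOp A π k * extOpDual A π c + extOpDual A π c * extOp A π k =
      @ite _ (k = c) (propDecidable _) 1 0 := fun c k => by
    convert extOp_extOpDual_anticomm (det_map_natCast_ne_zero hdet.1) (pi_ne_zero hpnorm hπ) c k
  obtain ⟨P, hP, hPF⟩ := ShiftSystem.exists_homotopicToId_finite (X := monShiftSystem A p hdet)
    hpnorm hπ hE hEF
  have key := hP.quasiIso (ShiftSystem.koszul_mul_self hpnorm hπ hE)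
    (fun b f => ShiftSystem.koszul_mem hpnorm hπ b) true hPF (t := toBFull hdet K)
    (D := dFull K π A)
  have hB := key ∅ (toBFull_injective hdet) (dFull_toBFull hdet hpnorm hπ)
    (QF := FinSuppB) (Q := OvercB p)
    (fun b => ⟨fun h => by
      obtain ⟨f, rfl⟩ := (overcB_iff_exists_toBFull hdet).1 h.overcB
      exact ⟨f, ⟨(finSuppB_toBFull_iff hdet f).1 h, fun j hj => hj.elim⟩, rfl⟩, by
      rintro ⟨f, ⟨hf, -⟩, rfl⟩
      exact (finSuppB_toBFull_iff hdet f).2 hf⟩)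
    (fun b => ⟨fun h => by
      obtain ⟨f, rfl⟩ := (overcB_iff_exists_toBFull hdet).1 h
      exact ⟨f, fun j hj => hj.elim, rfl⟩, by
      rintro ⟨f, -, rfl⟩
      exact (overcB_iff_exists_toBFull hdet).2 ⟨f, rfl⟩⟩)
  have hC := key {false} (toBFull_injective hdet) (dFull_toBFull hdet hpnorm hπ)
    (QF := CFin) (Q := COver p)
    (fun b => ⟨fun ⟨h, hg⟩ => by
      obtain ⟨f, rfl⟩ := (overcB_iff_exists_toBFull hdet).1 h.overcB
      refine ⟨f, ⟨(finSuppB_toBFull_iff hdet f).1 h, ?_⟩, rfl⟩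
      rintro _ rfl
      exact (gamOK_toBFull_iff hdet f).1 hg, by
      rintro ⟨f, ⟨hf, hg⟩, rfl⟩
      exact ⟨(finSuppB_toBFull_iff hdet f).2 hf, (gamOK_toBFull_iff hdet f).2 (hg _ rfl)⟩⟩)
    (fun b => ⟨fun ⟨h, hg⟩ => by
      obtain ⟨f, rfl⟩ := (overcB_iff_exists_toBFull hdet).1 h
      refine ⟨f, ?_, rfl⟩
      rintro _ rfl
      exact (gamOK_toBFull_iff hdet f).1 hg, by
      rintro ⟨f, hg, rfl⟩
      exact ⟨(overcB_iff_exists_toBFull hdet).2 ⟨f, rfl⟩,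
        (gamOK_toBFull_iff hdet f).2 (hg _ rfl)⟩⟩)
  exact ⟨hB.1, hB.2.1, hB.2.2.1, hB.2.2.2, hC.1, hC.2.1, hC.2.2.1, hC.2.2.2⟩
end
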